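/- Real Nullstellensatz for trace polynomials: Let J ⊆ TT_n be a two-sided ideal with tr(u)·I ∈ J for all u ∈ J, and let h ∈ TT_n. Then the following are equivalent: (i) for every X ∈ (M_n(ℝ))^g, if u(X) = 0 for every u ∈ J then h(X) = 0; (ii) there exists k ∈ ℕ such that −(hᵀh)^k ∈ Θ_n + J. -/

import Mathlib

noncomputable section

open Matrix

/-- The polynomial ring ℝ[ξ] in the g·n² commuting variables ξ_{jıȷ}. -/
abbrev PolyRing (n g : ℕ) : Type := MvPolynomial (Fin g × Fin n × Fin n) ℝ

/-- n×n matrices over ℝ[ξ]. -/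
abbrev MatP (n g : ℕ) : Type := Matrix (Fin n) (Fin n) (PolyRing n g)

/-- The generic matrices Ξ_j = (ξ_{jıȷ})_{ıȷ}. -/
def genMat (n g : ℕ) (j : Fin g) : MatP n g :=
  Matrix.of fun a b => MvPolynomial.X (j, a, b)

/-- The set of generic matrices together with their transposes. -/
def genSet (n g : ℕ) : Set (MatP n g) :=
  Set.range (genMat n g) ∪ Set.range (fun j => (genMat n g j)ᵀ)

/-- The trace ring TT_n: the ℝ-subalgebra of M_n(ℝ[ξ]) generated by the Ξ_j, their
transposes, and the scalar matrices tr(w)·1 for all products w of the Ξ_j, Ξ_jᵀ. -/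
def traceRing (n g : ℕ) : Subalgebra ℝ (MatP n g) :=
  Algebra.adjoin ℝ
    (genSet n g ∪
      {m | ∃ w ∈ Submonoid.closure (genSet n g), m = (Matrix.trace w) • (1 : MatP n g)})

/-- The center C_n of the trace ring: the scalar matrices in TT_n. -/
def centerSet (n g : ℕ) : Set (MatP n g) :=
  {c | c ∈ traceRing n g ∧ ∃ p : PolyRing n g, c = p • (1 : MatP n g)}

/-- Evaluation of a matrix of polynomials at a g-tuple X of n×n real matrices. -/
def evalMat (n g : ℕ) (X : Fin g → Matrix (Fin n) (Fin n) ℝ) (h : MatP n g) :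
    Matrix (Fin n) (Fin n) ℝ :=
  h.map (MvPolynomial.eval fun v => X v.1 v.2.1 v.2.2)

/-- The semialgebraic set K_S determined by S. -/
def KSet (n g : ℕ) (S : Set (MatP n g)) : Set (Fin g → Matrix (Fin n) (Fin n) ℝ) :=
  {X | ∀ s ∈ S, (evalMat n g X s).PosSemidef}

/-- Cyclic quadratic module in Sym TT_n. -/
def IsCyclicQM (n g : ℕ) (Q : Set (MatP n g)) : Prop :=
  (∀ q ∈ Q, q ∈ traceRing n g ∧ qᵀ = q) ∧
  (1 : MatP n g) ∈ Q ∧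
  (∀ a ∈ Q, ∀ b ∈ Q, a + b ∈ Q) ∧
  (∀ h ∈ traceRing n g, ∀ q ∈ Q, h * q * hᵀ ∈ Q) ∧
  (∀ q ∈ Q, (Matrix.trace q) • (1 : MatP n g) ∈ Q)

/-- Cyclic preordering: a cyclic quadratic module whose intersection with the center
is closed under multiplication. -/
def IsCyclicPreordering (n g : ℕ) (T : Set (MatP n g)) : Prop :=
  IsCyclicQM n g T ∧
  ∀ a ∈ T ∩ centerSet n g, ∀ b ∈ T ∩ centerSet n g, a * b ∈ T

/-- The smallest cyclic preordering T_S^tr containing S. -/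
def TtrS (n g : ℕ) (S : Set (MatP n g)) : Set (MatP n g) :=
  {a | ∀ T : Set (MatP n g), IsCyclicPreordering n g T → S ⊆ T → a ∈ T}

/-- Ω_n: finite sums of finite products of elements tr(hhᵀ)·1 with h ∈ TT_n. -/
def OmegaSet (n g : ℕ) : Set (MatP n g) :=
  (AddSubmonoid.closure
    ((Submonoid.closure
        {c : MatP n g | ∃ h ∈ traceRing n g,
          c = (Matrix.trace (h * hᵀ)) • (1 : MatP n g)} : Submonoid (MatP n g)) :
      Set (MatP n g)) : AddSubmonoid (MatP n g))

/-- Θ_n: finite sums of elements ω·h·hᵀ with ω ∈ Ω_n and h ∈ TT_n. -/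
def ThetaSet (n g : ℕ) : Set (MatP n g) :=
  (AddSubmonoid.closure
    {m : MatP n g | ∃ ω ∈ OmegaSet n g, ∃ h ∈ traceRing n g,
      m = ω * (h * hᵀ)} : AddSubmonoid (MatP n g))

set_option linter.unusedSectionVars false

open Polynomial

/-- Sign changes of polynomials over `L` produce roots. -/
def PolyIVT (L : Type*) [Field L] [LinearOrder L] : Prop :=
  ∀ (p : L[X]) (a b : L), a < b → p.eval a < 0 → 0 < p.eval b →
    ∃ c, a < c ∧ c < b ∧ p.eval c = 0

section IVT

variable {L : Type*} [Field L] [LinearOrder L] [IsStrictOrderedRing L]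

theorem PolyIVT.exists_root_of_mul_neg (hL : PolyIVT L) {p : L[X]} {a b : L} (hab : a < b)
    (h : p.eval a * p.eval b < 0) : ∃ c, a < c ∧ c < b ∧ p.eval c = 0 := by
  rcases mul_neg_iff.1 h with ⟨h1, h2⟩ | ⟨h1, h2⟩
  · obtain ⟨c, h3, h4, h5⟩ := hL (-p) a b hab (by simpa using h1) (by simpa using h2)
    exact ⟨c, h3, h4, by simpa using h5⟩
  · exact hL p a b hab h1 h2

theorem PolyIVT.mul_pos_of_forall_ne (hL : PolyIVT L) {p : L[X]} {a b : L}
    (h : ∀ c, a ≤ c ∧ c ≤ b ∨ b ≤ c ∧ c ≤ a → p.eval c ≠ 0) :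
    0 < p.eval a * p.eval b := by
  have ha : p.eval a ≠ 0 := h a (by rcases le_total a b with h | h <;> simp [h])
  have hb : p.eval b ≠ 0 := h b (by rcases le_total a b with h | h <;> simp [h])
  rcases (mul_ne_zero ha hb).lt_or_gt with h0 | h0
  · rcases lt_trichotomy a b with hab | hab | hab
    · obtain ⟨c, h1, h2, h3⟩ := hL.exists_root_of_mul_neg hab h0
      exact absurd h3 (h c (Or.inl ⟨h1.le, h2.le⟩))
    · subst hab
      exact absurd h0 (not_lt.2 (mul_self_nonneg _))
    · obtain ⟨c, h1, h2, h3⟩ := hL.exists_root_of_mul_neg hab (by rwa [mul_comm])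
      exact absurd h3 (h c (Or.inr ⟨h1.le, h2.le⟩))
  · exact h0

theorem PolyIVT.exists_derivative_root (hL : PolyIVT L) {p : L[X]} {x y : L} (hxy : x < y)
    (hx : p.eval x = 0) (hy : p.eval y = 0) (hx' : p.derivative.eval x ≠ 0)
    (hy' : p.derivative.eval y ≠ 0) : ∃ c, x < c ∧ c < y ∧ p.derivative.eval c = 0 := by
  have hp : p ≠ 0 := by rintro rfl; simp at hx'
  obtain ⟨z, hz, hmin⟩ := Finset.exists_min_image (p.roots.toFinset.filter (x < ·)) id
    ⟨y, by simp [hp, hy, hxy]⟩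
  simp only [Finset.mem_filter, Multiset.mem_toFinset, mem_roots hp, IsRoot.def, id] at hz hmin
  have hzy : z ≤ y := hmin y ⟨hy, hxy⟩
  by_cases hz' : p.derivative.eval z = 0
  · refine ⟨z, hz.2, lt_of_le_of_ne hzy ?_, hz'⟩
    rintro rfl; exact hy' hz'
  obtain ⟨g, hg⟩ : (X - C x) * (X - C z) ∣ p := by
    apply IsCoprime.mul_dvd
    · exact (isCoprime_X_sub_C_of_isUnit_sub (sub_ne_zero.2 hz.2.ne).isUnit)
    · exact dvd_iff_isRoot.2 hx
    · exact dvd_iff_isRoot.2 hz.1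
  have e1 : p.derivative.eval x = (x - z) * g.eval x := by
    rw [hg]; simp
  have e2 : p.derivative.eval z = (z - x) * g.eval z := by
    rw [hg]; simp
  have hgx : g.eval x ≠ 0 := fun h => hx' (by rw [e1, h, mul_zero])
  have hgz : g.eval z ≠ 0 := fun h => hz' (by rw [e2, h, mul_zero])
  have hpos : 0 < g.eval x * g.eval z := by
    refine (mul_ne_zero hgx hgz).lt_or_gt.resolve_left fun h => ?_
    obtain ⟨c, h1, h2, h3⟩ := hL.exists_root_of_mul_neg hz.2 h
    exact absurd (hmin c ⟨by rw [hg]; simp [h3], h1⟩) (not_le.2 h2)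
  have hneg : p.derivative.eval x * p.derivative.eval z < 0 := by
    rw [e1, e2]
    have : 0 < (z - x) * (z - x) := mul_pos (sub_pos.2 hz.2) (sub_pos.2 hz.2)
    nlinarith [mul_pos this hpos]
  obtain ⟨c, h1, h2, h3⟩ := hL.exists_root_of_mul_neg hz.2 hneg
  exact ⟨c, h1, h2.trans_le hzy, h3⟩

end IVT

section Compat

variable {E L S : Type*} [CommRing E] [Field L] [LinearOrder L] [IsStrictOrderedRing L]
  [Field S] [LinearOrder S] [IsStrictOrderedRing S]

/-- All roots of `q` in `L` and in `S` come from `E`. -/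
def RootsFrom (i : E →+* L) (j : E →+* S) (q : E[X]) : Prop :=
  (∀ x, q.eval₂ i x = 0 → ∃ e, i e = x) ∧ (∀ y, q.eval₂ j y = 0 → ∃ e, j e = y)

theorem compat_eq_zero_iff {i : E →+* L} {j : E →+* S} (hc : ∀ e, 0 < i e ↔ 0 < j e) (e : E) :
    i e = 0 ↔ j e = 0 := by
  have h1 := hc e
  have h2 := hc (-e)
  simp only [map_neg, Left.neg_pos_iff] at h2
  constructor
  · intro h
    rw [h] at h1 h2
    simp only [lt_self_iff_false, false_iff, not_lt] at h1 h2
    exact le_antisymm h1 h2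
  · intro h
    rw [h] at h1 h2
    simp only [lt_self_iff_false, iff_false, not_lt] at h1 h2
    exact le_antisymm h1 h2

theorem compat_lt_iff {i : E →+* L} {j : E →+* S} (hc : ∀ e, 0 < i e ↔ 0 < j e) (e f : E) :
    i e < i f ↔ j e < j f := by
  have := hc (f - e)
  simpa using this

/-- An element of `E` on the same side of each member of a finite set as `t`. -/
theorem exists_same_side (i : E →+* L) (hinv : ∃ e : E, 2 * e = 1) (t : L) (Γ : Finset E) :
    ∃ m : E, ∀ e ∈ Γ, (i e < t → i e < i m) ∧ (t < i e → i m < i e) := by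
  classical
  obtain ⟨h, hh⟩ := hinv
  have hh' : 2 * i h = 1 := by
    have := congrArg i hh; rwa [map_mul, map_ofNat, map_one] at this
  rcases (Γ.filter (fun e => i e < t)).eq_empty_or_nonempty with hA | hA <;>
  rcases (Γ.filter (fun e => t < i e)).eq_empty_or_nonempty with hB | hB
  · refine ⟨0, fun e he => ⟨fun h => ?_, fun h => ?_⟩⟩
    · exact (Finset.filter_eq_empty_iff.1 hA he h).elim
    · exact (Finset.filter_eq_empty_iff.1 hB he h).elim
  · obtain ⟨b, hb, hbm⟩ := Finset.exists_min_image _ i hB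
    refine ⟨b - 1, fun e he => ⟨fun h => ?_, fun h => ?_⟩⟩
    · exact (Finset.filter_eq_empty_iff.1 hA he h).elim
    · have := hbm e (Finset.mem_filter.2 ⟨he, h⟩)
      simp only [map_sub, map_one]; linarith
  · obtain ⟨a, ha, ham⟩ := Finset.exists_max_image _ i hA
    refine ⟨a + 1, fun e he => ⟨fun h => ?_, fun h => ?_⟩⟩
    · have := ham e (Finset.mem_filter.2 ⟨he, h⟩)
      simp only [map_add, map_one]; linarith
    · exact (Finset.filter_eq_empty_iff.1 hB he h).elim
  · obtain ⟨a, ha, ham⟩ := Finset.exists_max_image _ i hA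
    obtain ⟨b, hb, hbm⟩ := Finset.exists_min_image _ i hB
    have hab : i a < i b := (Finset.mem_filter.1 ha).2.trans (Finset.mem_filter.1 hb).2
    have hm : 2 * i ((a + b) * h) = i a + i b := by
      rw [map_mul, map_add]; linear_combination (i a + i b) * hh'
    refine ⟨(a + b) * h, fun e he => ⟨fun h => ?_, fun h => ?_⟩⟩
    · have := ham e (Finset.mem_filter.2 ⟨he, h⟩)
      linarith
    · have := hbm e (Finset.mem_filter.2 ⟨he, h⟩)
      linarith

theorem eval₂_pos_of_same_cut [IsDomain E] (hL : PolyIVT L) (hS : PolyIVT S) {i : E →+* L}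
    {j : E →+* S} (hi : Function.Injective i) (hc : ∀ e, 0 < i e ↔ 0 < j e)
    (hinv : ∃ e : E, 2 * e = 1) {t : L} {y : S} (ht : ∀ e, i e ≠ t)
    {q : E[X]} (h1 : ∀ e, q.eval e = 0 → i e < t → j e < y)
    (h2 : ∀ e, q.eval e = 0 → t < i e → y < j e) (hq : q ≠ 0) (hqr : RootsFrom i j q) (hpos : 0 < q.eval₂ i t) :
    0 < q.eval₂ j y := by
  classical
  have hj : Function.Injective j := by
    rw [injective_iff_map_eq_zero]
    intro e he
    exact (injective_iff_map_eq_zero i).1 hi e ((compat_eq_zero_iff hc e).2 he)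
  obtain ⟨m, hm⟩ := exists_same_side i hinv t q.roots.toFinset
  have hm' : ∀ e, q.eval e = 0 → (i e < t → i e < i m) ∧ (t < i e → i m < i e) :=
    fun e he => hm e (by simp [hq, he])
  have key1 : 0 < (q.map i).eval t * (q.map i).eval (i m) := by
    apply hL.mul_pos_of_forall_ne
    intro c hc' h0
    rw [eval_map] at h0
    obtain ⟨e, rfl⟩ := hqr.1 c h0
    rw [eval₂_at_apply] at h0
    have h0' := hm' e ((injective_iff_map_eq_zero i).1 hi _ h0)
    rcases (ht e).lt_or_gt with h | h
    · have := h0'.1 h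
      rcases hc' with h | h <;> [exact absurd h.1 (not_le.2 (by assumption));
        exact absurd h.1 (not_le.2 this)]
    · have := h0'.2 h
      rcases hc' with h | h <;> [exact absurd h.2 (not_le.2 this);
        exact absurd h.2 (not_le.2 (by assumption))]
  have key2 : 0 < (q.map j).eval y * (q.map j).eval (j m) := by
    apply hS.mul_pos_of_forall_ne
    intro c hc' h0
    rw [eval_map] at h0
    obtain ⟨e, rfl⟩ := hqr.2 c h0
    rw [eval₂_at_apply] at h0
    have h0' := hm' e ((injective_iff_map_eq_zero j).1 hj _ h0)
    rcases (ht e).lt_or_gt with h | h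
    · have h3 := (compat_lt_iff hc _ _).1 (h0'.1 h)
      have h4 := h1 e ((injective_iff_map_eq_zero j).1 hj _ h0) h
      rcases hc' with h | h <;> [exact absurd h.1 (not_le.2 h4);
        exact absurd h.1 (not_le.2 h3)]
    · have h3 := (compat_lt_iff hc _ _).1 (h0'.2 h)
      have h4 := h2 e ((injective_iff_map_eq_zero j).1 hj _ h0) h
      rcases hc' with h | h <;> [exact absurd h.2 (not_le.2 h3);
        exact absurd h.2 (not_le.2 h4)]
  rw [eval_map, eval_map, eval₂_at_apply] at key1 key2
  have h3 : 0 < i (q.eval m) := (pos_iff_pos_of_mul_pos key1).1 hpos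
  exact (pos_iff_pos_of_mul_pos key2).2 ((hc _).1 h3)

theorem eval₂_pos_iff_of_same_cut [IsDomain E] (hL : PolyIVT L) (hS : PolyIVT S) {i : E →+* L}
    {j : E →+* S} (hi : Function.Injective i) (hc : ∀ e, 0 < i e ↔ 0 < j e)
    (hinv : ∃ e : E, 2 * e = 1) {t : L} {y : S} (ht : ∀ e, i e ≠ t)
    {q : E[X]} (h1 : ∀ e, q.eval e = 0 → i e < t → j e < y)
    (h2 : ∀ e, q.eval e = 0 → t < i e → y < j e) (hqr : q ≠ 0 → RootsFrom i j q) :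
    0 < q.eval₂ i t ↔ 0 < q.eval₂ j y := by
  rcases eq_or_ne q 0 with rfl | hq
  · simp
  have hqr := hqr hq
  have hne : q.eval₂ i t ≠ 0 := fun h => by
    obtain ⟨e, he⟩ := hqr.1 t h
    exact ht e he
  refine ⟨eval₂_pos_of_same_cut hL hS hi hc hinv ht h1 h2 hq hqr, fun h => ?_⟩
  by_contra hn
  have h3 : 0 < (-q).eval₂ i t := by
    rw [eval₂_neg]; exact neg_pos.2 (lt_of_le_of_ne (not_lt.1 hn) hne)
  have h4 := eval₂_pos_of_same_cut hL hS hi hc hinv ht (q := -q)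
    (fun e he => h1 e (by simpa using he)) (fun e he => h2 e (by simpa using he))
    (neg_ne_zero.2 hq)
    (by simpa [RootsFrom] using hqr) h3
  rw [eval₂_neg] at h4
  linarith

/-- Roots of a monic polynomial over `E` are bounded by elements of `E`. -/
theorem exists_root_bound (i : E →+* L) {p : E[X]} (hp : p.Monic) :
    ∃ B : E, ∀ x, p.eval₂ i x = 0 → -i B < x ∧ x < i B := by
  refine ⟨2 + ∑ k ∈ Finset.range p.natDegree, (1 + p.coeff k ^ 2), fun x hx => ?_⟩
  rw [← abs_lt]
  have hB : i (2 + ∑ k ∈ Finset.range p.natDegree, (1 + p.coeff k ^ 2)) =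
    2 + ∑ k ∈ Finset.range p.natDegree, (1 + i (p.coeff k) ^ 2) := by
    simp [map_ofNat i 2]
  rw [hB]
  have hnn : ∀ k, |i (p.coeff k)| ≤ 1 + i (p.coeff k) ^ 2 := fun k => by
    rw [abs_le]; constructor <;> nlinarith [sq_nonneg (i (p.coeff k) + 1),
      sq_nonneg (i (p.coeff k) - 1)]
  have hsum : ∑ k ∈ Finset.range p.natDegree, |i (p.coeff k)| ≤
      ∑ k ∈ Finset.range p.natDegree, (1 + i (p.coeff k) ^ 2) :=
    Finset.sum_le_sum fun k _ => hnn k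
  have hsum0 : 0 ≤ ∑ k ∈ Finset.range p.natDegree, |i (p.coeff k)| :=
    Finset.sum_nonneg fun k _ => abs_nonneg _
  rcases lt_or_ge |x| 1 with h | h
  · linarith
  suffices |x| ≤ ∑ k ∈ Finset.range p.natDegree, |i (p.coeff k)| by linarith
  rw [eval₂_eq_sum_range, Finset.sum_range_succ, hp.coeff_natDegree, map_one, one_mul] at hx
  rcases Nat.eq_zero_or_pos p.natDegree with hd | hd
  · rw [hd] at hx; simp at hx
  obtain ⟨d, hd'⟩ : ∃ d, p.natDegree = d + 1 := Nat.exists_eq_succ_of_ne_zero hd.ne'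
  rw [hd'] at hx ⊢
  have h1 : |x| ^ (d + 1) ≤ (∑ k ∈ Finset.range (d + 1), |i (p.coeff k)|) * |x| ^ d := by
    have : x ^ (d + 1) = - ∑ k ∈ Finset.range (d + 1), i (p.coeff k) * x ^ k := by
      linear_combination hx
    rw [← abs_pow, this, abs_neg, Finset.sum_mul]
    refine (Finset.abs_sum_le_sum_abs _ _).trans (Finset.sum_le_sum fun k hk => ?_)
    rw [abs_mul, abs_pow]
    exact mul_le_mul_of_nonneg_left (pow_le_pow_right₀ h
      (Nat.lt_succ_iff.1 (Finset.mem_range.1 hk))) (abs_nonneg _)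
  rw [pow_succ, mul_comm] at h1
  exact le_of_mul_le_mul_right h1 (pow_pos (by linarith) d)

end Compat

section Core

variable {E L S : Type*} [CommRing E] [Field L] [LinearOrder L] [IsStrictOrderedRing L]
  [Field S] [LinearOrder S] [IsStrictOrderedRing S]

/-- If `p` has lowest degree among the polynomials over `E` with a root `α` outside `E`, then
some element of `S` satisfies the same polynomial inequalities over `E` as `α`. -/
theorem exists_conjugate_root [IsDomain E] (hL : PolyIVT L) (hS : PolyIVT S) {i : E →+* L}
    {j : E →+* S} (hi : Function.Injective i) (hc : ∀ e, 0 < i e ↔ 0 < j e)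
    (hinv : ∃ e : E, 2 * e = 1) {p : E[X]} (hp : p.Monic)
    (hd : ∀ q : E[X], q ≠ 0 → q.natDegree < p.natDegree → RootsFrom i j q) {α : L}
    (hα : p.eval₂ i α = 0) (hα' : ∀ e, i e ≠ α) :
    ∃ α' : S, ∀ q : E[X], 0 < q.eval₂ i α ↔ 0 < q.eval₂ j α' := by
  classical
  have hj : Function.Injective j := by
    rw [injective_iff_map_eq_zero]
    intro e he
    exact (injective_iff_map_eq_zero i).1 hi e ((compat_eq_zero_iff hc e).2 he)
  have hlt := compat_lt_iff hc
  have : CharZero E := i.charZero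
  have hdpos : p.natDegree ≠ 0 := by
    intro h0
    rw [hp.natDegree_eq_zero.1 h0] at hα
    simp at hα
  have hdp : derivative p ≠ 0 := by
    intro h0
    have h1 : (derivative p).coeff (p.natDegree - 1) = 0 := by rw [h0, coeff_zero]
    rw [coeff_derivative, Nat.sub_add_cancel (Nat.pos_of_ne_zero hdpos), hp.coeff_natDegree,
      one_mul] at h1
    have : ((p.natDegree - 1 + 1 : ℕ) : E) = 0 := by exact_mod_cast h1
    rw [Nat.cast_eq_zero] at this
    omega
  have hdp' := hd _ hdp (natDegree_derivative_lt hdpos)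
  have hnoroot : ∀ e, p.eval e ≠ 0 := by
    intro e he
    obtain ⟨g, hg⟩ := dvd_iff_isRoot.2 (show p.IsRoot e from he)
    have hgm : g.Monic := (monic_X_sub_C e).of_mul_monic_left (hg ▸ hp)
    have hgd : g.natDegree < p.natDegree := by
      rw [hg, (monic_X_sub_C e).natDegree_mul hgm, natDegree_X_sub_C]; omega
    rw [hg, eval₂_mul, eval₂_sub, eval₂_X, eval₂_C] at hα
    rcases mul_eq_zero.1 hα with h | h
    · exact hα' e (sub_eq_zero.1 h).symm
    · obtain ⟨f, hf⟩ := (hd g hgm.ne_zero hgd).1 α h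
      exact hα' f hf
  obtain ⟨B, hB⟩ := exists_root_bound i hp
  have hBα := hB α hα
  obtain ⟨a, ha, ham⟩ := Finset.exists_max_image
    (insert (-B) ((derivative p).roots.toFinset.filter (fun e => i e < α))) i (by simp)
  obtain ⟨b, hb, hbm⟩ := Finset.exists_min_image
    (insert B ((derivative p).roots.toFinset.filter (fun e => α < i e))) i (by simp)
  have haα : i a < α := by
    rcases Finset.mem_insert.1 ha with rfl | h
    · rw [map_neg]; exact hBα.1
    · exact (Finset.mem_filter.1 h).2
  have hbα : α < i b := by
    rcases Finset.mem_insert.1 hb with rfl | h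
    · exact hBα.2
    · exact (Finset.mem_filter.1 h).2
  have hnod : ∀ e, i a < i e → i e < i b → (derivative p).eval e ≠ 0 := by
    intro e h1 h2 h0
    have he : e ∈ (derivative p).roots.toFinset := by simp [hdp, h0]
    rcases (hα' e).lt_or_gt with h | h
    · exact absurd (ham e (Finset.mem_insert_of_mem (Finset.mem_filter.2 ⟨he, h⟩)))
        (not_le.2 h1)
    · exact absurd (hbm e (Finset.mem_insert_of_mem (Finset.mem_filter.2 ⟨he, h⟩)))
        (not_le.2 h2)
  have hnodL : ∀ x, i a < x → x < i b → (derivative p).eval₂ i x ≠ 0 := by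
    intro x h1 h2 h0
    obtain ⟨e, rfl⟩ := hdp'.1 x h0
    rw [eval₂_at_apply, map_eq_zero_iff i hi] at h0
    exact hnod e h1 h2 h0
  have hnodS : ∀ x, j a < x → x < j b → (derivative p).eval₂ j x ≠ 0 := by
    intro x h1 h2 h0
    obtain ⟨e, rfl⟩ := hdp'.2 x h0
    rw [eval₂_at_apply, map_eq_zero_iff j hj] at h0
    exact hnod e ((hlt _ _).2 h1) ((hlt _ _).2 h2) h0
  have huniqL : ∀ x y, i a < x → x < y → y < i b → p.eval₂ i x = 0 → p.eval₂ i y = 0 →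
      False := by
    intro x y h1 h2 h3 h4 h5
    obtain ⟨c, h6, h7, h8⟩ := hL.exists_derivative_root (p := p.map i) h2
      (by rwa [eval_map]) (by rwa [eval_map])
      (by rw [derivative_map, eval_map]; exact hnodL x h1 (h2.trans h3))
      (by rw [derivative_map, eval_map]; exact hnodL y (h1.trans h2) h3)
    rw [derivative_map, eval_map] at h8
    exact hnodL c (h1.trans h6) (h7.trans h3) h8
  have huniqS : ∀ x y, j a < x → x < y → y < j b → p.eval₂ j x = 0 → p.eval₂ j y = 0 →
      False := by
    intro x y h1 h2 h3 h4 h5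
    obtain ⟨c, h6, h7, h8⟩ := hS.exists_derivative_root (p := p.map j) h2
      (by rwa [eval_map]) (by rwa [eval_map])
      (by rw [derivative_map, eval_map]; exact hnodS x h1 (h2.trans h3))
      (by rw [derivative_map, eval_map]; exact hnodS y (h1.trans h2) h3)
    rw [derivative_map, eval_map] at h8
    exact hnodS c (h1.trans h6) (h7.trans h3) h8
  obtain ⟨g, hg⟩ := dvd_iff_isRoot.2 (show (p.map i).IsRoot α by rwa [IsRoot.def, eval_map])
  have hroot : ∀ a₁ b₁, i a ≤ i a₁ → i a₁ < α → α < i b₁ → i b₁ ≤ i b →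
      ∃ y, j a₁ < y ∧ y < j b₁ ∧ p.eval₂ j y = 0 := by
    intro a₁ b₁ h1 h2 h3 h4
    have hgpos : 0 < g.eval (i a₁) * g.eval (i b₁) := by
      apply hL.mul_pos_of_forall_ne
      intro c hc' h0
      have hc1 : i a₁ ≤ c ∧ c ≤ i b₁ := by
        rcases hc' with h | h
        · exact h
        · exact absurd ((h2.trans h3).trans_le (h.1.trans h.2)) (lt_irrefl _)
      have hpc : p.eval₂ i c = 0 := by rw [← eval_map, hg, eval_mul, h0, mul_zero]
      have hca : i a₁ < c := by
        refine lt_of_le_of_ne hc1.1 ?_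
        rintro rfl
        rw [eval₂_at_apply, map_eq_zero_iff i hi] at hpc
        exact hnoroot _ hpc
      have hcb : c < i b₁ := by
        refine lt_of_le_of_ne hc1.2 ?_
        rintro rfl
        rw [eval₂_at_apply, map_eq_zero_iff i hi] at hpc
        exact hnoroot _ hpc
      rcases lt_trichotomy c α with h | rfl | h
      · exact huniqL c α (h1.trans_lt hca) h hbα hpc hα
      · have := hnodL c haα hbα
        rw [← eval_map, ← derivative_map, hg] at this
        simp [h0] at this
      · exact huniqL α c haα h (hcb.trans_le h4) hα hpc
    have hneg : 0 < i (-(p.eval a₁ * p.eval b₁)) := by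
      have e1 : i (p.eval a₁) = (i a₁ - α) * g.eval (i a₁) := by
        rw [← eval₂_at_apply, ← eval_map, hg]; simp
      have e2 : i (p.eval b₁) = (i b₁ - α) * g.eval (i b₁) := by
        rw [← eval₂_at_apply, ← eval_map, hg]; simp
      rw [map_neg, map_mul, e1, e2]
      have : 0 < (α - i a₁) * (i b₁ - α) := mul_pos (sub_pos.2 h2) (sub_pos.2 h3)
      nlinarith [mul_pos this hgpos]
    rw [hc] at hneg
    obtain ⟨y, h5, h6, h7⟩ := hS.exists_root_of_mul_neg (p := p.map j)
      ((hlt a₁ b₁).1 (h2.trans h3)) (by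
        rw [eval_map, eval_map, eval₂_at_apply, eval₂_at_apply, ← map_mul]
        simpa using hneg)
    exact ⟨y, h5, h6, by rwa [eval_map] at h7⟩
  obtain ⟨α', h1, h2, h3⟩ := hroot a b le_rfl haα hbα le_rfl
  refine ⟨α', ?_⟩
  have heq : ∀ y, j a < y → y < j b → p.eval₂ j y = 0 → y = α' := by
    intro y h4 h5 h6
    rcases lt_trichotomy y α' with h | h | h
    · exact (huniqS y α' h4 h h2 h6 h3).elim
    · exact h
    · exact (huniqS α' y h1 h h5 h3 h6).elim
  have hle : ∀ e f, i e ≤ i f → j e ≤ j f := fun e f h =>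
    not_lt.1 fun h' => absurd ((hlt _ _).2 h') (not_lt.2 h)
  have hc1 : ∀ e, i e < α → j e < α' := by
    intro e he
    rcases le_total (i e) (i a) with h | h
    · exact (hle _ _ h).trans_lt h1
    · obtain ⟨y, h4, h5, h6⟩ := hroot e b h he hbα le_rfl
      rwa [heq y ((hle _ _ h).trans_lt h4) h5 h6] at h4
  have hc2 : ∀ e, α < i e → α' < j e := by
    intro e he
    rcases le_total (i b) (i e) with h | h
    · exact h2.trans_le (hle _ _ h)
    · obtain ⟨y, h4, h5, h6⟩ := hroot a e le_rfl haα he h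
      rwa [heq y h4 (h5.trans_le (hle _ _ h)) h6] at h5
  intro q
  rw [← eval₂_modByMonic_eq_self_of_root hα, ← eval₂_modByMonic_eq_self_of_root h3]
  refine eval₂_pos_iff_of_same_cut hL hS hi hc hinv hα'
    (fun e _ => hc1 e) (fun e _ => hc2 e) fun hq => hd _ hq ?_
  exact natDegree_modByMonic_lt _ hp (fun h => hdpos (by simp [h]))

end Core

section CompatSubring

variable {L S : Type*} [Field L] [LinearOrder L] [IsStrictOrderedRing L]
  [Field S] [LinearOrder S] [IsStrictOrderedRing S]

/-- A subring of `L × S` on which both projections see the same signs. -/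
def IsSignCompat (G : Subring (L × S)) : Prop := ∀ z ∈ G, 0 < z.1 ↔ 0 < z.2

/-- First projection of a subring of a product. -/
def subringFst (G : Subring (L × S)) : G →+* L := (RingHom.fst L S).comp G.subtype

/-- Second projection of a subring of a product. -/
def subringSnd (G : Subring (L × S)) : G →+* S := (RingHom.snd L S).comp G.subtype

theorem IsSignCompat.compat {G : Subring (L × S)} (hG : IsSignCompat G) (e : G) :
    0 < subringFst G e ↔ 0 < subringSnd G e := hG e e.2

theorem IsSignCompat.fst_injective {G : Subring (L × S)} (hG : IsSignCompat G) :
    Function.Injective (subringFst G) := by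
  rw [injective_iff_map_eq_zero]
  intro e he
  exact Subtype.ext (Prod.ext he ((compat_eq_zero_iff hG.compat e).1 he))

theorem IsSignCompat.snd_injective {G : Subring (L × S)} (hG : IsSignCompat G) :
    Function.Injective (subringSnd G) := by
  rw [injective_iff_map_eq_zero]
  intro e he
  exact Subtype.ext (Prod.ext ((compat_eq_zero_iff hG.compat e).2 he) he)

theorem exists_signCompat_adjoin {E : Type*} [CommRing E] {i : E →+* L} {j : E →+* S} {t : L}
    {y : S} (h : ∀ p : E[X], 0 < p.eval₂ i t ↔ 0 < p.eval₂ j y) :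
    ∃ G' : Subring (L × S), (∀ e, (i e, j e) ∈ G') ∧ IsSignCompat G' ∧ (t, y) ∈ G' := by
  refine ⟨(eval₂RingHom (i.prod j) (t, y)).range, fun e => ⟨C e, by simp⟩, ?_, ⟨X, by simp⟩⟩
  rintro _ ⟨p, rfl⟩
  have h1 := hom_eval₂ p (i.prod j) (RingHom.fst L S) (t, y)
  have h2 := hom_eval₂ p (i.prod j) (RingHom.snd L S) (t, y)
  simp only [RingHom.coe_fst, RingHom.coe_snd, RingHom.fst_comp_prod,
    RingHom.snd_comp_prod] at h1 h2
  rw [coe_eval₂RingHom, h1, h2]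
  exact h p

theorem IsSignCompat.exists_adjoin {G : Subring (L × S)} {t : L} {y : S}
    (h : ∀ p : G[X], 0 < p.eval₂ (subringFst G) t ↔ 0 < p.eval₂ (subringSnd G) y) :
    ∃ G' : Subring (L × S), G ≤ G' ∧ IsSignCompat G' ∧ (t, y) ∈ G' := by
  obtain ⟨G', h1, h2⟩ := exists_signCompat_adjoin h
  exact ⟨G', fun z hz => h1 ⟨z, hz⟩, h2⟩

theorem IsSignCompat.exists_maximal {G : Subring (L × S)} (hG : IsSignCompat G) :
    ∃ M, G ≤ M ∧ IsSignCompat M ∧ ∀ G', IsSignCompat G' → M ≤ G' → G' ≤ M := by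
  obtain ⟨M, hGM, hM⟩ := zorn_le_nonempty₀ {G : Subring (L × S) | IsSignCompat G} (by
    intro c hc hchain y hy
    refine ⟨sSup c, ?_, fun z hz => le_sSup hz⟩
    intro z hz
    obtain ⟨H, hH, hzH⟩ := (Subring.mem_sSup_of_directedOn ⟨y, hy⟩ hchain.directedOn).1 hz
    exact hc hH z hzH) G hG
  exact ⟨M, hGM, hM.1, fun G' h1 h2 => hM.2 h1 h2⟩

theorem eval₂_inv_pos_iff {R K : Type*} [CommRing R] [Field K] [LinearOrder K]
    [IsStrictOrderedRing K] (i : R →+* K) {z : R} (hi : i z ≠ 0) (p : R[X]) :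
    0 < p.eval₂ i (i z)⁻¹ ↔ 0 < i (p.reverse.eval z * z ^ p.natDegree) := by
  have : Invertible (i z)⁻¹ := invertibleOfNonzero (inv_ne_zero hi)
  have h := eval₂_reverse_mul_pow i (i z)⁻¹ p
  rw [invOf_eq_inv, inv_inv] at h
  rw [← h, map_mul, eval₂_at_apply, map_pow]
  have h3 : 0 < (i z ^ p.natDegree) ^ 2 := (sq_nonneg _).lt_of_ne' (pow_ne_zero _ (pow_ne_zero _ hi))
  rw [← mul_pos_iff_of_pos_right h3]
  have h4 : i (p.reverse.eval z) * (i z)⁻¹ ^ p.natDegree * (i z ^ p.natDegree) ^ 2 =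
    i (p.reverse.eval z) * i z ^ p.natDegree := by
    rw [inv_pow]
    have := pow_ne_zero p.natDegree hi
    field_simp
  rw [h4]

theorem IsSignCompat.exists_inv {M : Subring (L × S)} (hM : IsSignCompat M)
    (hmax : ∀ G', IsSignCompat G' → M ≤ G' → G' ≤ M) (z : M) (hz : z ≠ 0) :
    ∃ w : M, z * w = 1 := by
  have h1 : subringFst M z ≠ 0 := fun h => hz (hM.fst_injective (by simpa using h))
  have h2 : subringSnd M z ≠ 0 := fun h => hz (hM.snd_injective (by simpa using h))
  obtain ⟨G', h3, h4, h5⟩ := IsSignCompat.exists_adjoin (G := M) (t := (subringFst M z)⁻¹)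
    (y := (subringSnd M z)⁻¹) (fun p => by
      rw [eval₂_inv_pos_iff _ h1, eval₂_inv_pos_iff _ h2]; exact hM.compat _)
  refine ⟨⟨_, hmax G' h4 h3 h5⟩, Subtype.ext (Prod.ext ?_ ?_)⟩
  · exact mul_inv_cancel₀ h1
  · exact mul_inv_cancel₀ h2

theorem IsSignCompat.rootsFrom (hL : PolyIVT L) (hS : PolyIVT S) {M : Subring (L × S)}
    (hM : IsSignCompat M) (hmax : ∀ G', IsSignCompat G' → M ≤ G' → G' ≤ M) :
    ∀ (d : ℕ) (q : M[X]), q ≠ 0 → q.natDegree = d →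
      RootsFrom (subringFst M) (subringSnd M) q := by
  have : IsDomain M := hM.fst_injective.isDomain (subringFst M)
  have : CharZero M := (subringFst M).charZero
  have hinv : ∃ e : M, 2 * e = 1 := hM.exists_inv hmax 2 two_ne_zero
  intro d
  induction d using Nat.strong_induction_on with
  | _ d ih =>
  intro q hq hqd
  obtain ⟨w, hw⟩ := hM.exists_inv hmax _ (leadingCoeff_ne_zero.2 hq)
  have hmon : (C w * q).Monic := by
    rw [Monic, leadingCoeff_mul, leadingCoeff_C, mul_comm, hw]
  have hdeg : (C w * q).natDegree = d := by
    rw [natDegree_C_mul (by rintro rfl; simp at hw), hqd]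
  constructor
  · intro x hx
    by_contra! hne
    obtain ⟨y, hy⟩ := exists_conjugate_root hL hS hM.fst_injective hM.compat hinv hmon
      (fun r hr hrd => ih _ (hdeg ▸ hrd) r hr rfl) (by rw [eval₂_mul, hx, mul_zero]) hne
    obtain ⟨G', h3, h4, h5⟩ := IsSignCompat.exists_adjoin hy
    exact hne ⟨_, hmax G' h4 h3 h5⟩ rfl
  · intro y hy
    by_contra! hne
    obtain ⟨x, hx⟩ := exists_conjugate_root hS hL hM.snd_injective (fun e => (hM.compat e).symm)
      hinv hmon (fun r hr hrd => (ih _ (hdeg ▸ hrd) r hr rfl).symm)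
      (by rw [eval₂_mul, hy, mul_zero]) hne
    obtain ⟨G', h3, h4, h5⟩ := IsSignCompat.exists_adjoin (fun p => (hx p).symm)
    exact hne ⟨_, hmax G' h4 h3 h5⟩ rfl

end CompatSubring

section Germ

open Filter

variable {S : Type} [Field S] [LinearOrder S] [IsStrictOrderedRing S]

/-- The diagonal embedding of a field in an ultrapower. -/
def germConst {ι : Type} (u : Ultrafilter ι) (S : Type) [Field S] :
    S →+* (u : Filter ι).Germ S :=
  (Germ.coeRingHom (u : Filter ι)).comp (Pi.constRingHom ι S)

theorem germConst_apply {ι : Type} (u : Ultrafilter ι) (s : S) :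
    germConst u S s = ((fun _ => s : ι → S) : (u : Filter ι).Germ S) := rfl

theorem germ_polynomial_repr {ι : Type} (u : Ultrafilter ι) (p : ((u : Filter ι).Germ S)[X]) :
    ∃ P : ι → S[X], ∀ z : ι → S,
      p.eval (z : (u : Filter ι).Germ S) = ((fun y => (P y).eval (z y) : ι → S) :
        (u : Filter ι).Germ S) := by
  induction p using Polynomial.induction_on' with
  | add p q hp hq =>
    obtain ⟨P, hP⟩ := hp
    obtain ⟨Q, hQ⟩ := hq
    refine ⟨fun y => P y + Q y, fun z => ?_⟩
    rw [eval_add, hP, hQ, ← Germ.coe_add]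
    congr 1
    funext y
    simp
  | monomial k a =>
    induction a using Germ.inductionOn with
    | _ f =>
    refine ⟨fun y => monomial k (f y), fun z => ?_⟩
    rw [eval_monomial, ← Germ.coe_pow, ← Germ.coe_mul]
    congr 1
    funext y
    simp

theorem PolyIVT.germ (hS : PolyIVT S) {ι : Type} (u : Ultrafilter ι) :
    PolyIVT ((u : Filter ι).Germ S) := by
  intro p a b hab ha hb
  obtain ⟨P, hP⟩ := germ_polynomial_repr u p
  induction a using Germ.inductionOn with
  | _ a =>
  induction b using Germ.inductionOn with
  | _ b =>
  rw [hP, ← Germ.coe_zero, Germ.coe_lt] at ha hb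
  rw [Germ.coe_lt] at hab
  have h : ∀ y, ∃ c, (a y < b y ∧ (P y).eval (a y) < 0 ∧ 0 < (P y).eval (b y)) →
      (a y < c ∧ c < b y ∧ (P y).eval c = 0) := by
    intro y
    by_cases h : a y < b y ∧ (P y).eval (a y) < 0 ∧ 0 < (P y).eval (b y)
    · obtain ⟨c, hc⟩ := hS (P y) (a y) (b y) h.1 h.2.1 h.2.2
      exact ⟨c, fun _ => hc⟩
    · exact ⟨0, fun h' => absurd h' h⟩
  choose c hc using h
  have hev : ∀ᶠ y in (u : Filter ι), a y < c y ∧ c y < b y ∧ (P y).eval (c y) = 0 := by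
    filter_upwards [hab, ha, hb] with y h1 h2 h3
    exact hc y ⟨h1, h2, h3⟩
  refine ⟨(c : (u : Filter ι).Germ S), ?_, ?_, ?_⟩
  · rw [Germ.coe_lt]; exact hev.mono fun y h => h.1
  · rw [Germ.coe_lt]; exact hev.mono fun y h => h.2.1
  · rw [hP, ← Germ.coe_zero, Germ.coe_eq]; exact hev.mono fun y h => h.2.2

/-- Finite systems of equations and inequations over `ℝ` solvable in `S` are solvable in `ℝ`. -/
def SolvesInReal (σ : Type) {S : Type} [Field S] (k : ℝ →+* S) : Prop :=
  ∀ (G : Finset (MvPolynomial σ ℝ)) (c : MvPolynomial σ ℝ) (s : σ → S),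
    (∀ f ∈ G, f.eval₂ k s = 0) → c.eval₂ k s ≠ 0 →
    ∃ r : σ → ℝ, (∀ f ∈ G, MvPolynomial.eval r f = 0) ∧ MvPolynomial.eval r c ≠ 0

theorem germ_mvPolynomial_eval₂ {σ ι : Type} (u : Ultrafilter ι) (k : ℝ →+* S)
    (z : σ → ι → S) (f : MvPolynomial σ ℝ) :
    f.eval₂ ((germConst u S).comp k) (fun v => (z v : (u : Filter ι).Germ S)) =
      ((fun y => f.eval₂ k (fun v => z v y) : ι → S) : (u : Filter ι).Germ S) := by
  induction f using MvPolynomial.induction_on with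
  | C a => simp [germConst_apply]
  | add p q hp hq =>
    rw [MvPolynomial.eval₂_add, hp, hq, ← Germ.coe_add]
    congr 1
    funext y
    simp
  | mul_X p v hp =>
    rw [MvPolynomial.eval₂_mul, hp, MvPolynomial.eval₂_X, ← Germ.coe_mul]
    congr 1
    funext y
    simp

theorem SolvesInReal.germ {σ ι : Type} {k : ℝ →+* S} (hk : SolvesInReal σ k)
    (u : Ultrafilter ι) : SolvesInReal σ ((germConst u S).comp k) := by
  intro G c s hG hc
  have : ∃ z : σ → ι → S, s = fun v => (z v : (u : Filter ι).Germ S) := by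
    choose z hz using fun v => Quotient.exists_rep (s v)
    exact ⟨z, funext fun v => (hz v).symm⟩
  obtain ⟨z, rfl⟩ := this
  have h1 : ∀ᶠ y in (u : Filter ι), ∀ f ∈ G, f.eval₂ k (fun v => z v y) = 0 := by
    rw [Filter.eventually_all_finset]
    intro f hf
    have := hG f hf
    rw [germ_mvPolynomial_eval₂, ← Germ.coe_zero, Germ.coe_eq] at this
    exact this
  have h2 : ∀ᶠ y in (u : Filter ι), c.eval₂ k (fun v => z v y) ≠ 0 := by
    rw [germ_mvPolynomial_eval₂, ← Germ.coe_zero, Ne, Germ.coe_eq] at hc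
    exact Ultrafilter.eventually_not.2 hc
  obtain ⟨y, h3, h4⟩ := (h1.and h2).exists
  exact hk G c _ h3 h4

end Germ

section Transfer

open Filter

variable {L : Type} [Field L] [LinearOrder L] [IsStrictOrderedRing L]

theorem exists_germ_signCompat {S : Type} [Field S] [LinearOrder S] [IsStrictOrderedRing S]
    (hL : PolyIVT L) (hS : PolyIVT S) {M : Subring (L × S)} (hM : IsSignCompat M)
    (hmax : ∀ G', IsSignCompat G' → M ≤ G' → G' ≤ M) {t : L}
    (ht : ∀ e, subringFst M e ≠ t) :
    ∃ (u : Ultrafilter S) (y : (u : Filter S).Germ S)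
      (G' : Subring (L × (u : Filter S).Germ S)), IsSignCompat G' ∧ (t, y) ∈ G' ∧
        ∀ z ∈ M, (z.1, germConst u S z.2) ∈ G' := by
  classical
  have : IsDomain M := hM.fst_injective.isDomain (subringFst M)
  have : CharZero M := (subringFst M).charZero
  have hinv : ∃ e : M, 2 * e = 1 := hM.exists_inv hmax 2 two_ne_zero
  let U : M → Set S := fun e =>
    {y | (subringFst M e < t → subringSnd M e < y) ∧ (t < subringFst M e → y < subringSnd M e)}
  have hne : NeBot (generate (Set.range U)) := by
    rw [generate_neBot_iff]
    intro V hV hfin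
    obtain ⟨Γ, rfl⟩ : ∃ Γ : Finset M, V = U '' (Γ : Set M) := by
      obtain ⟨Γ, hΓ⟩ := hfin.exists_finset_coe
      have hV' : ∀ v ∈ V, ∃ e, U e = v := fun v hv => hV hv
      choose! f hf using hV'
      refine ⟨Γ.image f, ?_⟩
      ext v
      constructor
      · intro hv
        exact ⟨f v, by simpa using ⟨v, by rw [← Finset.mem_coe, hΓ]; exact hv, rfl⟩, hf v hv⟩
      · rintro ⟨e, he, rfl⟩
        simp only [Finset.coe_image, Set.mem_image, Finset.mem_coe] at he
        obtain ⟨v, hv, rfl⟩ := he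
        rw [← Finset.mem_coe, hΓ] at hv
        rwa [hf v hv]
    obtain ⟨m, hm⟩ := exists_same_side (subringFst M) hinv t Γ
    refine ⟨subringSnd M m, ?_⟩
    rintro _ ⟨e, he, rfl⟩
    exact ⟨fun h => (compat_lt_iff hM.compat _ _).1 ((hm e he).1 h),
      fun h => (compat_lt_iff hM.compat _ _).1 ((hm e he).2 h)⟩
  let u : Ultrafilter S := Ultrafilter.of (generate (Set.range U))
  have hU : ∀ e, ∀ᶠ y in (u : Filter S), y ∈ U e := fun e =>
    Ultrafilter.of_le _ (mem_generate_of_mem ⟨e, rfl⟩)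
  obtain ⟨G', h1, h2, h3⟩ := exists_signCompat_adjoin (i := subringFst M)
    (j := (germConst u S).comp (subringSnd M)) (t := t)
    (y := ((fun y => y : S → S) : (u : Filter S).Germ S)) (by
      intro p
      have hp : p.eval₂ ((germConst u S).comp (subringSnd M))
          ((fun y => y : S → S) : (u : Filter S).Germ S) =
          ((fun y => p.eval₂ (subringSnd M) y : S → S) : (u : Filter S).Germ S) := by
        induction p using Polynomial.induction_on' with
        | add p q hp hq =>
          rw [eval₂_add, hp, hq, ← Germ.coe_add]
          congr 1
          funext y
          simp
        | monomial k a =>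
          rw [eval₂_monomial, ← Germ.coe_pow, RingHom.comp_apply, germConst_apply,
            ← Germ.coe_mul]
          congr 1
          funext y
          simp
      rw [hp, Germ.coe_pos]
      have hev : ∀ᶠ y in (u : Filter S), ∀ e ∈ p.roots.toFinset, y ∈ U e := by
        rw [Filter.eventually_all_finset]
        exact fun e _ => hU e
      have hiff : ∀ᶠ y in (u : Filter S),
          (0 < p.eval₂ (subringFst M) t ↔ 0 < p.eval₂ (subringSnd M) y) := by
        rcases eq_or_ne p 0 with rfl | hp0
        · simp
        filter_upwards [hev] with y hy
        have hmem : ∀ e, p.eval e = 0 → e ∈ p.roots.toFinset := fun e he => by simp [hp0, he]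
        exact eval₂_pos_iff_of_same_cut hL hS hM.fst_injective hM.compat hinv ht
          (fun e he => (hy e (hmem e he)).1) (fun e he => (hy e (hmem e he)).2)
          (fun h => hM.rootsFrom hL hS hmax _ p h rfl)
      constructor
      · intro h
        filter_upwards [hiff] with y hy using hy.1 h
      · intro h
        obtain ⟨y, h4, h5⟩ := (hiff.and h).exists
        exact h4.2 h5)
  exact ⟨u, _, G', h2, h3, fun z hz => h1 ⟨z, hz⟩⟩

theorem exists_signCompat_contains (hL : PolyIVT L) (κ : ℝ →+* L) (σ : Type) (A : Finset L) :
    ∃ (S : Type) (_ : Field S) (_ : LinearOrder S) (_ : IsStrictOrderedRing S)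
      (k : ℝ →+* S) (G : Subring (L × S)), PolyIVT S ∧ SolvesInReal σ k ∧ IsSignCompat G ∧
        (∀ r, (κ r, k r) ∈ G) ∧ ∀ t ∈ A, ∃ y, (t, y) ∈ G := by
  classical
  induction A using Finset.induction_on with
  | empty =>
    refine ⟨ℝ, inferInstance, inferInstance, inferInstance, RingHom.id ℝ,
      (κ.prod (RingHom.id ℝ)).range, ?_, ?_, ?_, fun r => ⟨r, rfl⟩, by simp⟩
    · intro p a b hab ha hb
      obtain ⟨c, hc, h0⟩ := intermediate_value_Ioo hab.le p.continuous.continuousOn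
        (show (0 : ℝ) ∈ Set.Ioo (p.eval a) (p.eval b) from ⟨ha, hb⟩)
      exact ⟨c, hc.1, hc.2, h0⟩
    · intro G c s hG hc
      exact ⟨s, hG, hc⟩
    · have hpos : ∀ r : ℝ, 0 < r → 0 < κ r := by
        intro r hr
        have h1 : κ r = κ (Real.sqrt r) ^ 2 := by rw [← map_pow, Real.sq_sqrt hr.le]
        refine lt_of_le_of_ne (h1 ▸ sq_nonneg _) fun h => hr.ne' ?_
        exact (map_eq_zero κ).1 h.symm
      rintro _ ⟨r, rfl⟩
      refine ⟨fun h => ?_, hpos r⟩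
      by_contra hn
      rcases (not_lt.1 hn).lt_or_eq with h1 | h1
      · have := hpos (-r) (neg_pos.2 h1)
        rw [map_neg] at this
        exact absurd h (not_lt.2 (neg_pos.1 this).le)
      · have h2 : r = 0 := h1
        subst h2
        simp at h
  | insert t A _ ih =>
    obtain ⟨S, _, _, _, k, G, hS, hk, hG, hr, hA⟩ := ih
    obtain ⟨M, hGM, hM, hmax⟩ := hG.exists_maximal
    by_cases ht : ∃ e, subringFst M e = t
    · obtain ⟨e, he⟩ := ht
      refine ⟨S, _, _, inferInstance, k, M, hS, hk, hM, fun r => hGM (hr r), ?_⟩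
      intro x hx
      rcases Finset.mem_insert.1 hx with rfl | hx
      · exact ⟨(e : L × S).2, by rw [← he]; exact e.2⟩
      · exact (hA x hx).imp fun y hy => hGM hy
    · push Not at ht
      obtain ⟨u, y, G', h1, h2, h3⟩ := exists_germ_signCompat hL hS hM hmax ht
      refine ⟨(u : Filter S).Germ S, inferInstance, inferInstance, inferInstance,
        (germConst u S).comp k, G', hS.germ u, hk.germ u, h1, fun r => h3 _ (hGM (hr r)), ?_⟩
      intro x hx
      rcases Finset.mem_insert.1 hx with rfl | hx
      · exact ⟨y, h2⟩
      · obtain ⟨z, hz⟩ := hA x hx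
        exact ⟨_, h3 _ (hGM hz)⟩

/-- A finite system of polynomial equations and an inequation over `ℝ` that is solvable in an
ordered field with the intermediate value property for polynomials is solvable in `ℝ`. -/
theorem exists_real_solution (hL : PolyIVT L) (κ : ℝ →+* L) {σ : Type} [Finite σ]
    (G : Finset (MvPolynomial σ ℝ)) (c : MvPolynomial σ ℝ) (x : σ → L)
    (hG : ∀ f ∈ G, f.eval₂ κ x = 0) (hc : c.eval₂ κ x ≠ 0) :
    ∃ r : σ → ℝ, (∀ f ∈ G, MvPolynomial.eval r f = 0) ∧ MvPolynomial.eval r c ≠ 0 := by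
  obtain ⟨S, _, _, _, k, H, hS, hk, hH, hr, hA⟩ :=
    exists_signCompat_contains hL κ σ (Set.finite_range x).toFinset
  choose s hs using fun v => hA (x v) (by simp)
  have hmem : ∀ f : MvPolynomial σ ℝ, (f.eval₂ κ x, f.eval₂ k s) ∈ H := by
    intro f
    induction f using MvPolynomial.induction_on with
    | C a => simpa using hr a
    | add p q hp hq => simpa using H.add_mem hp hq
    | mul_X p v hp => simpa using H.mul_mem hp (hs v)
  have hiff : ∀ f : MvPolynomial σ ℝ, f.eval₂ κ x = 0 ↔ f.eval₂ k s = 0 := fun f =>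
    compat_eq_zero_iff hH.compat ⟨_, hmem f⟩
  exact hk G c s (fun f hf => (hiff f).1 (hG f hf)) fun h => hc ((hiff c).2 h)

end Transfer

section Preordering

variable {R : Type*} [CommRing R]

/-- `P` is closed under sums and products and contains all squares. -/
structure IsRingPreorder (P : Set R) : Prop where
  add : ∀ a ∈ P, ∀ b ∈ P, a + b ∈ P
  mul : ∀ a ∈ P, ∀ b ∈ P, a * b ∈ P
  sq : ∀ a, a ^ 2 ∈ P

theorem IsRingPreorder.zero {P : Set R} (h : IsRingPreorder P) : 0 ∈ P := by simpa using h.sq 0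

theorem IsRingPreorder.one {P : Set R} (h : IsRingPreorder P) : 1 ∈ P := by simpa using h.sq 1

theorem IsRingPreorder.adjoin {P : Set R} (h : IsRingPreorder P) (a : R) :
    IsRingPreorder {x | ∃ s ∈ P, ∃ t ∈ P, x = s + a * t} where
  add := by
    rintro _ ⟨s, hs, t, ht, rfl⟩ _ ⟨s', hs', t', ht', rfl⟩
    exact ⟨s + s', h.add _ hs _ hs', t + t', h.add _ ht _ ht', by ring⟩
  mul := by
    rintro _ ⟨s, hs, t, ht, rfl⟩ _ ⟨s', hs', t', ht', rfl⟩
    exact ⟨s * s' + a ^ 2 * (t * t'), h.add _ (h.mul _ hs _ hs') _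
      (h.mul _ (h.sq a) _ (h.mul _ ht _ ht')), s * t' + s' * t,
      h.add _ (h.mul _ hs _ ht') _ (h.mul _ hs' _ ht), by ring⟩
  sq := fun x => ⟨x ^ 2, h.sq x, 0, h.zero, by ring⟩

theorem IsRingPreorder.exists_maximal {T : Set R} (hT : IsRingPreorder T) {c : R}
    (hc : ∀ m : ℕ, -c ^ (2 * m) ∉ T) :
    ∃ P, T ⊆ P ∧ IsRingPreorder P ∧ (∀ m : ℕ, -c ^ (2 * m) ∉ P) ∧
      ∀ a, a ∉ P → ∃ m : ℕ, ∃ s ∈ P, ∃ t ∈ P, -c ^ (2 * m) = s + a * t := by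
  obtain ⟨P, hTP, hP⟩ := zorn_le_nonempty₀
    {P : Set R | IsRingPreorder P ∧ ∀ m : ℕ, -c ^ (2 * m) ∉ P} (by
    intro Γ hΓ hchain Y hY
    refine ⟨⋃₀ Γ, ⟨⟨?_, ?_, ?_⟩, ?_⟩, fun Z hZ => Set.subset_sUnion_of_mem hZ⟩
    · rintro a ⟨A, hA, ha⟩ b ⟨B, hB, hb⟩
      rcases hchain.total hA hB with h | h
      · exact ⟨B, hB, (hΓ hB).1.add _ (h ha) _ hb⟩
      · exact ⟨A, hA, (hΓ hA).1.add _ ha _ (h hb)⟩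
    · rintro a ⟨A, hA, ha⟩ b ⟨B, hB, hb⟩
      rcases hchain.total hA hB with h | h
      · exact ⟨B, hB, (hΓ hB).1.mul _ (h ha) _ hb⟩
      · exact ⟨A, hA, (hΓ hA).1.mul _ ha _ (h hb)⟩
    · exact fun a => ⟨Y, hY, (hΓ hY).1.sq a⟩
    · rintro m ⟨A, hA, ha⟩
      exact (hΓ hA).2 m ha) T ⟨hT, hc⟩
  refine ⟨P, hTP, hP.1.1, hP.1.2, fun a ha => ?_⟩
  by_contra! hcon
  have h1 := hP.2 (y := {x | ∃ s ∈ P, ∃ t ∈ P, x = s + a * t})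
    ⟨hP.1.1.adjoin a, fun m => ?_⟩ (fun x hx => ⟨x, hx, 0, hP.1.1.zero, by ring⟩)
  · exact ha (h1 ⟨0, hP.1.1.zero, 1, hP.1.1.one, by ring⟩)
  · rintro ⟨s, hs, t, ht, h⟩
    exact hcon m s hs t ht h

/-- A preordering avoiding every `-c ^ (2 * m)` extends to one with prime support that does not
contain `c`. -/
theorem IsRingPreorder.exists_prime_support {T : Set R} (hT : IsRingPreorder T) {c : R}
    (hc : ∀ m : ℕ, -c ^ (2 * m) ∉ T) :
    ∃ P, T ⊆ P ∧ IsRingPreorder P ∧ (∀ a, a ∈ P ∨ -a ∈ P) ∧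
      ∃ p : Ideal R, p.IsPrime ∧ c ∉ p ∧ ∀ a, a ∈ p ↔ a ∈ P ∧ -a ∈ P := by
  obtain ⟨P, hTP, hP, hcP, hmax⟩ := hT.exists_maximal hc
  have htot : ∀ a, a ∈ P ∨ -a ∈ P := by
    intro a
    by_contra! h
    obtain ⟨m, s, hs, t, ht, h1⟩ := hmax a h.1
    obtain ⟨l, s', hs', t', ht', h2⟩ := hmax (-a) h.2
    apply hcP (m + l)
    have : -c ^ (2 * (m + l)) =
        c ^ (2 * m) * s' + (c ^ (2 * l) * s + (s * s' + a ^ 2 * (t * t'))) := by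
      have e1 : a * t = -(c ^ (2 * m) + s) := by linear_combination -h1
      have e2 : a * t' = c ^ (2 * l) + s' := by linear_combination h2
      have e3 : a ^ 2 * (t * t') = -(c ^ (2 * m) + s) * (c ^ (2 * l) + s') := by
        rw [← e1, ← e2]; ring
      rw [e3]; ring
    rw [this]
    have hsq : ∀ k, c ^ (2 * k) ∈ P := fun k => by rw [mul_comm, pow_mul]; exact hP.sq _
    exact hP.add _ (hP.mul _ (hsq _) _ hs') _ (hP.add _ (hP.mul _ (hsq _) _ hs) _
      (hP.add _ (hP.mul _ hs _ hs') _ (hP.mul _ (hP.sq _) _ (hP.mul _ ht _ ht'))))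
  let p : Ideal R :=
    { carrier := {a | a ∈ P ∧ -a ∈ P}
      add_mem' := fun {a b} ha hb => ⟨hP.add _ ha.1 _ hb.1, by
        rw [neg_add]; exact hP.add _ ha.2 _ hb.2⟩
      zero_mem' := ⟨hP.zero, by simpa using hP.zero⟩
      smul_mem' := fun r a ha => by
        rcases htot r with h | h
        · exact ⟨hP.mul _ h _ ha.1, by simpa using hP.mul _ h _ ha.2⟩
        · exact ⟨by simpa using hP.mul _ h _ ha.2, by simpa using hP.mul _ h _ ha.1⟩ }
  have hp : ∀ a, a ∈ p ↔ a ∈ P ∧ -a ∈ P := fun a => Iff.rfl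
  have hcp : c ∉ p := fun h => hcP 1 (by
    have := hP.mul _ h.1 _ h.2
    convert this using 1; ring)
  refine ⟨P, hTP, hP, htot, p, ⟨?_, ?_⟩, hcp, hp⟩
  · intro h
    exact hcp (h ▸ Submodule.mem_top)
  · have key : ∀ x y, x * y ∈ p → x ∈ P → -x ∉ P → y ∈ P → -y ∉ P → False := by
      intro x y hxy _ hx _ hy
      obtain ⟨m, s, hs, t, ht, h1⟩ := hmax _ hx
      obtain ⟨l, s', hs', t', ht', h2⟩ := hmax _ hy
      apply hcP (m + l)
      have : -c ^ (2 * (m + l)) =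
          -(x * y) * (t * t') + (c ^ (2 * m) * s' + (c ^ (2 * l) * s + s * s')) := by
        have e1 : x * t = c ^ (2 * m) + s := by linear_combination h1
        have e2 : y * t' = c ^ (2 * l) + s' := by linear_combination h2
        have e3 : x * y * (t * t') = (c ^ (2 * m) + s) * (c ^ (2 * l) + s') := by
          rw [← e1, ← e2]; ring
        rw [neg_mul, e3]; ring
      rw [this]
      have hsq : ∀ k, c ^ (2 * k) ∈ P := fun k => by rw [mul_comm, pow_mul]; exact hP.sq _
      exact hP.add _ (hP.mul _ hxy.2 _ (hP.mul _ ht _ ht')) _ (hP.add _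
        (hP.mul _ (hsq _) _ hs') _ (hP.add _ (hP.mul _ (hsq _) _ hs) _ (hP.mul _ hs _ hs')))
    have key2 : ∀ x, x ∉ p → (x ∈ P ∧ -x ∉ P) ∨ (-x ∈ P ∧ - -x ∉ P) := by
      intro x hx
      rw [hp, not_and_or] at hx
      rw [neg_neg]
      rcases htot x with h | h
      · exact Or.inl ⟨h, hx.resolve_left (not_not.2 h)⟩
      · exact Or.inr ⟨h, hx.resolve_right (not_not.2 h)⟩
    intro x y hxy
    by_contra! h
    rcases key2 x h.1 with hx | hx <;> rcases key2 y h.2 with hy | hy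
    · exact key _ _ hxy hx.1 hx.2 hy.1 hy.2
    · exact key x (-y) (by rw [mul_neg]; exact p.neg_mem hxy) hx.1 hx.2 hy.1 hy.2
    · exact key (-x) y (by rw [neg_mul]; exact p.neg_mem hxy) hx.1 hx.2 hy.1 hy.2
    · exact key (-x) (-y) (by rwa [neg_mul_neg]) hx.1 hx.2 hy.1 hy.2

/-- A linear order on a field from its cone of nonnegative elements. -/
theorem exists_linearOrder_of_cone {K : Type*} [Field K] (N : Set K)
    (hadd : ∀ a ∈ N, ∀ b ∈ N, a + b ∈ N) (hmul : ∀ a ∈ N, ∀ b ∈ N, a * b ∈ N)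
    (htot : ∀ a, a ∈ N ∨ -a ∈ N) (hanti : ∀ a, a ∈ N → -a ∈ N → a = 0) :
    ∃ _ : LinearOrder K, IsStrictOrderedRing K ∧ ∀ a, 0 ≤ a ↔ a ∈ N := by
  classical
  have h0 : (0 : K) ∈ N := by rcases htot 0 with h | h <;> simpa using h
  let o : LinearOrder K :=
    { le := fun a b => b - a ∈ N
      le_refl := fun a => by simpa using h0
      le_trans := fun a b c h1 h2 => by simpa using hadd _ h1 _ h2
      le_antisymm := fun a b h1 h2 =>
        (sub_eq_zero.1 (hanti _ h1 (by simpa using h2))).symm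
      le_total := fun a b => by simpa using htot (b - a)
      toDecidableLE := Classical.decRel _ }
  have hle : ∀ a b : K, a ≤ b ↔ b - a ∈ N := fun a b => Iff.rfl
  have h1 : (1 : K) ∈ N := by
    rcases htot 1 with h | h
    · exact h
    · simpa using hmul _ h _ h
  have : IsOrderedAddMonoid K :=
    { add_le_add_left := fun a b h c => by rw [hle] at h ⊢; simpa using h }
  have : ZeroLEOneClass K := ⟨by rw [hle]; simpa using h1⟩
  have : IsOrderedRing K := IsOrderedRing.of_mul_nonneg fun a b ha hb => by
    rw [hle] at ha hb ⊢
    simpa using hmul _ ha _ hb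
  exact ⟨o, IsOrderedRing.toIsStrictOrderedRing K, fun a => by rw [hle]; simp⟩

end Preordering

section RealClosure

/-- Sums of the elements `ψ a * x ^ 2` with `a ∈ P` and `x ∈ E`. -/
def weightedSumSq {R K : Type*} [CommRing R] [CommRing K] (P : Set R) (ψ : R →+* K) (E : Set K) :
    AddSubmonoid K :=
  AddSubmonoid.closure {y | ∃ a ∈ P, ∃ x ∈ E, y = ψ a * x ^ 2}

variable {R Ω : Type*} [CommRing R] [Field Ω] {P : Set R} {ψ : R →+* Ω}

theorem weightedSumSq_mono {E E' : Set Ω} (h : E ⊆ E') :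
    weightedSumSq P ψ E ≤ weightedSumSq P ψ E' :=
  AddSubmonoid.closure_mono (by rintro _ ⟨a, ha, x, hx, rfl⟩; exact ⟨a, ha, x, h hx, rfl⟩)

theorem weightedSumSq_mul (hP : IsRingPreorder P) {E : Subfield Ω} {x y : Ω}
    (hx : x ∈ weightedSumSq P ψ E) (hy : y ∈ weightedSumSq P ψ E) :
    x * y ∈ weightedSumSq P ψ E := by
  induction hx using AddSubmonoid.closure_induction with
  | zero => rw [zero_mul]; exact zero_mem _
  | add u v _ _ hu hv => rw [add_mul]; exact add_mem hu hv
  | mem u hu =>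
    obtain ⟨a, ha, u, hu, rfl⟩ := hu
    induction hy using AddSubmonoid.closure_induction with
    | zero => rw [mul_zero]; exact zero_mem _
    | add u v _ _ hu hv => rw [mul_add]; exact add_mem hu hv
    | mem v hv =>
      obtain ⟨b, hb, v, hv, rfl⟩ := hv
      exact AddSubmonoid.subset_closure ⟨a * b, hP.mul _ ha _ hb, u * v, mul_mem hu hv, by
        rw [map_mul]; ring⟩

theorem weightedSumSq_sq (hP : IsRingPreorder P) {E : Subfield Ω} {x : Ω} (hx : x ∈ E) :
    x ^ 2 ∈ weightedSumSq P ψ E :=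
  AddSubmonoid.subset_closure ⟨1, hP.one, x, hx, by simp⟩

theorem weightedSumSq_weight {E : Subfield Ω} {a : R} (ha : a ∈ P) :
    ψ a ∈ weightedSumSq P ψ E :=
  AddSubmonoid.subset_closure ⟨a, ha, 1, one_mem _, by simp⟩

theorem weightedSumSq_subset {E : Subfield Ω} (hψ : ∀ a, ψ a ∈ E) {x : Ω}
    (hx : x ∈ weightedSumSq P ψ E) : x ∈ E := by
  induction hx using AddSubmonoid.closure_induction with
  | zero => exact zero_mem _
  | add u v _ _ hu hv => exact add_mem hu hv
  | mem u hu =>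
    obtain ⟨a, ha, u, hu, rfl⟩ := hu
    exact mul_mem (hψ a) (pow_mem hu 2)

theorem exists_maximal_subfield {E₀ : Subfield Ω} (h₀ : -1 ∉ weightedSumSq P ψ E₀) :
    ∃ E : Subfield Ω, E₀ ≤ E ∧ -1 ∉ weightedSumSq P ψ E ∧
      ∀ E' : Subfield Ω, E ≤ E' → -1 ∉ weightedSumSq P ψ E' → E' ≤ E := by
  obtain ⟨E, h1, h2⟩ := zorn_le_nonempty₀ {E : Subfield Ω | -1 ∉ weightedSumSq P ψ E} (by
    intro Γ hΓ hchain Y hY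
    refine ⟨sSup Γ, ?_, fun Z hZ => le_sSup hZ⟩
    have key : ∀ x ∈ weightedSumSq P ψ (sSup Γ : Subfield Ω),
        ∃ Z ∈ Γ, x ∈ weightedSumSq P ψ (Z : Subfield Ω) := by
      intro x hx
      induction hx using AddSubmonoid.closure_induction with
      | zero => exact ⟨Y, hY, zero_mem _⟩
      | add u v _ _ hu hv =>
        obtain ⟨Z, hZ, hu⟩ := hu
        obtain ⟨W, hW, hv⟩ := hv
        rcases hchain.total hZ hW with h | h
        · exact ⟨W, hW, add_mem (weightedSumSq_mono h hu) hv⟩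
        · exact ⟨Z, hZ, add_mem hu (weightedSumSq_mono h hv)⟩
      | mem u hu =>
        obtain ⟨a, ha, u, hu, rfl⟩ := hu
        obtain ⟨Z, hZ, hu⟩ := (Subfield.mem_sSup_of_directedOn ⟨Y, hY⟩ hchain.directedOn).1 hu
        exact ⟨Z, hZ, AddSubmonoid.subset_closure ⟨a, ha, u, hu, rfl⟩⟩
    intro h
    obtain ⟨Z, hZ, h⟩ := key _ h
    exact hΓ hZ h) E₀ h₀
  exact ⟨E, h1, h2.1, fun E' h3 h4 => h2.2 h4 h3⟩

theorem exists_weightedSumSq_eq_neg_one {E : Subfield Ω} (hψ : ∀ a, ψ a ∈ E)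
    (hmax : ∀ E' : Subfield Ω, E ≤ E' → -1 ∉ weightedSumSq P ψ E' → E' ≤ E) {α : Ω}
    (hα : α ∉ E) (halg : IsAlgebraic E α) :
    ∃ Q ∈ weightedSumSq P ((C : E →+* E[X]).comp (ψ.codRestrict E hψ)) Set.univ,
      aeval α Q = -1 := by
  let E' : Subfield Ω := (IntermediateField.adjoin E {α}).toSubfield
  have hE' : ∀ x ∈ E', ∃ q : E[X], aeval α q = x := by
    intro x hx
    have h1 : x ∈ (IntermediateField.adjoin E {α}).toSubalgebra := hx
    rw [IntermediateField.adjoin_simple_toSubalgebra_of_isAlgebraic halg,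
      Algebra.adjoin_singleton_eq_range_aeval] at h1
    exact h1
  have hle : E ≤ E' := fun x hx => (IntermediateField.adjoin E {α}).algebraMap_mem ⟨x, hx⟩
  have hαE' : α ∈ E' := IntermediateField.mem_adjoin_simple_self E α
  have h1 : -1 ∈ weightedSumSq P ψ E' := by
    by_contra h
    exact hα (hmax E' hle h hαE')
  have key : ∀ x ∈ weightedSumSq P ψ E',
      ∃ Q ∈ weightedSumSq P ((C : E →+* E[X]).comp (ψ.codRestrict E hψ)) Set.univ,
        aeval α Q = x := by
    intro x hx
    induction hx using AddSubmonoid.closure_induction with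
    | zero => exact ⟨0, zero_mem _, map_zero _⟩
    | add u v _ _ hu hv =>
      obtain ⟨q, hq, rfl⟩ := hu
      obtain ⟨r, hr, rfl⟩ := hv
      exact ⟨q + r, add_mem hq hr, map_add _ _ _⟩
    | mem u hu =>
      obtain ⟨a, ha, u, hu, rfl⟩ := hu
      obtain ⟨q, rfl⟩ := hE' u hu
      refine ⟨_, AddSubmonoid.subset_closure ⟨a, ha, q, trivial, rfl⟩, ?_⟩
      rw [map_mul, map_pow, RingHom.comp_apply, aeval_C]
      rfl
  exact key _ h1

theorem weightedSumSq_eval_sqrt {E : Subfield Ω} (hψ : ∀ a, ψ a ∈ E)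
    {α : Ω} {a : E} (ha : α ^ 2 = a) {Q : E[X]}
    (hQ : Q ∈ weightedSumSq P ((C : E →+* E[X]).comp (ψ.codRestrict E hψ)) Set.univ) :
    ∃ u ∈ weightedSumSq P ψ E, ∃ v ∈ weightedSumSq P ψ E, ∃ w ∈ E,
      aeval α Q = u + a * v + w * α := by
  have hq : ∀ q : E[X], ∃ x ∈ E, ∃ y ∈ E, aeval α q = x + y * α := by
    intro q
    induction q using Polynomial.induction_on with
    | C b => exact ⟨b, b.2, 0, zero_mem _, by rw [aeval_C, zero_mul, add_zero]; rfl⟩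
    | add p q hp hq =>
      obtain ⟨x, hx, y, hy, h1⟩ := hp
      obtain ⟨x', hx', y', hy', h2⟩ := hq
      exact ⟨x + x', add_mem hx hx', y + y', add_mem hy hy', by rw [map_add, h1, h2]; ring⟩
    | monomial k b h =>
      obtain ⟨x, hx, y, hy, h1⟩ := h
      refine ⟨y * a, mul_mem hy a.2, x, hx, ?_⟩
      rw [pow_succ, ← mul_assoc, map_mul, h1, aeval_X, ← ha]
      ring
  induction hQ using AddSubmonoid.closure_induction with
  | zero => exact ⟨0, zero_mem _, 0, zero_mem _, 0, zero_mem _, by simp⟩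
  | add q r _ _ h1 h2 =>
    obtain ⟨u, hu, v, hv, w, hw, h1⟩ := h1
    obtain ⟨u', hu', v', hv', w', hw', h2⟩ := h2
    exact ⟨u + u', add_mem hu hu', v + v', add_mem hv hv', w + w', add_mem hw hw', by
      rw [map_add, h1, h2]; ring⟩
  | mem q hq' =>
    obtain ⟨b, hb, q, -, rfl⟩ := hq'
    obtain ⟨x, hx, y, hy, h1⟩ := hq q
    refine ⟨ψ b * x ^ 2, AddSubmonoid.subset_closure ⟨b, hb, x, hx, rfl⟩, ψ b * y ^ 2,
      AddSubmonoid.subset_closure ⟨b, hb, y, hy, rfl⟩, ψ b * (2 * x * y),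
      mul_mem (hψ b) (mul_mem (mul_mem (by exact_mod_cast natCast_mem E 2) hx) hy), ?_⟩
    rw [map_mul, map_pow, h1, RingHom.comp_apply, aeval_C, ← ha]
    change ψ b * _ = _
    ring

/-- An ordered field structure and a real-closedness property for a maximal subfield on which the
weighted sums of squares avoid `-1`. -/
theorem exists_order_of_maximal_subfield [IsAlgClosed Ω] (hP : IsRingPreorder P)
    {E : Subfield Ω} (hψ : ∀ a, ψ a ∈ E)
    (h1 : -1 ∉ weightedSumSq P ψ E)
    (hmax : ∀ E' : Subfield Ω, E ≤ E' → -1 ∉ weightedSumSq P ψ E' → E' ≤ E) :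
    ∃ (_ : LinearOrder E), IsStrictOrderedRing E ∧
      (∀ a ∈ P, 0 ≤ ψ.codRestrict E hψ a) ∧ (∀ a : E, 0 ≤ a → ∃ b, a = b ^ 2) ∧
      ∀ p : E[X], Irreducible p → 2 ≤ p.natDegree → ∃ Q, IsSumSq Q ∧ p ∣ 1 + Q := by
  have hroot : ∀ a : E, ∃ α : Ω, α ^ 2 = a := fun a => by
    obtain ⟨z, hz⟩ := IsAlgClosed.exists_pow_nat_eq (a : Ω) (n := 2) (by norm_num)
    exact ⟨z, hz⟩
  have halg : ∀ (a : E) (α : Ω), α ^ 2 = a → IsAlgebraic E α := by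
    intro a α h
    refine ⟨X ^ 2 - C a, X_pow_sub_C_ne_zero (by norm_num) a, ?_⟩
    rw [map_sub, map_pow, aeval_X, aeval_C, h]
    exact sub_self _
  have hkey : ∀ (a : E), (∀ b : E, a ≠ b ^ 2) → ∃ u ∈ weightedSumSq P ψ E,
      ∃ v ∈ weightedSumSq P ψ E, -1 = u + a * v := by
    intro a ha
    obtain ⟨α, hα⟩ := hroot a
    have hαE : α ∉ E := fun h => ha ⟨α, h⟩ (Subtype.ext hα.symm)
    obtain ⟨Q, hQ, h2⟩ := exists_weightedSumSq_eq_neg_one hψ hmax hαE (halg a α hα)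
    obtain ⟨u, hu, v, hv, w, hw, h3⟩ := weightedSumSq_eval_sqrt hψ hα hQ
    rw [h2] at h3
    have hw0 : w = 0 := by
      by_contra hw0
      apply hαE
      have : α = (-1 - u - a * v) * w⁻¹ := by
        rw [eq_mul_inv_iff_mul_eq₀ hw0, h3]; ring
      rw [this]
      exact mul_mem (sub_mem (sub_mem (neg_mem (one_mem _)) (weightedSumSq_subset hψ hu))
        (mul_mem a.2 (weightedSumSq_subset hψ hv))) (inv_mem hw)
    exact ⟨u, hu, v, hv, by rw [h3, hw0]; ring⟩
  have hsq : ∀ a : E, (a : Ω) ∈ weightedSumSq P ψ E → ∃ b, a = b ^ 2 := by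
    intro a ha
    by_contra! h
    obtain ⟨u, hu, v, hv, h2⟩ := hkey a h
    exact h1 (h2 ▸ add_mem hu (weightedSumSq_mul hP ha hv))
  have htot : ∀ a : E, (a : Ω) ∈ weightedSumSq P ψ E ∨ -(a : Ω) ∈ weightedSumSq P ψ E := by
    intro a
    by_cases h : ∃ b, a = b ^ 2
    · obtain ⟨b, rfl⟩ := h
      exact Or.inl (weightedSumSq_sq hP b.2)
    · push Not at h
      obtain ⟨u, hu, v, hv, h2⟩ := hkey a h
      right
      have hv0 : v ≠ 0 := by
        rintro rfl
        rw [mul_zero, add_zero] at h2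
        exact h1 (h2 ▸ hu)
      have : -(a : Ω) = (1 + u) * v * (v⁻¹) ^ 2 := by
        have : u = -1 - a * v := by rw [h2]; ring
        rw [this]; field_simp; ring
      rw [this]
      exact weightedSumSq_mul hP (weightedSumSq_mul hP
        (add_mem (by simpa using weightedSumSq_sq hP (one_mem E)) hu) hv)
        (weightedSumSq_sq hP (inv_mem (weightedSumSq_subset hψ hv)))
  obtain ⟨o, ho, hnn⟩ := exists_linearOrder_of_cone
    {a : E | (a : Ω) ∈ weightedSumSq P ψ E} (fun a ha b hb => (weightedSumSq P ψ E).add_mem ha hb)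
    (fun a ha b hb => weightedSumSq_mul hP ha hb) htot (by
      intro a ha ha'
      by_contra h0
      apply h1
      have h0' : (a : Ω) ≠ 0 := fun h => h0 (Subtype.ext h)
      have : (-1 : Ω) = a * (-a : E) * ((a : Ω)⁻¹) ^ 2 := by
        push_cast; field_simp
      rw [this]
      exact weightedSumSq_mul hP (weightedSumSq_mul hP ha ha')
        (weightedSumSq_sq hP (inv_mem a.2)))
  refine ⟨o, ho, fun a ha => (hnn _).2 (weightedSumSq_weight ha),
    fun a ha => hsq a ((hnn a).1 ha), ?_⟩
  intro p hp hd
  obtain ⟨α, hα⟩ := IsAlgClosed.exists_aeval_eq_zero Ω p (by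
    rw [degree_eq_natDegree hp.ne_zero]
    intro h
    have : p.natDegree = 0 := by exact_mod_cast h
    omega)
  have hαE : α ∉ E := by
    intro h
    have hr : p.IsRoot ⟨α, h⟩ := by
      have h2 : aeval (algebraMap E Ω ⟨α, h⟩) p = 0 := hα
      rw [aeval_algebraMap_apply] at h2
      exact (map_eq_zero (algebraMap E Ω)).1 h2
    have : p.natDegree = 1 := natDegree_eq_of_degree_eq_some (degree_eq_one_of_irreducible_of_root hp hr)
    omega
  obtain ⟨Q, hQ, h2⟩ := exists_weightedSumSq_eq_neg_one hψ hmax hαE ⟨p, hp.ne_zero, hα⟩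
  refine ⟨Q, ?_, ?_⟩
  · clear h2
    induction hQ using AddSubmonoid.closure_induction with
    | zero => exact IsSumSq.zero
    | add _ _ _ _ h1 h2 => exact h1.add h2
    | mem q hq =>
      obtain ⟨a, ha, q, -, rfl⟩ := hq
      obtain ⟨b, hb⟩ := hsq (ψ.codRestrict E hψ a) (weightedSumSq_weight ha)
      have : (C : E →+* E[X]).comp (ψ.codRestrict E hψ) a * q ^ 2 = (C b * q) * (C b * q) := by
        rw [RingHom.comp_apply, hb, map_pow]; ring
      rw [this]
      exact IsSumSq.mul_self _
  · have h3 : aeval α (1 + Q) = 0 := by rw [map_add, map_one, h2, add_neg_cancel]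
    have h4 := minpoly.dvd E α h3
    rw [← minpoly.eq_of_irreducible hp hα] at h4
    exact (Dvd.intro _ rfl).trans h4

end RealClosure

section RealClosedIVT

variable {L : Type*} [Field L] [LinearOrder L] [IsStrictOrderedRing L]

theorem exists_isSumSq_reduction {p : L[X]} (hp : p.Monic) (hp1 : p.natDegree ≠ 0) {Q : L[X]}
    (hQ : IsSumSq Q) :
    ∃ Q', IsSumSq Q' ∧ p ∣ Q - Q' ∧ Q'.natDegree ≤ 2 * (p.natDegree - 1) := by
  induction hQ with
  | zero => exact ⟨0, IsSumSq.zero, by simp, by simp⟩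
  | @sq_add a s hs ih =>
    obtain ⟨Q', h1, h2, h3⟩ := ih
    refine ⟨(a %ₘ p) * (a %ₘ p) + Q', IsSumSq.sq_add _ h1, ?_, ?_⟩
    · have h4 : p ∣ a - a %ₘ p := ⟨a /ₘ p, by linear_combination -modByMonic_add_div a p⟩
      have h5 : a * a + s - (a %ₘ p * (a %ₘ p) + Q') =
        (a - a %ₘ p) * (a + a %ₘ p) + (s - Q') := by ring
      rw [h5]
      exact dvd_add (h4.mul_right _) h2
    · have h4 : (a %ₘ p).natDegree < p.natDegree :=
        natDegree_modByMonic_lt _ hp (fun h => hp1 (by simp [h]))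
      refine (natDegree_add_le _ _).trans (max_le (natDegree_mul_le.trans ?_) h3)
      omega

theorem isSumSq_eval_nonneg {Q : L[X]} (hQ : IsSumSq Q) (x : L) : 0 ≤ Q.eval x := by
  induction hQ with
  | zero => simp
  | sq_add a _ ih =>
    rw [eval_add, eval_mul]
    exact add_nonneg (mul_self_nonneg _) ih

/-- If every irreducible polynomial of degree at least two divides a nowhere vanishing sum of
squares, polynomials have the intermediate value property. -/
theorem polyIVT_of_irreducible_dvd
    (h : ∀ p : L[X], Irreducible p → 2 ≤ p.natDegree → ∃ Q, IsSumSq Q ∧ p ∣ 1 + Q) :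
    PolyIVT L := by
  have key : ∀ (d : ℕ) (p : L[X]), p.natDegree = d → ∀ a b, a < b →
      p.eval a * p.eval b < 0 → ∃ c, a < c ∧ c < b ∧ p.eval c = 0 := by
    intro d
    induction d using Nat.strong_induction_on with
    | _ d ih =>
    intro p hpd a b hab hneg
    have hp0 : p ≠ 0 := by rintro rfl; simp at hneg
    have hd0 : d ≠ 0 := by
      rintro rfl
      rw [eq_C_of_natDegree_eq_zero hpd] at hneg
      simp only [eval_C] at hneg
      exact absurd hneg (not_lt.2 (mul_self_nonneg _))
    have hnu : ¬ IsUnit p := fun hu => hd0 (hpd ▸ natDegree_eq_zero_of_isUnit hu)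
    by_cases hirr : Irreducible p
    · rcases Nat.lt_or_ge d 2 with h2 | h2
      · have hd1 : p.natDegree = 1 := by omega
        obtain ⟨u, hu, v, rfl⟩ := natDegree_eq_one.1 hd1
        refine ⟨-v / u, ?_⟩
        have he : ∀ x, (C u * X + C v).eval x = u * (x - -v / u) := fun x => by
          simp only [eval_add, eval_mul, eval_C, eval_X]; field_simp; ring
        rw [he, he] at hneg
        have h3 : (a - -v / u) * (b - -v / u) < 0 := by
          have : 0 < u * u := mul_self_pos.2 hu
          by_contra h4
          nlinarith [mul_nonneg this.le (not_lt.1 h4)]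
        refine ⟨?_, ?_, by rw [he, sub_self, mul_zero]⟩
        · by_contra h4
          nlinarith [mul_nonneg (sub_nonneg.2 (not_lt.1 h4))
            (sub_nonneg.2 ((not_lt.1 h4).trans hab.le))]
        · by_contra h4
          nlinarith [mul_nonneg_of_nonpos_of_nonpos (sub_nonpos.2 (not_lt.1 h4))
            (sub_nonpos.2 (hab.le.trans (not_lt.1 h4)))]
      · obtain ⟨Q, hQ, hdvd⟩ := h p hirr (by omega)
        have hlc : p.leadingCoeff ≠ 0 := leadingCoeff_ne_zero.2 hp0
        have hmon := monic_mul_leadingCoeff_inv hp0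
        have hdeg : (p * C p.leadingCoeff⁻¹).natDegree = d := by
          rw [natDegree_mul_C (inv_ne_zero hlc), hpd]
        obtain ⟨Q', hQ', hdvd', hQd⟩ := exists_isSumSq_reduction hmon
          (by rw [hdeg]; exact hd0) hQ
        have hdvd'' : p ∣ Q - Q' := (Dvd.intro _ rfl).trans hdvd'
        obtain ⟨r, hr⟩ : p ∣ 1 + Q' := by
          have := dvd_sub hdvd hdvd''
          rwa [show 1 + Q - (Q - Q') = 1 + Q' by ring] at this
        have hpos : ∀ x, 0 < p.eval x * r.eval x := fun x => by
          rw [← eval_mul, ← hr, eval_add, eval_one]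
          linarith [isSumSq_eval_nonneg hQ' x]
        have hr0 : r ≠ 0 := by
          rintro rfl
          simpa using hpos a
        have hrd : r.natDegree < d := by
          have h3 : (p * r).natDegree = d + r.natDegree := by rw [natDegree_mul hp0 hr0, hpd]
          have h4 : (1 + Q').natDegree ≤ 2 * (d - 1) := by
            rw [hdeg] at hQd
            exact (natDegree_add_le _ _).trans (max_le (by simp) hQd)
          rw [hr, h3] at h4
          omega
        have hrneg : r.eval a * r.eval b < 0 := by
          by_contra h5
          nlinarith [mul_pos (hpos a) (hpos b), mul_nonneg_of_nonpos_of_nonpos hneg.le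
            (neg_nonpos.2 (not_lt.1 h5))]
        obtain ⟨c, -, -, hc⟩ := ih _ hrd r rfl a b hab hrneg
        have := hpos c
        rw [hc, mul_zero] at this
        exact absurd this (lt_irrefl _)
    · rw [irreducible_iff] at hirr
      push Not at hirr
      obtain ⟨q, r, hqr, hq, hr⟩ := hirr hnu
      have hq0 : q ≠ 0 := by rintro rfl; simp [hp0] at hqr
      have hr0 : r ≠ 0 := by rintro rfl; simp [hp0] at hqr
      have hqd : q.natDegree ≠ 0 := fun h0 => hq (isUnit_iff_degree_eq_zero.2 (by
        rw [degree_eq_natDegree hq0, h0]; rfl))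
      have hrd : r.natDegree ≠ 0 := fun h0 => hr (isUnit_iff_degree_eq_zero.2 (by
        rw [degree_eq_natDegree hr0, h0]; rfl))
      have hsum : q.natDegree + r.natDegree = d := by rw [← natDegree_mul hq0 hr0, ← hqr, hpd]
      have hprod : (q.eval a * q.eval b) * (r.eval a * r.eval b) < 0 := by
        rw [hqr, eval_mul, eval_mul] at hneg
        linarith
      rcases mul_neg_iff.1 hprod with ⟨-, h3⟩ | ⟨h3, -⟩
      · obtain ⟨c, h4, h5, h6⟩ := ih _ (by omega) r rfl a b hab h3
        exact ⟨c, h4, h5, by rw [hqr, eval_mul, h6, mul_zero]⟩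
      · obtain ⟨c, h4, h5, h6⟩ := ih _ (by omega) q rfl a b hab h3
        exact ⟨c, h4, h5, by rw [hqr, eval_mul, h6, zero_mul]⟩
  intro p a b hab ha hb
  exact key _ p rfl a b hab (mul_neg_of_neg_of_pos ha hb)

end RealClosedIVT

/-- A preordering avoiding all `-c ^ (2 * m)` is nonnegative, and `c` nonzero, at some point with
values in a real closed field. -/
theorem IsRingPreorder.exists_point {R : Type} [CommRing R] {T : Set R} (hT : IsRingPreorder T)
    {c : R} (hc : ∀ m : ℕ, -c ^ (2 * m) ∉ T) :
    ∃ (L : Type) (_ : Field L) (_ : LinearOrder L) (_ : IsStrictOrderedRing L) (φ : R →+* L),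
      (∀ a ∈ T, 0 ≤ φ a) ∧ φ c ≠ 0 ∧ (∀ a : L, 0 ≤ a → ∃ b, a = b ^ 2) ∧
      (∀ p : L[X], Irreducible p → 2 ≤ p.natDegree → ∃ Q, IsSumSq Q ∧ p ∣ 1 + Q) ∧
      PolyIVT L := by
  obtain ⟨P, hTP, hP, htot, p, hp, hcp, hpP⟩ := hT.exists_prime_support hc
  let F := FractionRing (R ⧸ p)
  let Ω := AlgebraicClosure F
  let ψ : R →+* Ω := (algebraMap F Ω).comp ((algebraMap (R ⧸ p) F).comp (Ideal.Quotient.mk p))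
  have hker : ∀ a, ψ a = 0 ↔ a ∈ p := by
    intro a
    rw [← Ideal.Quotient.eq_zero_iff_mem]
    change algebraMap F Ω (algebraMap (R ⧸ p) F _) = 0 ↔ _
    rw [map_eq_zero, map_eq_zero_iff _ (IsFractionRing.injective (R ⧸ p) F)]
    rfl
  let E₀ : Subfield Ω := (algebraMap F Ω).fieldRange
  have hE₀ : ∀ a, ψ a ∈ E₀ := fun a => ⟨_, rfl⟩
  have hfrac : ∀ x ∈ E₀, ∃ u w, w ∉ p ∧ ψ w * x = ψ u := by
    rintro _ ⟨x, rfl⟩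
    obtain ⟨u, w, hw, rfl⟩ := IsFractionRing.div_surjective (A := R ⧸ p) x
    obtain ⟨u, rfl⟩ := Ideal.Quotient.mk_surjective u
    obtain ⟨w, rfl⟩ := Ideal.Quotient.mk_surjective w
    have hw' : w ∉ p := fun h => nonZeroDivisors.ne_zero hw (Ideal.Quotient.eq_zero_iff_mem.2 h)
    refine ⟨u, w, hw', ?_⟩
    have h0 : ψ w ≠ 0 := fun h => hw' ((hker w).1 h)
    rw [map_div₀]
    exact mul_div_cancel₀ (ψ u) h0
  have hnum : ∀ x ∈ weightedSumSq P ψ E₀, ∃ w, w ∉ p ∧ ∃ b ∈ P, ψ w ^ 2 * x = ψ b := by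
    intro x hx
    induction hx using AddSubmonoid.closure_induction with
    | zero => exact ⟨1, fun h => hp.ne_top ((Ideal.eq_top_iff_one _).2 h), 0, hP.zero, by simp⟩
    | add x y _ _ hx hy =>
      obtain ⟨w, hw, b, hb, h1⟩ := hx
      obtain ⟨w', hw', b', hb', h2⟩ := hy
      refine ⟨w * w', fun h => (hp.mem_or_mem h).elim hw hw', w' ^ 2 * b + w ^ 2 * b',
        hP.add _ (hP.mul _ (hP.sq _) _ hb) _ (hP.mul _ (hP.sq _) _ hb'), ?_⟩
      rw [map_mul, map_add, map_mul, map_mul, map_pow, map_pow, ← h1, ← h2]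
      ring
    | mem x hx =>
      obtain ⟨a, ha, x, hx, rfl⟩ := hx
      obtain ⟨u, w, hw, h1⟩ := hfrac x hx
      refine ⟨w, hw, a * u ^ 2, hP.mul _ ha _ (hP.sq _), ?_⟩
      rw [map_mul, map_pow, ← h1]
      ring
  have h₀ : -1 ∉ weightedSumSq P ψ E₀ := by
    intro h
    obtain ⟨w, hw, b, hb, h1⟩ := hnum _ h
    have h2 : w ^ 2 + b ∈ p := by
      rw [← hker, map_add, map_pow, ← h1]; ring
    have h3 : -(w ^ 2) ∈ P := by
      have := hP.add _ ((hpP _).1 h2).2 _ hb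
      rwa [neg_add, neg_add_cancel_right] at this
    exact hw (hp.mem_of_pow_mem 2 ((hpP _).2 ⟨hP.sq w, h3⟩))
  obtain ⟨E, hle, h1, hmax⟩ := exists_maximal_subfield h₀
  have hψ : ∀ a, ψ a ∈ E := fun a => hle (hE₀ a)
  obtain ⟨o, ho, h2, h3, h4⟩ := exists_order_of_maximal_subfield hP hψ h1 hmax
  refine ⟨E, inferInstance, o, ho, ψ.codRestrict E hψ, fun a ha => h2 a (hTP ha), ?_, h3, h4,
    polyIVT_of_irreducible_dvd h4⟩
  intro h
  exact hcp ((hker c).1 (congrArg Subtype.val h))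

section Newton

variable {K : Type*} [CommRing K] [Algebra ℚ K]

/-- The sequence `E` with `E 0 = 1` and `(m + 1) E (m + 1) = -∑ i ≤ m, E (m - i) p i`. If the `p i`
are the power sums of order `i + 1`, these are the signed elementary symmetric functions. -/
def newtonSeq (p : ℕ → K) : ℕ → K
  | 0 => 1
  | m + 1 => -((1 / (m + 1 : ℚ)) • ∑ i : Fin (m + 1), newtonSeq p (m - i) * p i)

theorem newtonSeq_zero (p : ℕ → K) : newtonSeq p 0 = 1 := by rw [newtonSeq]

theorem newtonSeq_succ (p : ℕ → K) (m : ℕ) :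
    (m + 1 : K) * newtonSeq p (m + 1) =
      -∑ i ∈ Finset.range (m + 1), newtonSeq p (m - i) * p i := by
  rw [newtonSeq, Finset.sum_range (fun i => newtonSeq p (m - i) * p i)]
  have h : (m + 1 : K) = algebraMap ℚ K (m + 1) := by simp
  rw [mul_neg, Algebra.smul_def, ← mul_assoc, h, ← map_mul, mul_one_div_cancel (by positivity),
    map_one, one_mul]

theorem algebraRat_isUnit (m : ℕ) : IsUnit (m + 1 : K) := by
  have h : (m + 1 : K) = algebraMap ℚ K (m + 1) := by simp
  rw [h]
  exact (IsUnit.mk0 (m + 1 : ℚ) (by positivity)).map _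

theorem eq_newtonSeq {p E : ℕ → K} (h0 : E 0 = 1)
    (hs : ∀ m : ℕ, (m + 1 : K) * E (m + 1) = -∑ i ∈ Finset.range (m + 1), E (m - i) * p i)
    (m : ℕ) : E m = newtonSeq p m := by
  induction m using Nat.strong_induction_on with
  | _ m ih =>
  cases m with
  | zero => rw [h0, newtonSeq_zero]
  | succ m =>
    apply (algebraRat_isUnit (K := K) m).mul_left_cancel
    rw [hs, newtonSeq_succ]
    congr 1
    exact Finset.sum_congr rfl fun i _ => by rw [ih _ (by omega)]

theorem map_newtonSeq {K' : Type*} [CommRing K'] [Algebra ℚ K'] (f : K →+* K') (p : ℕ → K)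
    (m : ℕ) : f (newtonSeq p m) = newtonSeq (fun i => f (p i)) m := by
  refine eq_newtonSeq (E := fun m => f (newtonSeq p m)) (by simp [newtonSeq_zero]) (fun m => ?_) m
  have := congrArg f (newtonSeq_succ p m)
  simpa using this

theorem newtonSeq_pow_mul (r : K) (p : ℕ → K) (m : ℕ) :
    newtonSeq (fun i => r ^ (i + 1) * p i) m = r ^ m * newtonSeq p m := by
  refine (eq_newtonSeq (E := fun m => r ^ m * newtonSeq p m) (by simp [newtonSeq_zero])
    (fun m => ?_) m).symm
  have := congrArg (fun x => r ^ (m + 1) * x) (newtonSeq_succ p m)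
  rw [mul_left_comm, this, mul_neg, Finset.mul_sum]
  congr 1
  refine Finset.sum_congr rfl fun i hi => ?_
  have : m + 1 = (m - i) + (i + 1) := by have := Finset.mem_range.1 hi; omega
  rw [this, pow_add]
  ring

theorem newtonSeq_two_mul {p : ℕ → K} (hp : ∀ i, p (2 * i) = 0) (m : ℕ) :
    newtonSeq p (2 * m) = newtonSeq (fun i => (1 / 2 : ℚ) • p (2 * i + 1)) m := by
  refine eq_newtonSeq (E := fun m => newtonSeq p (2 * m)) (by simp [newtonSeq_zero])
    (fun m => ?_) m
  have h := newtonSeq_succ p (2 * m + 1)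
  have h2 : (2 : K) * ((1 / 2 : ℚ) • (1 : K)) = 1 := by
    rw [Algebra.smul_def, mul_one, ← map_ofNat (algebraMap ℚ K) 2, ← map_mul]; norm_num
  have hsum : ∀ N : ℕ, ∀ g : ℕ → K, (∀ i, g (2 * i) = 0) →
      ∑ i ∈ Finset.range (2 * N), g i = ∑ i ∈ Finset.range N, g (2 * i + 1) := by
    intro N g hg
    induction N with
    | zero => simp
    | succ N ih =>
      rw [show 2 * (N + 1) = 2 * N + 1 + 1 by ring, Finset.sum_range_succ,
        Finset.sum_range_succ, ih, hg, Finset.sum_range_succ, add_zero]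
  rw [show 2 * m + 1 + 1 = 2 * (m + 1) by ring,
    hsum (m + 1) (fun i => newtonSeq p (2 * m + 1 - i) * p i) (fun i => by simp [hp])] at h
  push_cast at h
  have h3 : (m + 1 : K) * newtonSeq p (2 * (m + 1)) = ((1 / 2 : ℚ) • (1 : K)) *
      ((2 * m + 1 + 1 : K) * newtonSeq p (2 * (m + 1))) := by
    linear_combination (-(m + 1 : K) * newtonSeq p (2 * (m + 1))) * h2
  rw [h3, h, mul_neg, Finset.mul_sum]
  congr 1
  refine Finset.sum_congr rfl fun i hi => ?_
  rw [show 2 * m - 2 * i = 2 * (m - i) by omega, mul_smul_comm, mul_left_comm,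
    smul_mul_assoc, one_mul, mul_smul_comm]

theorem newtonSeq_const_succ (κ : K) (m : ℕ) :
    (m + 1 : K) * newtonSeq (fun _ => κ) (m + 1) = (m - κ) * newtonSeq (fun _ => κ) m := by
  cases m with
  | zero =>
    have := newtonSeq_succ (fun _ => κ) 0
    rw [Finset.sum_range_one, Nat.sub_zero, Nat.cast_zero] at this
    push_cast
    rw [this]; ring
  | succ m =>
    have h1 := newtonSeq_succ (fun _ => κ) (m + 1)
    have h2 := newtonSeq_succ (fun _ => κ) m
    rw [Finset.sum_range_succ'] at h1
    simp only [Nat.add_sub_add_right, Nat.sub_zero] at h1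
    push_cast at h1 ⊢
    linear_combination h1 - h2

end Newton

theorem exists_nat_of_newtonSeq_const {L : Type*} [Field L] [LinearOrder L]
    [IsStrictOrderedRing L] {κ : L} {n : ℕ}
    (h : newtonSeq (fun _ => κ) n = 0) : ∃ k : ℕ, κ = k := by
  by_contra! hne
  suffices ∀ m, newtonSeq (fun _ => κ) m ≠ 0 from this n h
  intro m
  induction m with
  | zero => simp [newtonSeq_zero]
  | succ m ih =>
    intro h0
    have := newtonSeq_const_succ κ m
    rw [h0, mul_zero] at this
    exact (mul_ne_zero (sub_ne_zero.2 (hne m).symm) ih) this.symm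

/-- An algebra with involution over an ordered field with a positive tracial functional `τ` which
satisfies the identities of the trace on `n × n` matrices with transposition. -/
structure IsTraceAlgebra {L A : Type*} [Field L] [LinearOrder L] [IsStrictOrderedRing L] [Ring A]
    [Algebra L A] [StarRing A] (n : ℕ) (τ : A →ₗ[L] L) : Prop where
  star_smul : ∀ (r : L) (a : A), star (r • a) = r • star a
  comm : ∀ a b, τ (a * b) = τ (b * a)
  tau_star : ∀ a, τ (star a) = τ a
  pos : ∀ a, a ≠ 0 → 0 < τ (a * star a)
  tau_one : τ 1 = n
  exists_aeval : ∀ a : A, ∃ p : L[X], p ≠ 0 ∧ aeval a p = 0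
  newton : ∀ a : A, ∀ m > n, newtonSeq (fun i => τ (a ^ (i + 1))) m = 0
  newton_skew : ∀ a b : A, star a = -a → star b = -b → ∀ m > n,
    newtonSeq (fun i => τ ((a * b) ^ (i + 1)) / 2) m = 0

/-- Minimal self-adjoint idempotents. -/
structure IsMinIdem {A : Type*} [Ring A] [StarRing A] (e : A) : Prop where
  ne : e ≠ 0
  sa : star e = e
  idem : e * e = e
  min : ∀ f, star f = f → f * f = f → e * f = f → f * e = f → f = 0 ∨ f = e

namespace IsTraceAlgebra

variable {L A : Type*} [Field L] [LinearOrder L] [IsStrictOrderedRing L] [Ring A]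
    [Algebra L A] [StarRing A] {n : ℕ} {τ : A →ₗ[L] L}

theorem pos' (hA : IsTraceAlgebra n τ) {a : A} (ha : a ≠ 0) : 0 < τ (star a * a) := by
  rw [hA.comm]; exact hA.pos a ha

theorem nonneg (hA : IsTraceAlgebra n τ) (a : A) : 0 ≤ τ (a * star a) := by
  by_cases h : a = 0
  · simp [h]
  · exact (hA.pos a h).le

theorem exists_nat_of_idem (hA : IsTraceAlgebra n τ) {e : A} (he : e * e = e) :
    ∃ k : ℕ, τ e = k := by
  have h := hA.newton e (n + 1) (Nat.lt_succ_self n)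
  have hp : ∀ i, e ^ (i + 1) = e := fun i => by
    induction i with
    | zero => simp
    | succ i ih => rw [pow_succ, ih, he]
  simp only [hp] at h
  exact exists_nat_of_newtonSeq_const h

theorem map_idem_pos (hA : IsTraceAlgebra n τ) {e : A} (he : e * e = e) (hs : star e = e)
    (h0 : e ≠ 0) : 0 < τ e := by
  have := hA.pos e h0
  rwa [hs, he] at this

theorem exists_minIdem_sum (hA : IsTraceAlgebra n τ) (k : ℕ) : ∀ f : A, f * f = f → star f = f →
    τ f = k → ∃ (ι : Type) (_ : Fintype ι) (e : ι → A), (∀ i, IsMinIdem (e i)) ∧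
      (∀ i j, i ≠ j → e i * e j = 0) ∧ ∑ i, e i = f := by
  induction k using Nat.strong_induction_on with
  | _ k ih =>
  intro f hf hfs hk
  by_cases h0 : f = 0
  · exact ⟨Empty, inferInstance, fun i => i.elim, fun i => i.elim, fun i => i.elim, by simp [h0]⟩
  by_cases hmin : IsMinIdem f
  · refine ⟨Unit, inferInstance, fun _ => f, fun _ => hmin, fun i j hij => (hij rfl).elim, by simp⟩
  have : ∃ g, star g = g ∧ g * g = g ∧ f * g = g ∧ g * f = g ∧ g ≠ 0 ∧ g ≠ f := by
    by_contra! hc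
    refine hmin ⟨h0, hfs, hf, fun g h1 h2 h3 h4 => ?_⟩
    by_contra! h
    exact h.2 (hc g h1 h2 h3 h4 h.1)
  obtain ⟨g, hgs, hg, hfg, hgf, hg0, hgne⟩ := this
  have h1 : (f - g) * (f - g) = f - g := by
    rw [mul_sub, sub_mul, sub_mul, hf, hg, hfg, hgf]; abel
  have h1s : star (f - g) = f - g := by rw [star_sub, hfs, hgs]
  obtain ⟨k1, hk1⟩ := hA.exists_nat_of_idem hg
  obtain ⟨k2, hk2⟩ := hA.exists_nat_of_idem h1
  have hp1 := hA.map_idem_pos hg hgs hg0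
  have hp2 := hA.map_idem_pos h1 h1s (sub_ne_zero.2 (Ne.symm hgne))
  have hsum : k1 + k2 = k := by
    have : (k1 : L) + k2 = k := by rw [← hk1, ← hk2, map_sub, hk]; ring
    exact_mod_cast this
  rw [hk1] at hp1
  rw [hk2] at hp2
  have hp1' : 0 < k1 := by exact_mod_cast hp1
  have hp2' : 0 < k2 := by exact_mod_cast hp2
  obtain ⟨ι, _, e, he, heo, hes⟩ := ih k1 (by omega) g hg hgs hk1
  obtain ⟨ι', _, e', he', heo', hes'⟩ := ih k2 (by omega) (f - g) h1 h1s hk2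
  classical
  have hr : ∀ {κ : Type} [Fintype κ] (a : κ → A) (g : A), (∀ i, IsMinIdem (a i)) →
      (∀ i j, i ≠ j → a i * a j = 0) → ∑ i, a i = g → ∀ i, a i * g = a i ∧ g * a i = a i := by
    intro κ _ a g h1 h2 h3 i
    rw [← h3, Finset.mul_sum, Finset.sum_mul, Finset.sum_eq_single i, Finset.sum_eq_single i]
    · exact ⟨(h1 i).idem, (h1 i).idem⟩
    · exact fun j _ hj => h2 j i hj
    · simp
    · exact fun j _ hj => h2 i j hj.symm
    · simp
  have hz : g * (f - g) = 0 := by rw [mul_sub, hg, hgf, sub_self]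
  have hz' : (f - g) * g = 0 := by rw [sub_mul, hg, hfg, sub_self]
  refine ⟨ι ⊕ ι', inferInstance, Sum.elim e e', ?_, ?_, ?_⟩
  · rintro (i | i)
    · exact he i
    · exact he' i
  · rintro (i | i) (j | j) hij
    · exact heo i j (by simpa using hij)
    · simp only [Sum.elim_inl, Sum.elim_inr]
      rw [← (hr e g he heo hes i).1, ← (hr e' _ he' heo' hes' j).2, mul_assoc, ← mul_assoc g, hz]
      simp
    · simp only [Sum.elim_inl, Sum.elim_inr]
      rw [← (hr e g he heo hes j).2, ← (hr e' _ he' heo' hes' i).1, mul_assoc, ← mul_assoc (f - g),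
        hz']
      simp
    · exact heo' i j (by simpa using hij)
  · rw [Fintype.sum_sum_type]
    simp [hes, hes']

theorem star_aeval (hA : IsTraceAlgebra n τ) {a : A} (ha : star a = a) (p : L[X]) :
    star (aeval a p) = aeval a p := by
  induction p using Polynomial.induction_on' with
  | add p q hp hq => rw [map_add, star_add, hp, hq]
  | monomial k r =>
    rw [aeval_monomial, ← Algebra.smul_def, hA.star_smul, star_pow, ha]

theorem corner_selfAdjoint (hA : IsTraceAlgebra n τ)
    (hM : ∀ p : L[X], Irreducible p → 2 ≤ p.natDegree → ∃ Q, IsSumSq Q ∧ p ∣ 1 + Q)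
    {e a : A} (he : IsMinIdem e) (ha : star a = a) (hea : e * a = a) (hae : a * e = a) :
    a = (τ a / τ e) • e := by
  have hτe := hA.map_idem_pos he.idem he.sa he.ne
  suffices ∃ c : L, a = c • e by
    obtain ⟨c, hc⟩ := this
    rw [hc, map_smul, smul_eq_mul, mul_div_cancel_right₀ _ hτe.ne']
  have hcomm : ∀ p : L[X], e * aeval a p = aeval a p * e := fun p => by
    have : Commute e a := by rw [Commute, SemiconjBy, hea, hae]
    induction p using Polynomial.induction_on' with
    | add p q hp hq => rw [map_add, mul_add, add_mul, hp, hq]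
    | monomial k r =>
      rw [aeval_monomial, ← Algebra.smul_def, mul_smul_comm, smul_mul_assoc, (this.pow_right k).eq]
  let S : Set ℕ := {m | ∃ p : L[X], p ≠ 0 ∧ aeval a p * e = 0 ∧ p.natDegree = m}
  have hS : S.Nonempty := by
    obtain ⟨p, hp, h⟩ := hA.exists_aeval a
    exact ⟨_, p, hp, by rw [h, zero_mul], rfl⟩
  obtain ⟨p, hp0, hpe, hpd⟩ := Nat.sInf_mem hS
  have hpmin : ∀ r : L[X], r ≠ 0 → aeval a r * e = 0 → p.natDegree ≤ r.natDegree := fun r h1 h2 => by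
    rw [hpd]; exact Nat.sInf_le ⟨r, h1, h2, rfl⟩
  have hpu : ¬ IsUnit p := by
    intro hu
    obtain ⟨c, hc, rfl⟩ := Polynomial.isUnit_iff.1 hu
    rw [aeval_C, ← Algebra.smul_def] at hpe
    exact (smul_ne_zero hc.ne_zero he.ne) hpe
  obtain ⟨q, hq, r, rfl⟩ := WfDvdMonoid.exists_irreducible_factor hpu hp0
  have hr0 : r ≠ 0 := right_ne_zero_of_mul hp0
  have hqd : 0 < q.natDegree := hq.natDegree_pos
  set y := aeval a r * e with hy
  have hy0 : y ≠ 0 := fun h => by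
    have := hpmin r hr0 h
    rw [natDegree_mul hq.ne_zero hr0] at this
    omega
  have hqy : aeval a q * y = 0 := by rw [hy, ← mul_assoc, ← map_mul, hpe]
  have hys : star y = y := by rw [hy, star_mul, he.sa, hA.star_aeval ha, hcomm]
  have hey : e * y = y := by rw [hy, ← mul_assoc, hcomm, mul_assoc, he.idem]
  have hye : y * e = y := by rw [hy, mul_assoc, he.idem]
  by_cases h2 : 2 ≤ q.natDegree
  · exfalso
    obtain ⟨Q, hQ, h, hQh⟩ := hM q hq h2
    have h0 : τ (y * (aeval a (1 + Q) * y)) = 0 := by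
      rw [hQh, mul_comm, map_mul (aeval a), mul_assoc (aeval a h), hqy, mul_zero, mul_zero, map_zero]
    have hge : ∀ Q : L[X], IsSumSq Q → 0 ≤ τ (y * (aeval a Q * y)) := fun Q hQ => by
      induction hQ with
      | zero => simp
      | sq_add b hb ih =>
        rw [map_add, add_mul, mul_add, map_add]
        refine add_nonneg ?_ ih
        · have := hA.nonneg (y * aeval a b)
          rwa [star_mul, hys, hA.star_aeval ha, mul_assoc, ← mul_assoc (aeval a b), ← map_mul (aeval a)] at this
    have hpos := hA.pos y hy0
    have hge := hge Q hQ
    rw [map_add, map_one, add_mul, one_mul, mul_add, map_add] at h0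
    rw [hys] at hpos
    linarith
  · have hq1 : q.natDegree = 1 := by omega
    obtain ⟨c, hc, d, rfl⟩ := Polynomial.natDegree_eq_one.1 hq1
    obtain ⟨μ, hμ⟩ : ∃ μ, a * y = μ • y := by
      refine ⟨-d / c, ?_⟩
      rw [map_add, map_mul, aeval_C, aeval_C, aeval_X, add_mul, ← Algebra.smul_def,
        ← Algebra.smul_def, smul_mul_assoc] at hqy
      have : c⁻¹ • (c • (a * y) + d • y) = 0 := by rw [hqy, smul_zero]
      rw [smul_add, smul_smul, smul_smul, inv_mul_cancel₀ hc, one_smul] at this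
      rw [eq_neg_of_add_eq_zero_left this, ← neg_smul]
      congr 1
      ring
    have hev : ∀ s : L[X], aeval a s * y = s.eval μ • y := by
      intro s
      induction s using Polynomial.induction_on' with
      | add p q hp hq => rw [map_add, add_mul, hp, hq, eval_add, add_smul]
      | monomial k c =>
        have : ∀ k : ℕ, a ^ k * y = μ ^ k • y := fun k => by
          induction k with
          | zero => simp
          | succ k ih => rw [pow_succ, mul_assoc, hμ, mul_smul_comm, ih, smul_smul, pow_succ']
        rw [aeval_monomial, mul_assoc, this, ← Algebra.smul_def, smul_smul, eval_monomial]
    have hyy : y * y = r.eval μ • y := by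
      conv_lhs => rw [hy]
      rw [mul_assoc, ← hy, hey, hev]
    have hrμ : r.eval μ ≠ 0 := by
      intro h
      have := hA.pos y hy0
      rw [hys, hyy, h, zero_smul, map_zero] at this
      exact lt_irrefl _ this
    have hf := he.min ((r.eval μ)⁻¹ • y) (by rw [hA.star_smul, hys])
      (by rw [smul_mul_smul_comm, hyy, smul_smul, mul_assoc, inv_mul_cancel₀ hrμ, mul_one])
      (by rw [mul_smul_comm, hey]) (by rw [smul_mul_assoc, hye])
    rcases hf with hf | hf
    · exact (smul_ne_zero (inv_ne_zero hrμ) hy0 hf).elim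
    · refine ⟨μ, ?_⟩
      rw [← hae, ← hf, mul_smul_comm, hμ, smul_comm]

end IsTraceAlgebra

/-- Skew elements of the corner ring `e A e`. -/
structure IsSkewCorner {A : Type*} [Ring A] [StarRing A] (e x : A) : Prop where
  left : e * x = x
  right : x * e = x
  skew : star x = -x

namespace IsTraceAlgebra

variable {L A : Type*} [Field L] [LinearOrder L] [IsStrictOrderedRing L] [Ring A]
    [Algebra L A] [StarRing A] {n : ℕ} {τ : A →ₗ[L] L} {e : A}

theorem skew_map_eq_zero (hA : IsTraceAlgebra n τ) {x : A} (hx : star x = -x) : τ x = 0 := by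
  have := hA.tau_star x
  rw [hx, map_neg] at this
  linarith

theorem anticomm (hA : IsTraceAlgebra n τ)
    (hM : ∀ p : L[X], Irreducible p → 2 ≤ p.natDegree → ∃ Q, IsSumSq Q ∧ p ∣ 1 + Q)
    (he : IsMinIdem e) {x y : A} (hx : IsSkewCorner e x) (hy : IsSkewCorner e y) :
    x * y + y * x = (2 * τ (x * y) / τ e) • e := by
  have := hA.corner_selfAdjoint hM he (a := x * y + y * x)
    (by rw [star_add, star_mul, star_mul, hx.skew, hy.skew]; simp [add_comm])
    (by rw [mul_add, ← mul_assoc, ← mul_assoc, hx.left, hy.left])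
    (by rw [add_mul, mul_assoc, mul_assoc, hx.right, hy.right])
  rwa [map_add, hA.comm y x, ← two_mul] at this

theorem exists_normalized (hA : IsTraceAlgebra n τ)
    (hM : ∀ p : L[X], Irreducible p → 2 ≤ p.natDegree → ∃ Q, IsSumSq Q ∧ p ∣ 1 + Q)
    (hsq : ∀ a : L, 0 ≤ a → ∃ b, a = b ^ 2)
    (he : IsMinIdem e) {x : A} (hx : IsSkewCorner e x) (hx0 : x ≠ 0) :
    ∃ c : L, IsSkewCorner e (c • x) ∧ (c • x) * (c • x) = -e := by
  have hτe := hA.map_idem_pos he.idem he.sa he.ne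
  have hp := hA.pos x hx0
  rw [hx.skew, mul_neg, map_neg] at hp
  obtain ⟨b, hb⟩ := hsq (-τ (x * x) / τ e) (div_nonneg hp.le hτe.le)
  have hb0 : b ≠ 0 := by
    rintro rfl
    have : 0 < -τ (x * x) / τ e := div_pos hp hτe
    rw [hb] at this
    simp at this
  have h := hA.anticomm hM he hx hx
  have hxx : x * x = (τ (x * x) / τ e) • e := by
    have h2 : (2 : L) • (x * x) = (2 : L) • ((τ (x * x) / τ e) • e) := by
      rw [two_smul, h, smul_smul, mul_div_assoc]
    have := congrArg (fun z => (2 : L)⁻¹ • z) h2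
    simpa [smul_smul] using this
  refine ⟨b⁻¹, ⟨?_, ?_, ?_⟩, ?_⟩
  · rw [mul_smul_comm, hx.left]
  · rw [smul_mul_assoc, hx.right]
  · rw [hA.star_smul, hx.skew, smul_neg]
  · rw [smul_mul_smul_comm, hxx, smul_smul, ← neg_one_smul L e]
    congr 1
    have : τ (x * x) / τ e = - b ^ 2 := by rw [← hb]; ring
    rw [this]
    field_simp

theorem parseval_of_skew (hA : IsTraceAlgebra n τ)
    (hM : ∀ p : L[X], Irreducible p → 2 ≤ p.natDegree → ∃ Q, IsSumSq Q ∧ p ∣ 1 + Q)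
    (he : IsMinIdem e) {d : ℕ} {q : Fin d → A} (hq : ∀ s, IsSkewCorner e (q s))
    (hp : ∀ w, IsSkewCorner e w → w = ∑ s, (-τ (q s * w) / τ e) • q s) (w : A)
    (h1 : e * w = w) (h2 : w * e = w) :
    w = (τ (star e * w) / τ e) • e + ∑ s, (τ (star (q s) * w) / τ e) • q s := by
  have h1' : star w * e = star w := by rw [← he.sa, ← star_mul, h1]
  have h2' : e * star w = star w := by
    conv_lhs => rw [← he.sa]
    rw [← star_mul, h2]
  have ha := hA.corner_selfAdjoint hM he (a := w + star w) (by simp [add_comm])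
    (by rw [mul_add, h1, h2']) (by rw [add_mul, h2, h1'])
  have hb := hp (w - star w) ⟨by rw [mul_sub, h1, h2'], by rw [sub_mul, h2, h1'], by simp⟩
  rw [map_add, hA.tau_star] at ha
  have hs : ∀ s, -τ (q s * (w - star w)) = 2 * τ (star (q s) * w) := fun s => by
    have : τ (q s * star w) = τ (star (q s) * w) := by
      rw [← hA.tau_star, star_mul, star_star, hA.comm]
    rw [mul_sub, map_sub, this, (hq s).skew, neg_mul, map_neg]
    ring
  simp only [hs] at hb
  have : (2 : L) • w = (2 : L) • ((τ (star e * w) / τ e) • e +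
      ∑ s, (τ (star (q s) * w) / τ e) • q s) := by
    have h3 : (2 : L) • w = (w + star w) + (w - star w) := by rw [two_smul]; abel
    rw [h3, ha, hb, he.sa, h1, smul_add, smul_smul, Finset.smul_sum]
    congr 1
    · congr 1; ring
    · refine Finset.sum_congr rfl fun s _ => ?_
      rw [smul_smul]; congr 1; ring
  have := congrArg (fun z => (2 : L)⁻¹ • z) this
  simpa only [smul_smul, inv_mul_cancel₀ (two_ne_zero' L), one_smul] using this

theorem exists_corner_basis_of_skew (hA : IsTraceAlgebra n τ)
    (hM : ∀ p : L[X], Irreducible p → 2 ≤ p.natDegree → ∃ Q, IsSumSq Q ∧ p ∣ 1 + Q)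
    (he : IsMinIdem e) {d : ℕ} {q : Fin d → A} (hq : ∀ s, IsSkewCorner e (q s))
    (hqq : ∀ s, q s * q s = -e)
    (hp : ∀ w, IsSkewCorner e w → w = ∑ s, (-τ (q s * w) / τ e) • q s) :
    ∃ q : Fin (d + 1) → A, (∀ s, e * q s = q s ∧ q s * e = q s ∧ star (q s) * q s = e ∧
      q s * star (q s) = e) ∧
      ∀ w, e * w = w → w * e = w → w = ∑ s, (τ (star (q s) * w) / τ e) • q s := by
  refine ⟨Fin.cons e q, fun s => ?_, fun w h1 h2 => ?_⟩
  · refine Fin.cases ?_ (fun s => ?_) s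
    · simp [he.sa, he.idem]
    · simp [(hq s).left, (hq s).right, (hq s).skew, hqq]
  · rw [Fin.sum_univ_succ]
    simpa using hA.parseval_of_skew hM he hq hp w h1 h2

theorem exists_corner_basis (hA : IsTraceAlgebra n τ)
    (hM : ∀ p : L[X], Irreducible p → 2 ≤ p.natDegree → ∃ Q, IsSumSq Q ∧ p ∣ 1 + Q)
    (hsq : ∀ a : L, 0 ≤ a → ∃ b, a = b ^ 2)
    (he : IsMinIdem e) :
    ∃ (d m : ℕ), τ e = d * m ∧ ∃ q : Fin d → A,
      (∀ s, e * q s = q s ∧ q s * e = q s ∧ star (q s) * q s = e ∧ q s * star (q s) = e) ∧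
      ∀ w, e * w = w → w * e = w → w = ∑ s, (τ (star (q s) * w) / τ e) • q s := by
  have hτe := hA.map_idem_pos he.idem he.sa he.ne
  by_cases hS : ∀ s, IsSkewCorner e s → s = 0
  · obtain ⟨k, hk⟩ := hA.exists_nat_of_idem he.idem
    refine ⟨1, k, by simp [hk], hA.exists_corner_basis_of_skew hM he (d := 0) (q := ![])
      (fun s => s.elim0) (fun s => s.elim0) fun w hw => by simp [hS w hw]⟩
  push Not at hS
  obtain ⟨i, hi, hii⟩ : ∃ i, IsSkewCorner e i ∧ i * i = -e := by
    obtain ⟨s, hs, hs0⟩ := hS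
    obtain ⟨c, h⟩ := hA.exists_normalized hM hsq he hs hs0
    exact ⟨_, h⟩
  by_cases hS2 : ∀ s, IsSkewCorner e s → i * s + s * i = 0 → s = 0
  · have hm : ∃ m : ℕ, τ e = 2 * m := by
      have h := hA.newton_skew i (-i) hi.skew (by rw [star_neg, hi.skew]) (n + 1) (by omega)
      have hp : ∀ t, (i * -i) ^ (t + 1) = e := fun t => by
        rw [mul_neg, hii, neg_neg]
        induction t with
        | zero => simp
        | succ t ih => rw [pow_succ, ih, he.idem]
      simp only [hp] at h
      obtain ⟨m, hm⟩ := exists_nat_of_newtonSeq_const h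
      exact ⟨m, by rw [← hm]; ring⟩
    obtain ⟨m, hm⟩ := hm
    refine ⟨2, m, by simp [hm], hA.exists_corner_basis_of_skew hM he (d := 1) (q := ![i])
      (by simpa using hi) (by simpa using hii) fun w hw => ?_⟩
    have hw' : IsSkewCorner e (w + (τ (i * w) / τ e) • i) :=
      ⟨by rw [mul_add, mul_smul_comm, hw.left, hi.left],
        by rw [add_mul, smul_mul_assoc, hw.right, hi.right],
        by rw [star_add, hA.star_smul, hw.skew, hi.skew, smul_neg, neg_add]⟩
    have h0 := hS2 _ hw' (by
      rw [hA.anticomm hM he hi hw', mul_add, mul_smul_comm, hii, map_add, map_smul, map_neg,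
        smul_eq_mul, mul_neg, div_mul_cancel₀ _ hτe.ne', add_neg_cancel]
      simp)
    rw [Fin.sum_univ_one]
    simp only [Matrix.cons_val_zero, neg_div, neg_smul]
    exact eq_neg_of_add_eq_zero_left h0
  push Not at hS2
  obtain ⟨j, hj, hij, hjj⟩ : ∃ j, IsSkewCorner e j ∧ i * j + j * i = 0 ∧ j * j = -e := by
    obtain ⟨s, hs, hs1, hs0⟩ := hS2
    obtain ⟨c, h1, h2⟩ := hA.exists_normalized hM hsq he hs hs0
    exact ⟨_, h1, by rw [mul_smul_comm, smul_mul_assoc, ← smul_add, hs1, smul_zero], h2⟩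
  have hji : j * i = -(i * j) := eq_neg_of_add_eq_zero_right hij
  have hk : IsSkewCorner e (i * j) :=
    ⟨by rw [← mul_assoc, hi.left], by rw [mul_assoc, hj.right],
      by rw [star_mul, hi.skew, hj.skew, neg_mul_neg, hji]⟩
  have hkk : (i * j) * (i * j) = -e := by
    rw [mul_assoc, ← mul_assoc j, hji, neg_mul, mul_assoc, hjj, mul_neg, mul_neg, mul_neg, neg_neg,
      ← mul_assoc, hii, neg_mul, he.idem]
  have hm : ∃ m : ℕ, τ e = 4 * m := by
    have h := hA.newton_skew i j hi.skew hj.skew (2 * (n + 1)) (by omega)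
    have he1 : ∀ t, (i * j) ^ (2 * t + 1) = (-1 : L) ^ t • (i * j) := fun t => by
      induction t with
      | zero => simp
      | succ t ih =>
        rw [show 2 * (t + 1) + 1 = (2 * t + 1) + 1 + 1 by ring, pow_succ, pow_succ, ih, mul_assoc,
          hkk, smul_mul_assoc, mul_neg, hk.right, pow_succ, mul_neg_one, neg_smul, smul_neg]
    have he2 : ∀ t, (i * j) ^ (2 * t + 1 + 1) = (-1 : L) ^ (t + 1) • e := fun t => by
      rw [pow_succ, he1, smul_mul_assoc, hkk, pow_succ, mul_neg_one, neg_smul, smul_neg]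
    rw [newtonSeq_two_mul (fun t => by rw [he1, map_smul, hA.skew_map_eq_zero hk.skew]; simp)] at h
    simp only [he2, map_smul] at h
    have h' : newtonSeq (fun t => (-1 : L) ^ (t + 1) * (τ e / 4)) (n + 1) = 0 := by
      rw [← h]
      congr 1
      funext t
      rw [Rat.smul_def, smul_eq_mul]
      push_cast
      ring
    rw [newtonSeq_pow_mul] at h'
    obtain ⟨m, hm⟩ := exists_nat_of_newtonSeq_const
      ((mul_eq_zero.1 h').resolve_left (pow_ne_zero _ (by simp)))
    exact ⟨m, by rw [← hm]; ring⟩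
  obtain ⟨m, hm⟩ := hm
  refine ⟨4, m, by simp [hm], hA.exists_corner_basis_of_skew hM he (d := 3) (q := ![i, j, i * j])
    (fun s => by fin_cases s <;> simpa) (fun s => by fin_cases s <;> simpa) fun w hw => ?_⟩
  rw [Fin.sum_univ_three]
  simp only [Matrix.cons_val_zero, Matrix.cons_val_one, Matrix.cons_val]
  set k := i * j with hkdef
  set w' := w + (τ (i * w) / τ e) • i + (τ (j * w) / τ e) • j + (τ (k * w) / τ e) • k with hw'def
  suffices h0 : w' = 0 by
    rw [hw'def, add_assoc, add_assoc] at h0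
    simp only [neg_div, neg_smul]
    refine (eq_neg_of_add_eq_zero_left h0).trans ?_
    abel
  have hw' : IsSkewCorner e w' :=
    ⟨by simp only [hw'def, mul_add, mul_smul_comm, hw.left, hi.left, hj.left, hk.left],
      by simp only [hw'def, add_mul, smul_mul_assoc, hw.right, hi.right, hj.right, hk.right],
      by simp only [hw'def, star_add, hA.star_smul, hw.skew, hi.skew, hj.skew, hk.skew, smul_neg,
        neg_add]⟩
  have tij : τ (i * j) = 0 := hA.skew_map_eq_zero hk.skew
  have tik : τ (i * k) = 0 := by
    rw [hkdef, ← mul_assoc, hii, neg_mul, hj.left, map_neg, hA.skew_map_eq_zero hj.skew, neg_zero]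
  have tjk : τ (j * k) = 0 := by
    rw [hkdef, ← mul_assoc, hji, neg_mul, mul_assoc, hjj, mul_neg, hi.right, neg_neg,
      hA.skew_map_eq_zero hi.skew]
  have ai : i * w' + w' * i = 0 := by
    have : τ (i * w') = 0 := by
      simp only [hw'def, mul_add, mul_smul_comm, map_add, map_smul, hii, tij, tik, map_neg,
        smul_eq_mul, mul_neg, div_mul_cancel₀ _ hτe.ne']
      ring
    rw [hA.anticomm hM he hi hw', this]; simp
  have aj : j * w' + w' * j = 0 := by
    have : τ (j * w') = 0 := by
      simp only [hw'def, mul_add, mul_smul_comm, map_add, map_smul, hjj, hA.comm j i, tij, tjk,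
        map_neg, smul_eq_mul, mul_neg, div_mul_cancel₀ _ hτe.ne']
      ring
    rw [hA.anticomm hM he hj hw', this]; simp
  have ak : k * w' + w' * k = 0 := by
    have : τ (k * w') = 0 := by
      simp only [hw'def, mul_add, mul_smul_comm, map_add, map_smul, hkk, hA.comm k i, hA.comm k j,
        tik, tjk, map_neg, smul_eq_mul, mul_neg, div_mul_cancel₀ _ hτe.ne']
      ring
    rw [hA.anticomm hM he hk hw', this]; simp
  have hc : k * w' = w' * k := by
    rw [hkdef, mul_assoc, eq_neg_of_add_eq_zero_left aj, mul_neg, ← mul_assoc,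
      eq_neg_of_add_eq_zero_left ai, neg_mul, neg_neg, mul_assoc]
  have hkw : k * w' = 0 := by
    rw [← hc, ← two_smul L] at ak
    exact (smul_eq_zero.1 ak).resolve_left two_ne_zero
  have := congrArg (fun z => k * z) hkw
  simp only [← mul_assoc, hkk, mul_zero, neg_mul, hw'.left] at this
  exact neg_eq_zero.1 this

end IsTraceAlgebra

/-- Equivalence of self-adjoint idempotents through a partial isometry. -/
def IdemEquiv {A : Type*} [Ring A] [StarRing A] (e f : A) : Prop :=
  ∃ u, f * u = u ∧ u * e = u ∧ u * star u = f ∧ star u * u = e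

theorem IdemEquiv.symm {A : Type*} [Ring A] [StarRing A] {e f : A} (he : star e = e)
    (hf : star f = f) (h : IdemEquiv e f) : IdemEquiv f e := by
  obtain ⟨u, h1, h2, h3, h4⟩ := h
  refine ⟨star u, ?_, ?_, ?_, ?_⟩
  · conv_lhs => rw [← he]
    rw [← star_mul, h2]
  · conv_lhs => rw [← hf]
    rw [← star_mul, h1]
  · rwa [star_star]
  · rwa [star_star]

theorem IdemEquiv.trans {A : Type*} [Ring A] [StarRing A] {e f g : A}
    (h : IdemEquiv e f) (h' : IdemEquiv f g) : IdemEquiv e g := by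
  obtain ⟨u, h1, h2, h3, h4⟩ := h
  obtain ⟨v, k1, k2, k3, k4⟩ := h'
  refine ⟨v * u, ?_, ?_, ?_, ?_⟩
  · rw [← mul_assoc, k1]
  · rw [mul_assoc, h2]
  · rw [star_mul, mul_assoc, ← mul_assoc u, h3, ← mul_assoc, k2, k3]
  · rw [star_mul, mul_assoc, ← mul_assoc (star v), k4, h1, h4]

namespace IsTraceAlgebra

variable {L A : Type*} [Field L] [LinearOrder L] [IsStrictOrderedRing L] [Ring A]
    [Algebra L A] [StarRing A] {n : ℕ} {τ : A →ₗ[L] L}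

theorem idemEquiv_of_ne (hA : IsTraceAlgebra n τ)
    (hM : ∀ p : L[X], Irreducible p → 2 ≤ p.natDegree → ∃ Q, IsSumSq Q ∧ p ∣ 1 + Q)
    (hsq : ∀ a : L, 0 ≤ a → ∃ b, a = b ^ 2) {e f x : A}
    (he : IsMinIdem e) (hf : IsMinIdem f) (hx : f * x * e ≠ 0) : IdemEquiv e f := by
  have hτe := hA.map_idem_pos he.idem he.sa he.ne
  set y := f * x * e with hy
  have h1 : f * y = y := by rw [hy, ← mul_assoc, ← mul_assoc, hf.idem]
  have h2 : y * e = y := by rw [hy, mul_assoc, he.idem]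
  have h1' : star y * f = star y := by rw [← hf.sa, ← star_mul, h1]
  have h2' : e * star y = star y := by
    conv_lhs => rw [← he.sa]
    rw [← star_mul, h2]
  have h3 := hA.corner_selfAdjoint hM he (a := star y * y) (by simp) (by rw [← mul_assoc, h2'])
    (by rw [mul_assoc, h2])
  have h4 := hA.corner_selfAdjoint hM hf (a := y * star y) (by simp) (by rw [← mul_assoc, h1])
    (by rw [mul_assoc, h1'])
  set c := τ (star y * y) / τ e with hc
  set c' := τ (y * star y) / τ f with hc'
  have hcc : c = c' := by
    have h5 : y * (star y * y) = y * star y * y := (mul_assoc _ _ _).symm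
    rw [h3, h4, mul_smul_comm, smul_mul_assoc, h1, h2] at h5
    exact smul_left_injective L hx h5
  have hcpos : 0 < c := div_pos (hA.pos' hx) hτe
  obtain ⟨b, hb⟩ := hsq c hcpos.le
  have hb0 : b ≠ 0 := by rintro rfl; simp [hb] at hcpos
  have hbb : b⁻¹ * b⁻¹ * c = 1 := by rw [hb]; field_simp
  refine ⟨b⁻¹ • y, by rw [mul_smul_comm, h1], by rw [smul_mul_assoc, h2], ?_, ?_⟩
  · rw [hA.star_smul, smul_mul_smul_comm, h4, ← hcc, smul_smul, hbb, one_smul]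
  · rw [hA.star_smul, smul_mul_smul_comm, h3, smul_smul, hbb, one_smul]

theorem exists_isotypic_data (hA : IsTraceAlgebra n τ)
    (hM : ∀ p : L[X], Irreducible p → 2 ≤ p.natDegree → ∃ Q, IsSumSq Q ∧ p ∣ 1 + Q)
    (hsq : ∀ a : L, 0 ≤ a → ∃ b, a = b ^ 2) :
    ∃ (ι : Type) (_ : Fintype ι) (e : ι → A) (c : ι → ι) (d m : ι → ℕ)
      (v : ∀ f, Fin (d (c f)) → A),
      (∀ f, 0 < τ (e f)) ∧ (∀ f g, f ≠ g → e f * e g = 0) ∧ ∑ f, e f = 1 ∧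
      (∀ f, τ (e f) = d f * m f) ∧
      (∀ f s, e f * v f s = v f s ∧ star (v f s) * e f = star (v f s) ∧
        star (v f s) * v f s = e (c f) ∧ v f s * star (v f s) = e f) ∧
      (∀ f g b s, ∑ r, (τ (star (v f r) * b * v g s) / τ (e (c f))) • v f r = e f * b * v g s) ∧
      (∀ f g b s, c f ≠ c g → e f * b * v g s = 0) := by
  classical
  obtain ⟨ι, _, e, he, heo, hes⟩ := hA.exists_minIdem_sum n 1 (one_mul 1) (star_one A) hA.tau_one
  have hτ : ∀ f, 0 < τ (e f) := fun f => hA.map_idem_pos (he f).idem (he f).sa (he f).ne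
  let S : Setoid ι :=
    { r := fun f g => IdemEquiv (e f) (e g)
      iseqv :=
        { refl := fun f => ⟨e f, by simp [(he f).idem, (he f).sa]⟩
          symm := fun {f g} h => h.symm (he f).sa (he g).sa
          trans := fun h h' => h.trans h' } }
  let c : ι → ι := fun f => (Quotient.mk S f).out
  have hc : ∀ f, IdemEquiv (e (c f)) (e f) := fun f => Quotient.mk_out (s := S) f
  have hcc : ∀ f g, c f ≠ c g → ∀ b, e f * b * e g = 0 := by
    intro f g hfg b
    by_contra h
    apply hfg
    have : IdemEquiv (e f) (e g) :=
      (hA.idemEquiv_of_ne hM hsq (he g) (he f) h).symm (he g).sa (he f).sa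
    simp only [c]
    congr 1
    exact Quotient.sound (s := S) this
  choose u hu1 hu2 hu3 hu4 using hc
  choose d m hdm q hq hw using fun f => hA.exists_corner_basis hM hsq (he f)
  have hv1 : ∀ f s, e f * (u f * q (c f) s) = u f * q (c f) s := fun f s => by
    rw [← mul_assoc, hu1]
  have hv2 : ∀ f s, star (u f * q (c f) s) * e f = star (u f * q (c f) s) := fun f s => by
    conv_lhs => rw [← (he f).sa]
    rw [← star_mul, hv1]
  have hv3 : ∀ f s, (u f * q (c f) s) * e (c f) = u f * q (c f) s := fun f s => by
    rw [mul_assoc, (hq (c f) s).2.1]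
  have hv0 : ∀ f g b s, c f ≠ c g → e f * b * (u g * q (c g) s) = 0 := fun f g b s h => by
    rw [← hv1, ← mul_assoc, hcc f g h, zero_mul]
  refine ⟨ι, inferInstance, e, c, d, m, fun f s => u f * q (c f) s, hτ, heo, hes, hdm,
    fun f s => ⟨hv1 f s, hv2 f s, ?_, ?_⟩, fun f g b s => ?_, hv0⟩
  · rw [star_mul, mul_assoc, ← mul_assoc (star (u f)), hu4, (hq (c f) s).1, (hq (c f) s).2.2.1]
  · rw [star_mul, mul_assoc, ← mul_assoc (q (c f) s), (hq (c f) s).2.2.2, ← mul_assoc, hu2, hu3]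
  · by_cases h : c f = c g
    · have hwc : (e f * b * (u g * q (c g) s)) * e (c f) = e f * b * (u g * q (c g) s) := by
        rw [h, mul_assoc, hv3]
      set w := e f * b * (u g * q (c g) s) with hwdef
      have hfw : e f * w = w := by
        simp only [hwdef, ← mul_assoc, (he f).idem]
      have h1 : ∀ r, star (u f * q (c f) r) * b * (u g * q (c g) s) =
          star (q (c f) r) * (star (u f) * w) := fun r => by
        rw [hwdef, ← hv2]
        simp only [star_mul, mul_assoc]
      have h2 := hw (c f) (star (u f) * w)
        (by
          conv_lhs => rw [← (he (c f)).sa]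
          rw [← mul_assoc, ← star_mul, hu2])
        (by rw [mul_assoc, hwc])
      have h3 := congrArg (fun z => u f * z) h2
      simp only [← mul_assoc, hu3, hfw, Finset.mul_sum, mul_smul_comm] at h3
      rw [h3]
      refine Finset.sum_congr rfl fun r _ => ?_
      rw [h1]
      simp only [mul_assoc]
    · rw [hv0 f g b s h]
      refine Finset.sum_eq_zero fun r _ => ?_
      rw [← hv2, mul_assoc, mul_assoc, ← mul_assoc (e f), hv0 f g b s h, mul_zero, map_zero,
        zero_div, zero_smul]

/-- A positive trace algebra over a real closed field embeds in the matrix algebra. -/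
theorem exists_matrix_rep (hA : IsTraceAlgebra n τ)
    (hM : ∀ p : L[X], Irreducible p → 2 ≤ p.natDegree → ∃ Q, IsSumSq Q ∧ p ∣ 1 + Q)
    (hsq : ∀ a : L, 0 ≤ a → ∃ b, a = b ^ 2) :
    ∃ ρ : A →ₐ[L] Matrix (Fin n) (Fin n) L,
      (∀ a, ρ (star a) = (ρ a).transpose) ∧ ∀ a, (ρ a).trace = τ a := by
  classical
  obtain ⟨ι, _, e, c, d, m, v, hτ, heo, hes, hdm, hv, hexp, hv0⟩ :=
    hA.exists_isotypic_data hM hsq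
  let I := Σ f, Fin (d (c f)) × Fin (m (c f))
  let R : A →ₗ[L] Matrix I I L :=
    { toFun := fun a => Matrix.of fun p q => if (p.2.2 : ℕ) = q.2.2 then
        τ (star (v p.1 p.2.1) * a * v q.1 q.2.1) / τ (e (c p.1)) else 0
      map_add' := fun a b => by
        ext p q
        simp only [Matrix.of_apply, Matrix.add_apply]
        split_ifs
        · rw [mul_add, add_mul, map_add, add_div]
        · simp
      map_smul' := fun r a => by
        ext p q
        simp only [Matrix.of_apply, Matrix.smul_apply, RingHom.id_apply, smul_eq_mul]
        split_ifs
        · rw [mul_smul_comm, smul_mul_assoc, map_smul, smul_eq_mul, mul_div_assoc]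
        · simp }
  have hR : ∀ a p q, R a p q = if (p.2.2 : ℕ) = q.2.2 then
        τ (star (v p.1 p.2.1) * a * v q.1 q.2.1) / τ (e (c p.1)) else 0 := fun _ _ _ => rfl
  have hz : ∀ f g b s r, c f ≠ c g → star (v f s) * b * v g r = 0 := fun f g b s r h => by
    rw [← (hv f s).2.1, mul_assoc, mul_assoc, ← mul_assoc (e f), hv0 f g b r h, mul_zero]
  have hstar : ∀ a, R (star a) = (R a).transpose := fun a => by
    ext p q
    rw [Matrix.transpose_apply, hR, hR]
    by_cases h : (p.2.2 : ℕ) = q.2.2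
    · rw [if_pos h, if_pos h.symm]
      by_cases hc : c p.1 = c q.1
      · rw [congrArg e hc, ← hA.tau_star]
        congr 2
        simp [mul_assoc]
      · rw [hz _ _ _ _ _ hc, hz _ _ _ _ _ (Ne.symm hc)]; simp
    · rw [if_neg h, if_neg (Ne.symm h)]
  have htr : ∀ a, (R a).trace = τ a := fun a => by
    rw [Matrix.trace]
    simp only [Matrix.diag, hR, if_true]
    rw [Fintype.sum_sigma]
    have : ∀ f, ∑ x : Fin (d (c f)) × Fin (m (c f)),
        τ (star (v f x.1) * a * v f x.1) / τ (e (c f)) = τ (a * e f) := fun f => by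
      have : ∀ s, τ (star (v f s) * a * v f s) = τ (a * e f) := fun s => by
        rw [hA.comm, ← mul_assoc, (hv f s).2.2.2, hA.comm]
      simp only [this]
      have h1 := (hτ (c f)).ne'
      rw [Finset.sum_const, Finset.card_univ, Fintype.card_prod, Fintype.card_fin,
        Fintype.card_fin, nsmul_eq_mul, Nat.cast_mul, ← hdm, mul_div_cancel₀ _ h1]
    simp only [this]
    rw [← map_sum, ← Finset.mul_sum, hes, mul_one]
  have hmul : ∀ a b, R (a * b) = R a * R b := fun a b => by
    ext p q
    rw [Matrix.mul_apply, Fintype.sum_sigma]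
    have h1 : ∀ f, ∑ x : Fin (d (c f)) × Fin (m (c f)), R a p ⟨f, x⟩ * R b ⟨f, x⟩ q =
        if (p.2.2 : ℕ) = q.2.2 then
          τ (star (v p.1 p.2.1) * a * (e f * b * v q.1 q.2.1)) / τ (e (c p.1)) else 0 := by
      intro f
      rw [Fintype.sum_prod_type]
      by_cases hc : c f = c q.1
      · have hm : m (c f) = m (c q.1) := by rw [hc]
        have h2 : ∀ s, ∑ t, R a p ⟨f, (s, t)⟩ * R b ⟨f, (s, t)⟩ q =
            if (p.2.2 : ℕ) = q.2.2 then τ (star (v p.1 p.2.1) * a * v f s) / τ (e (c p.1)) *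
              (τ (star (v f s) * b * v q.1 q.2.1) / τ (e (c f))) else 0 := fun s => by
          rw [Finset.sum_eq_single (Fin.cast hm.symm q.2.2)]
          · simp only [hR, Fin.val_cast, if_true]
            split_ifs <;> simp
          · intro t _ ht
            have : (t : ℕ) ≠ q.2.2 := fun h => ht (Fin.ext h)
            simp only [hR, if_neg this, mul_zero]
          · simp
        simp only [h2]
        split_ifs
        · rw [← hexp, Finset.mul_sum, map_sum, Finset.sum_div]
          refine Finset.sum_congr rfl fun s _ => ?_
          rw [mul_smul_comm, map_smul, smul_eq_mul]
          ring
        · simp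
      · rw [hv0 _ _ _ _ hc]
        simp only [hR]
        simp [hz _ _ _ _ _ hc]
    rw [Finset.sum_congr rfl fun f _ => h1 f, hR]
    split_ifs
    · rw [← Finset.sum_div, ← map_sum, ← Finset.mul_sum]
      simp only [← Finset.sum_mul, hes, one_mul, mul_assoc]
    · simp
  have horth : ∀ f s s', s ≠ s' → τ (star (v f s) * v f s') = 0 := fun f s s' hs => by
    have h1 := (hτ (c f)).ne'
    have h2 := congrArg (fun z => τ (star (v f s') * z)) (hexp f f 1 s')
    simp only [mul_one, Finset.mul_sum, map_sum, mul_smul_comm, map_smul, smul_eq_mul,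
      (hv f s').1, (hv f s').2.2.1] at h2
    rw [← Finset.add_sum_erase _ _ (Finset.mem_univ s'), (hv f s').2.2.1, div_self h1, one_mul] at h2
    have h3 := left_eq_add.1 h2.symm
    have h4 : ∀ r, τ (star (v f s') * v f r) = τ (star (v f r) * v f s') := fun r => by
      rw [← hA.tau_star]; simp
    rw [Finset.sum_eq_zero_iff_of_nonneg] at h3
    · have := h3 s (by simp [hs])
      rw [h4, mul_eq_zero, div_eq_zero_iff] at this
      simpa [h1] using this
    · intro r _
      rw [h4, div_mul_eq_mul_div]
      exact div_nonneg (mul_self_nonneg _) (hτ _).le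
  have hone : R 1 = 1 := by
    ext p q
    rw [hR, mul_one]
    by_cases hpq : p = q
    · subst hpq
      rw [if_pos rfl, (hv _ _).2.2.1, div_self (hτ _).ne', Matrix.one_apply_eq]
    · rw [Matrix.one_apply_ne hpq]
      obtain ⟨f, s, t⟩ := p
      obtain ⟨g, s', t'⟩ := q
      by_cases hfg : f = g
      · subst hfg
        by_cases ht : (t : ℕ) = t'
        · rw [if_pos ht, horth, zero_div]
          rintro rfl
          exact hpq (by rw [Fin.ext ht])
        · exact if_neg ht
      · have : star (v f s) * v g s' = 0 := by
          rw [← (hv f s).2.1, ← (hv g s').1, mul_assoc, ← mul_assoc (e f), heo _ _ hfg]; simp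
        simp [this]
  have hcard : Fintype.card I = n := by
    have h1 := htr 1
    rw [hone, Matrix.trace_one, hA.tau_one] at h1
    exact_mod_cast h1
  let φ := Fintype.equivFinOfCardEq hcard
  refine ⟨(Matrix.reindexAlgEquiv L L φ).toAlgHom.comp (AlgHom.ofLinearMap R hone hmul),
    fun a => ?_, fun a => ?_⟩
  · simp [hstar]
  · simp only [AlgHom.comp_apply, AlgHom.ofLinearMap_apply]
    rw [← htr a, Matrix.trace, Matrix.trace]
    exact Fintype.sum_equiv φ.symm _ _ fun x => by simp

end IsTraceAlgebra

section Jacobi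

variable {m : Type*} [Fintype m] [DecidableEq m] {R : Type*} [CommRing R]

theorem derivative_det_eq (M : Matrix m m R[X]) :
    derivative M.det = (M.adjugate * M.map (fun p => derivative p)).trace := by
  have h : ∀ k, (M.adjugate * M.map (fun p => derivative p)) k k =
      (M.updateCol k fun i => derivative (M i k)).det := fun k => by
    rw [← cramer_apply, cramer_eq_adjugate_mulVec]
    simp [Matrix.mul_apply, mulVec, dotProduct]
  simp only [Matrix.trace, Matrix.diag, h]
  simp only [det_apply, derivative_sum]
  rw [Finset.sum_comm]
  refine Finset.sum_congr rfl fun σ _ => ?_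
  rw [← Finset.smul_sum, Units.smul_def, Units.smul_def, derivative_smul, derivative_prod_finset]
  congr 1
  refine Finset.sum_congr rfl fun k _ => ?_
  rw [← Finset.mul_prod_erase _ _ (Finset.mem_univ k), mul_comm]
  congr 1
  · simp
  · refine Finset.prod_congr rfl fun i hi => ?_
    rw [updateCol_ne (Finset.ne_of_mem_erase hi)]

theorem charpolyRev_newton (M : Matrix m m R) (k : ℕ) :
    (k + 1 : R) * M.charpolyRev.coeff (k + 1) =
      -∑ i ∈ Finset.range (k + 1), M.charpolyRev.coeff (k - i) * (M ^ (i + 1)).trace := by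
  set B : Matrix m m R[X] := 1 - (X : R[X]) • M.map C with hB
  set N := B.adjugate with hN
  have hD : M.charpolyRev = B.det := rfl
  let c : ℕ → Matrix m m R := fun k => N.map fun p => p.coeff k
  have hNB : N - (X : R[X]) • (N * M.map C) = M.charpolyRev • 1 := by
    rw [hD, ← adjugate_mul, ← hN, hB, mul_sub, mul_one, mul_smul_comm]
  have hNM : ∀ k, (N * M.map C).map (fun p => p.coeff k) = c k * M := fun k => by
    ext i j
    simp [Matrix.mul_apply, c, coeff_mul_C]
  have h0 : c 0 = M.charpolyRev.coeff 0 • 1 := by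
    ext i j
    have := congrArg (fun Z : Matrix m m R[X] => (Z i j).coeff 0) hNB
    simp only [Matrix.sub_apply, Matrix.smul_apply, smul_eq_mul, coeff_sub, mul_coeff_zero,
      coeff_X_zero, zero_mul, sub_zero] at this
    simp only [c, Matrix.map_apply, this, Matrix.smul_apply, smul_eq_mul, Matrix.one_apply]
    split_ifs <;> simp
  have hs : ∀ k, c (k + 1) = c k * M + M.charpolyRev.coeff (k + 1) • 1 := fun k => by
    ext i j
    have := congrArg (fun Z : Matrix m m R[X] => (Z i j).coeff (k + 1)) hNB
    simp only [Matrix.sub_apply, Matrix.smul_apply, smul_eq_mul, coeff_sub, coeff_X_mul] at this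
    have h2 := congrFun (congrFun (hNM k) i) j
    rw [Matrix.map_apply] at h2
    rw [h2, sub_eq_iff_eq_add] at this
    simp only [c, Matrix.map_apply, this, Matrix.add_apply, Matrix.smul_apply, smul_eq_mul,
      Matrix.one_apply]
    split_ifs <;> simp [add_comm]
  have hc : ∀ k, c k = ∑ i ∈ Finset.range (k + 1), M.charpolyRev.coeff (k - i) • M ^ i := by
    intro k
    induction k with
    | zero => simp [h0]
    | succ k ih =>
      rw [Finset.sum_range_succ' _ (k + 1), hs, ih, Finset.sum_mul]
      simp [pow_succ]
  have hder := derivative_det_eq B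
  have hBd : B.map (fun p => derivative p) = -M.map C := by
    ext1 i j
    simp only [hB, Matrix.map_apply, Matrix.sub_apply, Matrix.smul_apply, smul_eq_mul,
      Matrix.one_apply, Matrix.neg_apply, derivative_sub, derivative_mul, derivative_X,
      derivative_C, one_mul, mul_zero, add_zero]
    split_ifs <;> simp
  rw [← hD, hBd, mul_neg, trace_neg, ← hN] at hder
  have := congrArg (fun p => p.coeff k) hder
  simp only [coeff_derivative, coeff_neg] at this
  rw [mul_comm, this]
  congr 1
  have htr : ∀ Z : Matrix m m R[X], Z.trace.coeff k = (Z.map fun p => p.coeff k).trace := fun Z => by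
    simp [Matrix.trace]
  rw [htr, hNM, hc, Finset.sum_mul, trace_sum]
  refine Finset.sum_congr rfl fun i _ => ?_
  rw [smul_mul_assoc, ← pow_succ, trace_smul, smul_eq_mul]

theorem charpolyRev_coeff_eq_newtonSeq [Algebra ℚ R] (M : Matrix m m R) (k : ℕ) :
    M.charpolyRev.coeff k = newtonSeq (fun i => (M ^ (i + 1)).trace) k :=
  eq_newtonSeq (E := fun k => M.charpolyRev.coeff k)
    (by simp [coeff_zero_eq_eval_zero]) (charpolyRev_newton M) k

theorem natDegree_charpolyRev_le (M : Matrix m m R) : M.charpolyRev.natDegree ≤ Fintype.card m := by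
  have := natDegree_det_X_add_C_le (-M) (1 : Matrix m m R)
  rwa [show (X : R[X]) • (-M).map C + (1 : Matrix m m R).map C = 1 - (X : R[X]) • M.map C by
    ext1 i j; simp [sub_eq_add_neg, add_comm, Matrix.one_apply]] at this

theorem newtonSeq_trace_eq_zero [Algebra ℚ R] (M : Matrix m m R) {k : ℕ}
    (hk : Fintype.card m < k) : newtonSeq (fun i => (M ^ (i + 1)).trace) k = 0 := by
  rw [← charpolyRev_coeff_eq_newtonSeq]
  exact coeff_eq_zero_of_natDegree_lt ((natDegree_charpolyRev_le M).trans_lt hk)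

theorem charpoly_coeff_eq_newtonSeq [Algebra ℚ R] [Nontrivial R] (M : Matrix m m R) {k : ℕ}
    (hk : k ≤ Fintype.card m) :
    M.charpoly.coeff (Fintype.card m - k) = newtonSeq (fun i => (M ^ (i + 1)).trace) k := by
  rw [← charpolyRev_coeff_eq_newtonSeq, ← reverse_charpoly, coeff_reverse,
    charpoly_natDegree_eq_dim, revAt_le hk]

/-- The Cayley-Hamilton identity with coefficients expressed by traces of powers. -/
theorem sum_newtonSeq_smul_pow_eq_zero [Algebra ℚ R] [Nontrivial R] (M : Matrix m m R) :
    ∑ k ∈ Finset.range (Fintype.card m + 1),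
      newtonSeq (fun i => (M ^ (i + 1)).trace) k • M ^ (Fintype.card m - k) = 0 := by
  have h := aeval_self_charpoly M
  rw [aeval_eq_sum_range, charpoly_natDegree_eq_dim, ← Finset.sum_range_reflect] at h
  rw [← h]
  refine Finset.sum_congr rfl fun k hk => ?_
  have hk : k ≤ Fintype.card m := Nat.lt_succ_iff.1 (Finset.mem_range.1 hk)
  rw [show Fintype.card m + 1 - 1 - k = Fintype.card m - k by omega,
    charpoly_coeff_eq_newtonSeq M hk]

end Jacobi

section Pfaffian

variable {F : Type*} [Field F] [CharZero F]

theorem isSquare_det_of_skew (k : ℕ) : ∀ A : Matrix (Fin k) (Fin k) F, Aᵀ = -A →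
    IsSquare A.det := by
  induction k using Nat.strong_induction_on with
  | _ k ih =>
  intro A hA
  have hd : ∀ i, A i i = 0 := fun i => by
    have := congrFun (congrFun hA i) i
    rw [transpose_apply, Matrix.neg_apply] at this
    exact self_eq_neg.1 this
  rcases k with _ | _ | k
  · simp
  · rw [det_fin_one, hd]; simp
  by_cases h0 : ∀ j, A 0 j = 0
  · rw [det_eq_zero_of_row_eq_zero 0 h0]; simp
  push Not at h0
  obtain ⟨j, hj⟩ := h0
  have hj0 : j ≠ 0 := by rintro rfl; exact hj (hd 0)
  let σ : Fin 2 ⊕ Fin k ≃ Fin (k + 2) :=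
    (finSumFinEquiv.trans (finCongr (add_comm 2 k))).trans (Equiv.swap 1 j)
  have hσ0 : σ (Sum.inl 0) = 0 := by
    have : (finCongr (add_comm 2 k)) (finSumFinEquiv (Sum.inl 0)) = (0 : Fin (k + 2)) := rfl
    simp only [σ, Equiv.trans_apply, this]
    exact Equiv.swap_apply_of_ne_of_ne (by simp) hj0.symm
  have hσ1 : σ (Sum.inl 1) = j := by
    have : (finCongr (add_comm 2 k)) (finSumFinEquiv (Sum.inl 1)) = (1 : Fin (k + 2)) := rfl
    simp only [σ, Equiv.trans_apply, this]
    exact Equiv.swap_apply_left _ _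
  set B := A.submatrix σ σ with hB
  have hBs : Bᵀ = -B := by rw [hB, transpose_submatrix, hA]; rfl
  rw [← det_submatrix_equiv_self σ A, ← hB, ← fromBlocks_toBlocks B]
  set P := B.toBlocks₁₁ with hP
  have hPs : Pᵀ = -P := by
    ext a b
    exact congrFun (congrFun hBs (Sum.inl a)) (Sum.inl b)
  have hSs : B.toBlocks₂₂ᵀ = -B.toBlocks₂₂ := by
    ext a b
    exact congrFun (congrFun hBs (Sum.inr a)) (Sum.inr b)
  have hQ : B.toBlocks₂₁ = -B.toBlocks₁₂ᵀ := by
    ext a b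
    have := congrFun (congrFun hBs (Sum.inl b)) (Sum.inr a)
    exact this
  have h01 : P 0 1 = A 0 j := by
    change A (σ (Sum.inl 0)) (σ (Sum.inl 1)) = _
    rw [hσ0, hσ1]
  have hP00 : P 0 0 = 0 := hd _
  have hP10 : P 1 0 = -P 0 1 := congrFun (congrFun hPs 0) 1
  have hdet : P.det = A 0 j * A 0 j := by rw [det_fin_two, hP00, hP10, h01]; ring
  have hu : IsUnit P.det := by rw [hdet]; exact (mul_ne_zero hj hj).isUnit
  have : Invertible P := P.invertibleOfIsUnitDet hu
  rw [det_fromBlocks₁₁, hdet, hQ]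
  refine IsSquare.mul ⟨_, rfl⟩ (ih k (by omega) _ ?_)
  have hinv : (⅟P)ᵀ = -⅟P := by
    rw [invOf_eq_nonsing_inv, transpose_nonsing_inv, hPs]
    refine inv_eq_left_inv ?_
    rw [neg_mul_neg, nonsing_inv_mul _ hu]
  simp only [transpose_sub, transpose_mul, transpose_neg, transpose_transpose, hSs, hinv,
    Matrix.neg_mul, Matrix.mul_neg, Matrix.mul_assoc]
  abel

theorem isSquare_det_one_sub_mul {k : ℕ} {a b : Matrix (Fin k) (Fin k) F} (ha : aᵀ = -a)
    (hb : bᵀ = -b) : IsSquare (1 - a * b).det := by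
  have hs : ∀ M : Matrix (Fin k ⊕ Fin k) (Fin k ⊕ Fin k) F, Mᵀ = -M → IsSquare M.det := by
    intro M hM
    rw [← det_submatrix_equiv_self finSumFinEquiv.symm M]
    exact isSquare_det_of_skew _ _ (by rw [transpose_submatrix, hM]; rfl)
  have h1 := hs (fromBlocks (-a) 1 (-1) b) (by
    rw [fromBlocks_transpose, fromBlocks_neg, transpose_neg, ha, hb]; simp)
  have h2 := hs (fromBlocks 0 (-1) 1 0) (by
    rw [fromBlocks_transpose, fromBlocks_neg]; simp)
  have h3 := h1.mul h2
  rw [← det_mul, fromBlocks_multiply] at h3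
  simpa using h3

end Pfaffian

theorem derivative_mk_newtonSeq {K : Type*} [CommRing K] [Algebra ℚ K] (p : ℕ → K) :
    PowerSeries.derivative K (PowerSeries.mk (newtonSeq p)) =
      -(PowerSeries.mk (newtonSeq p) * PowerSeries.mk p) := by
  ext k
  rw [PowerSeries.coeff_derivative, PowerSeries.coeff_mk, mul_comm, newtonSeq_succ, map_neg,
    PowerSeries.coeff_mul, Finset.Nat.sum_antidiagonal_eq_sum_range_succ_mk,
    ← Finset.sum_range_reflect]
  congr 1
  refine Finset.sum_congr rfl fun i hi => ?_
  have := Finset.mem_range.1 hi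
  rw [PowerSeries.coeff_mk, PowerSeries.coeff_mk]
  congr 2; all_goals omega

theorem mk_newtonSeq_mul {K : Type*} [CommRing K] [Algebra ℚ K] (p q : ℕ → K) :
    PowerSeries.mk (newtonSeq p) * PowerSeries.mk (newtonSeq q) =
      PowerSeries.mk (newtonSeq fun i => p i + q i) := by
  ext k
  rw [PowerSeries.coeff_mk]
  refine eq_newtonSeq
    (E := fun k => PowerSeries.coeff k (PowerSeries.mk (newtonSeq p) * PowerSeries.mk (newtonSeq q)))
    (by simp [newtonSeq_zero]) (fun m => ?_) k
  have h : PowerSeries.derivative K (PowerSeries.mk (newtonSeq p) * PowerSeries.mk (newtonSeq q)) =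
      -((PowerSeries.mk (newtonSeq p) * PowerSeries.mk (newtonSeq q)) *
        PowerSeries.mk fun i => p i + q i) := by
    rw [Derivation.leibniz, derivative_mk_newtonSeq, derivative_mk_newtonSeq, smul_eq_mul,
      smul_eq_mul, show (PowerSeries.mk fun i => p i + q i) = PowerSeries.mk p + PowerSeries.mk q
        by ext; simp]
    ring
  generalize PowerSeries.mk (newtonSeq p) * PowerSeries.mk (newtonSeq q) = F at h ⊢
  have := congrArg (PowerSeries.coeff m) h
  rw [PowerSeries.coeff_derivative, map_neg, PowerSeries.coeff_mul,
    Finset.Nat.sum_antidiagonal_eq_sum_range_succ_mk, ← Finset.sum_range_reflect] at this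
  rw [mul_comm, this]
  congr 1
  refine Finset.sum_congr rfl fun i hi => ?_
  have := Finset.mem_range.1 hi
  rw [PowerSeries.coeff_mk]
  rw [show m - (m.succ - 1 - i) = i by omega, show m.succ - 1 - i = m - i by omega]

theorem newtonSeq_half_trace_eq_zero {R : Type*} [CommRing R] [IsDomain R]
    [UniqueFactorizationMonoid R] [Algebra ℚ R] {k : ℕ} {a b : Matrix (Fin k) (Fin k) R}
    (ha : a.transpose = -a) (hb : b.transpose = -b) {m : ℕ} (hm : k < m) :
    newtonSeq (fun i => (1 / 2 : ℚ) • ((a * b) ^ (i + 1)).trace) m = 0 := by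
  have : CharZero R := algebraRat.charZero R
  let K := FractionRing R[X]
  let f : R →+* K := (algebraMap R[X] K).comp C
  have hsq : IsSquare (algebraMap R[X] K (a * b).charpolyRev) := by
    have h1 : algebraMap R[X] K (a * b).charpolyRev =
        (1 - (algebraMap R[X] K X) • a.map f * b.map f).det := by
      rw [Matrix.charpolyRev, RingHom.map_det]
      congr 1
      ext i j
      simp [f, Matrix.mul_apply, Matrix.one_apply, apply_ite, Finset.mul_sum]
      rw [Finset.smul_sum]
      exact Finset.sum_congr rfl fun x _ => (Algebra.smul_def _ _).symm
    rw [h1]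
    refine isSquare_det_one_sub_mul ?_ ?_
    · rw [Matrix.transpose_smul, ← Matrix.transpose_map, ha, ← smul_neg]
      congr 1; ext i j; simp
    · rw [← Matrix.transpose_map, hb]; ext i j; simp
  obtain ⟨q₀, hq₀⟩ := hsq
  obtain ⟨q, rfl⟩ := IsIntegrallyClosed.exists_algebraMap_eq_of_isIntegral_pow (R := R[X])
    (x := q₀) two_pos (by rw [sq, ← hq₀]; exact isIntegral_algebraMap)
  rw [← map_mul] at hq₀
  have hq : (a * b).charpolyRev = q * q := IsFractionRing.injective R[X] K hq₀
  set E := PowerSeries.mk (newtonSeq fun i => (1 / 2 : ℚ) • ((a * b) ^ (i + 1)).trace) with hE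
  have hEE : E * E = (q : PowerSeries R) * q := by
    rw [hE, mk_newtonSeq_mul, ← Polynomial.coe_mul, ← hq]
    ext i
    rw [PowerSeries.coeff_mk, Polynomial.coeff_coe, charpolyRev_coeff_eq_newtonSeq]
    congr 1
    ext j
    rw [← add_smul]; norm_num
  have hdeg : q.natDegree < m := by
    have h1 := natDegree_charpolyRev_le (a * b)
    rw [hq, Fintype.card_fin] at h1
    by_cases h0 : q = 0
    · rw [h0, natDegree_zero]; omega
    · rw [natDegree_mul h0 h0] at h1; omega
  have hc : newtonSeq (fun i => (1 / 2 : ℚ) • ((a * b) ^ (i + 1)).trace) m =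
      PowerSeries.coeff m E := by rw [hE, PowerSeries.coeff_mk]
  rw [hc]
  rcases mul_self_eq_mul_self_iff.1 hEE with h | h <;>
    simp [h, Polynomial.coeff_coe, coeff_eq_zero_of_natDegree_lt hdeg]

section PolyFun

variable (L : Type*) [Field L] (V : Type*) [AddCommGroup V] [Module L V]

/-- Polynomial functions of one variable with values in a vector space. -/
def polyFun : Submodule L (L → V) :=
  Submodule.span L {f | ∃ (i : ℕ) (a : V), f = fun r => r ^ i • a}

variable {L V}

theorem polyFun.const (a : V) : (fun _ : L => a) ∈ polyFun L V :=
  Submodule.subset_span ⟨0, a, by simp⟩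

theorem polyFun.line (a b : V) : (fun r : L => a + r • b) ∈ polyFun L V :=
  (polyFun L V).add_mem (polyFun.const a) (Submodule.subset_span ⟨1, b, by simp⟩)

theorem polyFun.add {f g : L → V} (hf : f ∈ polyFun L V) (hg : g ∈ polyFun L V) :
    (fun r => f r + g r) ∈ polyFun L V :=
  (polyFun L V).add_mem hf hg

theorem polyFun.smul (c : L) {f : L → V} (hf : f ∈ polyFun L V) :
    (fun r => c • f r) ∈ polyFun L V :=
  (polyFun L V).smul_mem c hf

theorem polyFun.map {V' : Type*} [AddCommGroup V'] [Module L V'] (g : V →ₗ[L] V') {f : L → V}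
    (hf : f ∈ polyFun L V) : (fun r => g (f r)) ∈ polyFun L V' := by
  induction hf using Submodule.span_induction with
  | mem f hf =>
    obtain ⟨i, a, rfl⟩ := hf
    exact Submodule.subset_span ⟨i, g a, by simp⟩
  | zero => simpa using polyFun.const (L := L) (0 : V')
  | add f₁ f₂ _ _ h₁ h₂ => simpa using polyFun.add h₁ h₂
  | smul c f _ h => simpa using polyFun.smul c h

theorem polyFun.mul {A : Type*} [Ring A] [Algebra L A] {f g : L → A}
    (hf : f ∈ polyFun L A) (hg : g ∈ polyFun L A) : (fun r => f r * g r) ∈ polyFun L A := by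
  induction hf using Submodule.span_induction with
  | mem f hf =>
    obtain ⟨i, a, rfl⟩ := hf
    induction hg using Submodule.span_induction with
    | mem g hg =>
      obtain ⟨j, b, rfl⟩ := hg
      exact Submodule.subset_span ⟨i + j, a * b, by ext r; simp [pow_add, mul_smul, smul_comm (r ^ j)]⟩
    | zero => simpa using polyFun.const (L := L) (0 : A)
    | add f₁ f₂ _ _ h₁ h₂ => simpa [mul_add] using polyFun.add h₁ h₂
    | smul c f _ h =>
      convert (polyFun L A).smul_mem c h using 1
      ext r; simp [smul_comm c]
  | zero => simpa using polyFun.const (L := L) (0 : A)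
  | add f₁ f₂ _ _ h₁ h₂ => simpa [add_mul] using polyFun.add h₁ h₂
  | smul c f _ h => simpa using polyFun.smul c h

theorem polyFun.pow {A : Type*} [Ring A] [Algebra L A] {f : L → A}
    (hf : f ∈ polyFun L A) (k : ℕ) : (fun r => f r ^ k) ∈ polyFun L A := by
  induction k with
  | zero => simpa using polyFun.const (L := L) (1 : A)
  | succ k ih => simpa [pow_succ] using polyFun.mul ih hf

theorem polyFun.sum {ι : Type*} (s : Finset ι) {f : ι → L → V}
    (hf : ∀ i ∈ s, f i ∈ polyFun L V) : (fun r => ∑ i ∈ s, f i r) ∈ polyFun L V := by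
  have := (polyFun L V).sum_mem hf
  rwa [show ∑ i ∈ s, f i = fun r => ∑ i ∈ s, f i r by ext r; simp] at this

theorem polyFun.newtonSeq [CharZero L] {p : L → ℕ → L}
    (hp : ∀ i, (fun r => p r i) ∈ polyFun L L) (m : ℕ) :
    (fun r => newtonSeq (p r) m) ∈ polyFun L L := by
  induction m using Nat.strong_induction_on with
  | _ m ih =>
  cases m with
  | zero => simpa [newtonSeq_zero] using polyFun.const (L := L) (1 : L)
  | succ m =>
    have h : (fun r => _root_.newtonSeq (p r) (m + 1)) = fun r => (-(m + 1 : L)⁻¹) •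
        ∑ i ∈ Finset.range (m + 1), _root_.newtonSeq (p r) (m - i) * p r i := by
      ext r
      rw [smul_eq_mul, neg_mul, ← mul_neg, ← newtonSeq_succ, inv_mul_cancel_left₀ (by exact_mod_cast m.succ_ne_zero)]
    rw [h]
    exact (polyFun L L).smul_mem _
      (polyFun.sum _ fun i _ => polyFun.mul (ih (m - i) (by omega)) (hp i))

theorem polyFun.eq_zero [CharZero L] {f : L → L} (hf : f ∈ polyFun L L)
    (h : ∀ k : ℕ, f k = 0) (r : L) : f r = 0 := by
  have hp : ∃ p : L[X], ∀ r, f r = p.eval r := by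
    clear h
    induction hf using Submodule.span_induction with
    | mem f hf =>
      obtain ⟨i, a, rfl⟩ := hf
      exact ⟨C a * X ^ i, fun r => show r ^ i • a = _ from by rw [eval_C_mul, eval_pow, eval_X, smul_eq_mul, mul_comm]⟩
    | zero => exact ⟨0, by simp⟩
    | add f₁ f₂ _ _ h₁ h₂ =>
      obtain ⟨p, hp⟩ := h₁
      obtain ⟨q, hq⟩ := h₂
      exact ⟨p + q, by simp [hp, hq]⟩
    | smul c f _ h =>
      obtain ⟨p, hp⟩ := h
      exact ⟨c • p, by simp [hp]⟩
  obtain ⟨p, hp⟩ := hp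
  have : p = 0 := p.eq_zero_of_infinite_isRoot <|
    (Set.infinite_range_of_injective (Nat.cast_injective (R := L))).mono (by
      rintro _ ⟨k, rfl⟩
      rw [Set.mem_ofPred_eq, IsRoot.def, ← hp, h])
  rw [hp, this, eval_zero]

theorem eq_zero_of_polyFun_line [CharZero L] {T : Type*} [AddCommGroup T] (ι : T →+ V)
    (hι : Submodule.span L (Set.range ι) = ⊤) {F : V → L}
    (hF : ∀ a b : V, (fun r : L => F (a + r • b)) ∈ polyFun L L) (h0 : ∀ h, F (ι h) = 0) (x : V) :
    F x = 0 := by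
  suffices ∀ z, (∀ h, F (ι h + z) = 0) → ∀ h, F (ι h + z + x) = 0 by
    simpa using this 0 (by simpa using h0) 0
  have hx : x ∈ Submodule.span L (Set.range ι) := by rw [hι]; trivial
  induction hx using Submodule.closure_induction with
  | zero => simp
  | add x y _ _ hx hy =>
    intro z hz h
    rw [← add_assoc, add_assoc (ι h)]
    exact hy _ (fun h => by rw [← add_assoc]; exact hx z hz h) h
  | smul_mem r x hx =>
    obtain ⟨t, rfl⟩ := hx
    intro z hz h
    refine polyFun.eq_zero (hF (ι h + z) (ι t)) (fun k => ?_) r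
    have := hz (h + k • t)
    rwa [map_add, map_nsmul, add_right_comm, ← Nat.cast_smul_eq_nsmul L] at this

end PolyFun

section Transfer

variable {L A T : Type*} [Field L] [LinearOrder L] [IsStrictOrderedRing L] [Ring T] [StarRing T]
  [Ring A] [Algebra L A] [StarRing A]

/-- A trace on a ring with involution, with values in an ordered field, that satisfies the
trace identities of `n × n` matrices with the transpose involution. -/
structure IsMatrixTrace (n : ℕ) (θ : T →+ L) : Prop where
  comm : ∀ a b, θ (a * b) = θ (b * a)
  apply_star : ∀ a, θ (star a) = θ a
  apply_one : θ 1 = n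
  pos : ∀ (s : Finset T) (r : T → L), 0 ≤ ∑ a ∈ s, ∑ b ∈ s, r a * r b * θ (a * star b)
  newton : ∀ a, ∀ m > n, newtonSeq (fun i => θ (a ^ (i + 1))) m = 0
  newton_skew : ∀ a b, star a = -a → star b = -b → ∀ m > n,
    newtonSeq (fun i => θ ((a * b) ^ (i + 1)) / 2) m = 0
  cayley_hamilton : ∀ a v, ∑ k ∈ Finset.range (n + 1),
    newtonSeq (fun i => θ (a ^ (i + 1))) k * θ (a ^ (n - k) * v) = 0

theorem IsMatrixTrace.isTraceAlgebra {n : ℕ} {θ : T →+ L} (hθ : IsMatrixTrace n θ)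
    {τ : A →ₗ[L] L} (ι : T →+* A) (hι : Submodule.span L (Set.range ι) = ⊤)
    (hιs : ∀ a, ι (star a) = star (ι a)) (hτ : ∀ a, τ (ι a) = θ a)
    (hs : ∀ (r : L) (a : A), star (r • a) = r • star a)
    (hc : ∀ a b, τ (a * b) = τ (b * a)) (hst : ∀ a, τ (star a) = τ a)
    (hpos : ∀ a, a ≠ 0 → 0 < τ (a * star a)) : IsTraceAlgebra n τ := by
  have key : ∀ {F : A → L}, (∀ a b : A, (fun r : L => F (a + r • b)) ∈ polyFun L L) →
      (∀ h, F (ι h) = 0) → ∀ x, F x = 0 := fun hF h0 x =>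
    eq_zero_of_polyFun_line ι.toAddMonoidHom hι hF h0 x
  let S : A →ₗ[L] A := { toFun := star, map_add' := star_add, map_smul' := hs }
  have hskew : ∀ m > n, ∀ x y : A,
      newtonSeq (fun i => τ (((x - star x) * (y - star y)) ^ (i + 1)) / 2) m = 0 := by
    intro m hm x y
    have hline : ∀ a b : A, (fun r : L => a + r • b - star (a + r • b)) ∈ polyFun L A :=
      fun a b => polyFun.map (LinearMap.id - S) (polyFun.line a b)
    have hP : ∀ f g : L → A, f ∈ polyFun L A → g ∈ polyFun L A →
        (fun r => newtonSeq (fun i => τ ((f r * g r) ^ (i + 1)) / 2) m) ∈ polyFun L L := by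
      intro f g hf hg
      refine polyFun.newtonSeq (fun i => ?_) m
      have := polyFun.smul (2⁻¹ : L) (polyFun.map τ (polyFun.pow (polyFun.mul hf hg) (i + 1)))
      simpa [div_eq_inv_mul] using this
    refine key (F := fun x => newtonSeq (fun i =>
      τ (((x - star x) * (y - star y)) ^ (i + 1)) / 2) m)
      (fun a b => hP _ _ (hline a b) (polyFun.const _)) (fun h => ?_) x
    refine key (F := fun y => newtonSeq (fun i =>
      τ (((ι h - star (ι h)) * (y - star y)) ^ (i + 1)) / 2) m)
      (fun a b => hP _ _ (polyFun.const _) (hline a b)) (fun h' => ?_) y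
    have := hθ.newton_skew (h - star h) (h' - star h') (by simp) (by simp) m hm
    simpa only [← hτ, map_pow, map_mul, map_sub, hιs] using this
  have hN : ∀ m, ∀ a b : A, (fun r : L => newtonSeq (fun i => τ ((a + r • b) ^ (i + 1))) m) ∈
      polyFun L L := fun m a b =>
    polyFun.newtonSeq (fun i => polyFun.map τ (polyFun.pow (polyFun.line a b) (i + 1))) m
  have hCH : ∀ a v : A, ∑ k ∈ Finset.range (n + 1),
      newtonSeq (fun i => τ (a ^ (i + 1))) k * τ (a ^ (n - k) * v) = 0 := by
    intro a v
    refine key (F := fun a => ∑ k ∈ Finset.range (n + 1),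
      newtonSeq (fun i => τ (a ^ (i + 1))) k * τ (a ^ (n - k) * v)) (fun a b => ?_) (fun h => ?_) a
    · exact polyFun.sum _ fun k _ => polyFun.mul (hN k a b)
        (polyFun.map τ (polyFun.mul (polyFun.pow (polyFun.line a b) (n - k)) (polyFun.const v)))
    · refine key (F := fun v => ∑ k ∈ Finset.range (n + 1),
        newtonSeq (fun i => τ (ι h ^ (i + 1))) k * τ (ι h ^ (n - k) * v)) (fun a b => ?_)
        (fun h' => ?_) v
      · exact polyFun.sum _ fun k _ => polyFun.mul (polyFun.const _)
          (polyFun.map τ (polyFun.mul (polyFun.const _) (polyFun.line a b)))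
      · simpa only [← hτ, map_pow, map_mul] using hθ.cayley_hamilton h h'
  refine ⟨hs, hc, hst, hpos, by rw [← ι.map_one, hτ, hθ.apply_one], fun a => ?_, fun a m hm => ?_,
    fun a b ha hb m hm => ?_⟩
  · refine ⟨∑ k ∈ Finset.range (n + 1),
      monomial (n - k) (newtonSeq (fun i => τ (a ^ (i + 1))) k), fun h0 => ?_, ?_⟩
    · have := congrArg (fun p => p.coeff n) h0
      simp only [finsetSum_coeff, coeff_monomial, coeff_zero] at this
      rw [Finset.sum_eq_single 0] at this
      · simp [newtonSeq_zero] at this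
      · intro k hk hk0
        have := Finset.mem_range.1 hk
        rw [if_neg (by omega)]
      · simp
    · by_contra hne
      refine (hpos _ hne).ne' ?_
      rw [← hCH a (star (aeval a (∑ k ∈ Finset.range (n + 1),
        monomial (n - k) (newtonSeq (fun i => τ (a ^ (i + 1))) k))))]
      conv_lhs => enter [2, 1]; rw [map_sum]
      rw [Finset.sum_mul, map_sum]
      refine Finset.sum_congr rfl fun k _ => ?_
      rw [aeval_monomial, ← Algebra.smul_def, smul_mul_assoc, map_smul, smul_eq_mul]
  · exact key (F := fun a => newtonSeq (fun i => τ (a ^ (i + 1))) m) (hN m)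
      (fun h => by simpa only [← hτ, map_pow] using hθ.newton h m hm) a
  · have := hskew m hm ((2⁻¹ : L) • a) ((2⁻¹ : L) • b)
    have h2 : ∀ c : A, star c = -c → (2⁻¹ : L) • c - star ((2⁻¹ : L) • c) = c := fun c hc => by
      rw [hs, hc, smul_neg, sub_neg_eq_add, ← add_smul]
      norm_num
    rwa [h2 a ha, h2 b hb] at this

end Transfer

section TraceQuotient

open MulOpposite

variable {L T : Type*} [Field L] [LinearOrder L] [IsStrictOrderedRing L] [Ring T] [StarRing T]

/-- The linear extension of an additive functional to the monoid algebra. -/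
noncomputable def traceForm (θ : T →+ L) : MonoidAlgebra L T →ₗ[L] L :=
  (Finsupp.linearCombination L θ) ∘ₗ (MonoidAlgebra.coeffLinearEquiv L).toLinearMap

theorem traceForm_of (θ : T →+ L) (t : T) : traceForm θ (MonoidAlgebra.of L T t) = θ t := by
  simp [traceForm]

/-- The linear extension of an involution to the monoid algebra. -/
noncomputable def monoidAlgebraStar (L T : Type*) [Field L] [Ring T] [StarRing T] :
    MonoidAlgebra L T →ₐ[L] (MonoidAlgebra L T)ᵐᵒᵖ :=
  MonoidAlgebra.lift L _ T
    { toFun := fun t => op (MonoidAlgebra.of L T (star t))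
      map_one' := by rw [star_one, map_one, op_one]
      map_mul' := fun a b => by rw [star_mul, map_mul, op_mul] }

theorem monoidAlgebraStar_of (t : T) :
    monoidAlgebraStar L T (MonoidAlgebra.of L T t) = op (MonoidAlgebra.of L T (star t)) :=
  MonoidAlgebra.lift_of _ _

theorem monoidAlgebraStar_star (w : MonoidAlgebra L T) :
    unop (monoidAlgebraStar L T (unop (monoidAlgebraStar L T w))) = w := by
  induction w using MonoidAlgebra.induction_on with
  | of t => rw [monoidAlgebraStar_of, unop_op, monoidAlgebraStar_of, unop_op, star_star]
  | add x y hx hy => rw [map_add, unop_add, map_add, unop_add, hx, hy]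
  | smul r x hx => rw [map_smul, unop_smul, map_smul, unop_smul, hx]

/-- The kernel of the bilinear form attached to an additive functional. -/
noncomputable def traceKernel (θ : T →+ L) : Ideal (MonoidAlgebra L T) where
  carrier := {w | ∀ v, traceForm θ (v * w) = 0}
  add_mem' := fun ha hb v => by rw [mul_add, map_add, ha v, hb v, add_zero]
  zero_mem' := fun v => by rw [mul_zero, map_zero]
  smul_mem' := fun c x hx v => by rw [smul_eq_mul, ← mul_assoc]; exact hx _

variable {n : ℕ} {θ : T →+ L} (hθ : IsMatrixTrace n θ)

include hθ

theorem IsMatrixTrace.traceForm_comm (v w : MonoidAlgebra L T) :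
    traceForm θ (v * w) = traceForm θ (w * v) := by
  induction v using MonoidAlgebra.induction_on with
  | of a =>
    induction w using MonoidAlgebra.induction_on with
    | of b => rw [← map_mul, ← map_mul, traceForm_of, traceForm_of, hθ.comm]
    | add x y hx hy => rw [mul_add, add_mul, map_add, map_add, hx, hy]
    | smul r x hx => rw [mul_smul_comm, smul_mul_assoc, map_smul, map_smul, hx]
  | add x y hx hy => rw [mul_add, add_mul, map_add, map_add, hx, hy]
  | smul r x hx => rw [mul_smul_comm, smul_mul_assoc, map_smul, map_smul, hx]

theorem IsMatrixTrace.traceForm_star (w : MonoidAlgebra L T) :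
    traceForm θ (unop (monoidAlgebraStar L T w)) = traceForm θ w := by
  induction w using MonoidAlgebra.induction_on with
  | of a => rw [monoidAlgebraStar_of, unop_op, traceForm_of, traceForm_of, hθ.apply_star]
  | add x y hx hy => rw [map_add, unop_add, map_add, map_add, hx, hy]
  | smul r x hx => rw [map_smul, unop_smul, map_smul, map_smul, hx]

theorem IsMatrixTrace.traceForm_mul_star_nonneg (w : MonoidAlgebra L T) :
    0 ≤ traceForm θ (w * unop (monoidAlgebraStar L T w)) := by
  have hw : w = ∑ a ∈ w.coeff.support, w.coeff a • MonoidAlgebra.of L T a := by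
    conv_lhs => rw [← MonoidAlgebra.sum_coeff_single w]
    simp [Finsupp.sum]
  set s := w.coeff.support
  set r := w.coeff
  rw [hw]
  convert hθ.pos s r using 1
  rw [map_sum, Finset.sum_mul, map_sum]
  refine Finset.sum_congr rfl fun a _ => ?_
  rw [Finset.unop_sum, Finset.mul_sum, map_sum]
  refine Finset.sum_congr rfl fun b _ => ?_
  rw [map_smul, monoidAlgebraStar_of, unop_smul, unop_op, smul_mul_smul_comm, ← (MonoidAlgebra.of L T).map_mul,
    map_smul, traceForm_of, smul_eq_mul]

theorem IsMatrixTrace.mem_traceKernel_of_traceForm_eq_zero {w : MonoidAlgebra L T}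
    (hw : traceForm θ (w * unop (monoidAlgebraStar L T w)) = 0) : w ∈ traceKernel θ := by
  intro v
  rw [hθ.traceForm_comm]
  set y := unop (monoidAlgebraStar L T v) with hy
  have hv : v = unop (monoidAlgebraStar L T y) := (monoidAlgebraStar_star v).symm
  by_contra hne
  set β := traceForm θ (w * v) with hβ
  have hsymm : traceForm θ (y * unop (monoidAlgebraStar L T w)) = β := by
    rw [hβ, hv, ← hθ.traceForm_star (w * _), map_mul (monoidAlgebraStar L T), unop_mul, monoidAlgebraStar_star]
  have h := fun r : L => hθ.traceForm_mul_star_nonneg (r • w + y)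
  simp only [map_add, unop_add, map_smul, unop_smul, add_mul, mul_add, smul_mul_assoc,
    mul_smul_comm, hw, hsymm, ← hv, ← hβ, smul_eq_mul] at h
  have h1 := h (-(traceForm θ (y * v) + 1) / (2 * β))
  have h2 : -(traceForm θ (y * v) + 1) / (2 * β) * β = -(traceForm θ (y * v) + 1) / 2 := by
    field_simp
  rw [h2] at h1
  linarith

theorem IsMatrixTrace.exists_ringHom_matrix
    (hM : ∀ p : L[X], Irreducible p → 2 ≤ p.natDegree → ∃ Q, IsSumSq Q ∧ p ∣ 1 + Q)
    (hsq : ∀ a : L, 0 ≤ a → ∃ b, a = b ^ 2) :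
    ∃ ρ : T →+* Matrix (Fin n) (Fin n) L, (∀ a, ρ (star a) = (ρ a).transpose) ∧
      ∀ a, (ρ a).trace = θ a := by
  have hN : (traceKernel θ).IsTwoSided := ⟨fun {a} b ha v => by
    rw [← mul_assoc, hθ.traceForm_comm, ← mul_assoc]; exact ha _⟩
  let A := MonoidAlgebra L T ⧸ traceKernel θ
  let q : MonoidAlgebra L T →ₐ[L] A := Ideal.Quotient.mkₐ L (traceKernel θ)
  have hq : Function.Surjective q := Ideal.Quotient.mk_surjective
  have hq0 : ∀ {w}, q w = 0 ↔ w ∈ traceKernel θ := Ideal.Quotient.eq_zero_iff_mem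
  let q' : (MonoidAlgebra L T)ᵐᵒᵖ →ₐ[L] Aᵐᵒᵖ := AlgHom.op q
  have hq'0 : ∀ w ∈ traceKernel θ, (q'.comp (monoidAlgebraStar L T)) w = 0 := fun w hw => by
    apply unop_injective
    change q (unop (monoidAlgebraStar L T w)) = 0
    rw [hq0]
    intro v
    rw [← hθ.traceForm_star, map_mul, unop_mul, monoidAlgebraStar_star, hθ.traceForm_comm]
    exact hw _
  let s : A →ₐ[L] Aᵐᵒᵖ := Ideal.Quotient.liftₐ (traceKernel θ) (q'.comp (monoidAlgebraStar L T)) hq'0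
  have hs : ∀ w, unop (s (q w)) = q (unop (monoidAlgebraStar L T w)) := fun w => rfl
  let τ : A →ₗ[L] L := (traceKernel θ |>.restrictScalars L).liftQ (traceForm θ) (fun w hw => by
    have := hw 1
    rwa [one_mul] at this)
  have hτ : ∀ w, τ (q w) = traceForm θ w := fun w => rfl
  let _ : StarRing A :=
    { star := fun a => unop (s a)
      star_involutive := fun a => by
        obtain ⟨w, rfl⟩ := hq a
        change unop (s (unop (s (q w)))) = q w
        rw [hs, hs, monoidAlgebraStar_star]
      star_mul := fun a b => by
        change unop (s (a * b)) = unop (s b) * unop (s a)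
        rw [map_mul, unop_mul]
      star_add := fun a b => by
        change unop (s (a + b)) = unop (s a) + unop (s b)
        rw [map_add, unop_add] }
  have hstar : ∀ w, star (q w) = q (unop (monoidAlgebraStar L T w)) := hs
  let ι : T →+* A :=
    { toFun := fun t => q (MonoidAlgebra.of L T t)
      map_one' := by rw [(MonoidAlgebra.of L T).map_one]; exact map_one q
      map_mul' := fun a b => by rw [(MonoidAlgebra.of L T).map_mul]; exact map_mul q _ _
      map_zero' := hq0.2 fun v => by
        induction v using MonoidAlgebra.induction_on with
        | of a => rw [← map_mul, traceForm_of, mul_zero, map_zero]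
        | add x y hx hy => rw [add_mul, map_add, hx, hy, add_zero]
        | smul r x hx => rw [smul_mul_assoc, map_smul, hx, smul_zero]
      map_add' := fun a b => by
        rw [← map_add, ← sub_eq_zero, ← map_sub, hq0]
        intro v
        induction v using MonoidAlgebra.induction_on with
        | of c =>
          rw [mul_sub, mul_add, ← map_mul, ← map_mul, ← map_mul, map_sub, map_add, traceForm_of,
            traceForm_of, traceForm_of, mul_add, map_add, sub_self]
        | add x y hx hy => rw [add_mul, map_add, hx, hy, add_zero]
        | smul r x hx => rw [smul_mul_assoc, map_smul, hx, smul_zero] }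
  have hι : ∀ t, ι t = q (MonoidAlgebra.of L T t) := fun t => rfl
  have hA : IsTraceAlgebra n τ := by
    refine hθ.isTraceAlgebra ι ?_ (fun a => ?_) (fun a => ?_) (fun r a => ?_) (fun a b => ?_)
      (fun a => ?_) (fun a ha => ?_)
    · refine eq_top_iff.2 fun a _ => ?_
      obtain ⟨w, rfl⟩ := hq a
      induction w using MonoidAlgebra.induction_on with
      | of t => exact Submodule.subset_span ⟨t, rfl⟩
      | add x y hx hy => rw [map_add]; exact Submodule.add_mem _ (hx trivial) (hy trivial)
      | smul r x hx => rw [map_smul]; exact Submodule.smul_mem _ _ (hx trivial)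
    · rw [hι, hι, hstar, monoidAlgebraStar_of, unop_op]
    · rw [hι, hτ, traceForm_of]
    · change unop (s (r • a)) = r • unop (s a)
      rw [map_smul, unop_smul]
    · obtain ⟨v, rfl⟩ := hq a
      obtain ⟨w, rfl⟩ := hq b
      rw [← map_mul, ← map_mul, hτ, hτ, hθ.traceForm_comm]
    · obtain ⟨w, rfl⟩ := hq a
      rw [hstar, hτ, hτ, hθ.traceForm_star]
    · obtain ⟨w, rfl⟩ := hq a
      rw [hstar, ← map_mul, hτ]
      refine lt_of_le_of_ne (hθ.traceForm_mul_star_nonneg w) fun h => ha ?_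
      exact hq0.2 (hθ.mem_traceKernel_of_traceForm_eq_zero h.symm)
  obtain ⟨ρ, hρs, hρt⟩ := hA.exists_matrix_rep hM hsq
  refine ⟨(ρ : A →+* _).comp ι, fun a => ?_, fun a => ?_⟩
  · rw [RingHom.comp_apply, RingHom.comp_apply, hι, hι]
    have := hρs (q (MonoidAlgebra.of L T a))
    rwa [hstar, monoidAlgebraStar_of, unop_op] at this
  · have := hρt (q (MonoidAlgebra.of L T a))
    rwa [hτ, traceForm_of] at this

end TraceQuotient

theorem sum_sum_mul_map_nonneg {S M L ι : Type*} [CommRing S] [AddCommGroup M] [Module S M]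
    [Field L] [LinearOrder L] [IsStrictOrderedRing L] (φ : S →+* L) (B : M →ₗ[S] M →ₗ[S] S)
    (hB : ∀ x y, B x y = B y x) (hφ : ∀ x, 0 ≤ φ (B x x)) (s : Finset ι) (r : ι → L)
    (h : ι → M) : 0 ≤ ∑ a ∈ s, ∑ b ∈ s, r a * r b * φ (B (h a) (h b)) := by
  classical
  induction s using Finset.induction_on generalizing h with
  | empty => simp
  | insert a₀ s ha₀ ih =>
    set g : ι → L := fun b => φ (B (h a₀) (h b)) with hg
    set Q := ∑ a ∈ s, ∑ b ∈ s, r a * r b * φ (B (h a) (h b)) with hQ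
    set l := ∑ b ∈ s, r b * g b with hl
    have hsum : ∑ a ∈ insert a₀ s, ∑ b ∈ insert a₀ s, r a * r b * φ (B (h a) (h b)) =
        r a₀ ^ 2 * g a₀ + 2 * r a₀ * l + Q := by
      rw [Finset.sum_insert ha₀, Finset.sum_insert ha₀]
      simp only [Finset.sum_insert ha₀, Finset.sum_add_distrib]
      have h1 : ∑ b ∈ s, r a₀ * r b * φ (B (h a₀) (h b)) = r a₀ * l := by
        rw [hl, Finset.mul_sum]
        exact Finset.sum_congr rfl fun b _ => by rw [mul_assoc]
      have h2 : ∑ b ∈ s, r b * r a₀ * φ (B (h b) (h a₀)) = r a₀ * l := by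
        rw [← h1]
        exact Finset.sum_congr rfl fun b _ => by rw [hB, mul_comm (r b)]
      rw [h1, h2]
      ring
    rw [hsum]
    have hQ0 : 0 ≤ Q := ih h
    rcases (hφ (h a₀)).eq_or_lt with h0 | h0
    · have hgz : ∀ b, g b = 0 := by
        intro b
        have h1 := hφ (B (h b) (h b) • h a₀ - B (h a₀) (h b) • h b)
        have h2 := hφ (h b - B (h a₀) (h b) • h a₀)
        simp only [map_sub, LinearMap.sub_apply, map_smul, LinearMap.smul_apply, smul_eq_mul,
          hB (h b) (h a₀), map_mul, ← h0] at h1 h2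
        change 0 ≤ _ at h1
        have h3 : g b = φ (B (h a₀) (h b)) := rfl
        rw [← h3] at h1 h2
        have h4 : 0 ≤ φ (B (h b) (h b)) := hφ _
        set y := φ (B (h b) (h b))
        by_contra hne
        have hp : 0 < g b ^ 2 := by positivity
        rcases h4.eq_or_lt with h5 | h5
        · rw [← h5] at h2; nlinarith
        · nlinarith [mul_pos h5 hp]
      have hl0 : l = 0 := Finset.sum_eq_zero fun b _ => by rw [hgz, mul_zero]
      rw [hl0, hgz]
      simpa using hQ0
    · have h1 := ih fun b => B (h a₀) (h a₀) • h b - B (h a₀) (h b) • h a₀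
      have h2 : ∑ a ∈ s, ∑ b ∈ s, r a * r b *
          φ (B (B (h a₀) (h a₀) • h a - B (h a₀) (h a) • h a₀)
            (B (h a₀) (h a₀) • h b - B (h a₀) (h b) • h a₀)) =
          g a₀ ^ 2 * Q - g a₀ * l ^ 2 := by
        rw [hQ, sq l, hl, Finset.sum_mul_sum, Finset.mul_sum, Finset.mul_sum,
          ← Finset.sum_sub_distrib]
        refine Finset.sum_congr rfl fun a _ => ?_
        rw [Finset.mul_sum, Finset.mul_sum, ← Finset.sum_sub_distrib]
        refine Finset.sum_congr rfl fun b _ => ?_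
        simp only [map_sub, LinearMap.sub_apply, map_smul, LinearMap.smul_apply, smul_eq_mul,
          hB (h a) (h a₀), map_mul, hg]
        ring
      rw [h2] at h1
      change 0 < g a₀ at h0
      have h3 : 0 ≤ g a₀ * Q - l ^ 2 := by
        refine nonneg_of_mul_nonneg_right ?_ h0
        linarith
      refine nonneg_of_mul_nonneg_right (a := g a₀) ?_ h0
      nlinarith [sq_nonneg (r a₀ * g a₀ + l)]

section TraceRing

variable {n g : ℕ}

/-- The algebra generated by the traces of words in the generic matrices and their transposes. -/
def wordTraces (n g : ℕ) : Subalgebra ℝ (PolyRing n g) :=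
  Algebra.adjoin ℝ {p | ∃ w ∈ Submonoid.closure (genSet n g), p = trace w}

theorem genSet_subset_traceRing : genSet n g ⊆ traceRing n g := fun _ hw =>
  Algebra.subset_adjoin (Or.inl hw)

theorem closure_genSet_subset_traceRing {w : MatP n g}
    (hw : w ∈ Submonoid.closure (genSet n g)) : w ∈ traceRing n g :=
  (Submonoid.closure_le (S := (traceRing n g).toSubmonoid)).2 genSet_subset_traceRing hw

theorem transpose_mem_genSet {w : MatP n g} (hw : w ∈ genSet n g) : wᵀ ∈ genSet n g := by
  rcases hw with ⟨j, rfl⟩ | ⟨j, rfl⟩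
  · exact Or.inr ⟨j, rfl⟩
  · exact Or.inl ⟨j, rfl⟩

theorem transpose_mem_traceRing {h : MatP n g} (hh : h ∈ traceRing n g) :
    hᵀ ∈ traceRing n g := by
  induction hh using Algebra.adjoin_induction with
  | mem x hx =>
    rcases hx with hx | ⟨w, hw, rfl⟩
    · exact genSet_subset_traceRing (transpose_mem_genSet hx)
    · rw [transpose_smul, transpose_one]
      exact Algebra.subset_adjoin (Or.inr ⟨w, hw, rfl⟩)
  | algebraMap r =>
    rw [Algebra.algebraMap_eq_smul_one, transpose_smul, transpose_one]
    exact Subalgebra.smul_mem _ (one_mem _) r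
  | add x y _ _ hx hy => rw [transpose_add]; exact add_mem hx hy
  | mul x y _ _ hx hy => rw [transpose_mul]; exact mul_mem hy hx

theorem traceRing_le_span {h : MatP n g} (hh : h ∈ traceRing n g) :
    h ∈ Submodule.span (wordTraces n g)
      (Submonoid.closure (genSet n g) : Set (MatP n g)) := by
  have h1 : (1 : MatP n g) ∈ Submodule.span (wordTraces n g)
      (Submonoid.closure (genSet n g) : Set (MatP n g)) := Submodule.subset_span (one_mem _)
  induction hh using Algebra.adjoin_induction with
  | mem x hx =>
    rcases hx with hx | ⟨w, hw, rfl⟩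
    · exact Submodule.subset_span (Submonoid.subset_closure hx)
    · exact Submodule.smul_mem _ (⟨trace w, Algebra.subset_adjoin ⟨w, hw, rfl⟩⟩ : wordTraces n g) h1
  | algebraMap r =>
    rw [Algebra.algebraMap_eq_smul_one]
    have := Submodule.smul_mem _ (algebraMap ℝ (wordTraces n g) r) h1
    rwa [algebraMap_smul] at this
  | add x y _ _ hx hy => exact add_mem hx hy
  | mul x y _ _ hx hy =>
    have := Submodule.mul_mem_mul hx hy
    rw [Submodule.span_mul_span] at this
    refine Submodule.span_mono ?_ this
    rintro _ ⟨a, ha, b, hb, rfl⟩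
    exact mul_mem ha hb

theorem trace_mem_wordTraces {h : MatP n g} (hh : h ∈ traceRing n g) :
    trace h ∈ wordTraces n g := by
  have := traceRing_le_span hh
  clear hh
  induction this using Submodule.span_induction with
  | mem x hx => exact Algebra.subset_adjoin ⟨x, hx, rfl⟩
  | zero => rw [trace_zero]; exact zero_mem _
  | add x y _ _ hx hy => rw [trace_add]; exact add_mem hx hy
  | smul c x _ hx => rw [trace_smul]; exact mul_mem c.2 hx

theorem smul_one_mem_traceRing {p : PolyRing n g} (hp : p ∈ wordTraces n g) :
    p • (1 : MatP n g) ∈ traceRing n g := by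
  induction hp using Algebra.adjoin_induction with
  | mem x hx =>
    obtain ⟨w, hw, rfl⟩ := hx
    exact Algebra.subset_adjoin (Or.inr ⟨w, hw, rfl⟩)
  | algebraMap r => rw [algebraMap_smul]; exact Subalgebra.smul_mem _ (one_mem _) r
  | add x y _ _ hx hy => rw [add_smul]; exact add_mem hx hy
  | mul x y _ _ hx hy =>
    have := mul_mem hx hy
    rwa [smul_mul_smul_comm, one_mul] at this

theorem smul_mem_traceRing {p : PolyRing n g} (hp : p ∈ wordTraces n g) {h : MatP n g}
    (hh : h ∈ traceRing n g) : p • h ∈ traceRing n g := by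
  have := mul_mem (smul_one_mem_traceRing hp) hh
  rwa [smul_mul_assoc, one_mul] at this

theorem OmegaSet.add {a b : MatP n g} (ha : a ∈ OmegaSet n g) (hb : b ∈ OmegaSet n g) :
    a + b ∈ OmegaSet n g := AddSubmonoid.add_mem _ ha hb

theorem OmegaSet.of_mem_closure {a : MatP n g}
    (ha : a ∈ Submonoid.closure {c : MatP n g | ∃ h ∈ traceRing n g,
      c = (Matrix.trace (h * hᵀ)) • (1 : MatP n g)}) : a ∈ OmegaSet n g :=
  AddSubmonoid.subset_closure ha

theorem OmegaSet.mul {a b : MatP n g} (ha : a ∈ OmegaSet n g) (hb : b ∈ OmegaSet n g) :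
    a * b ∈ OmegaSet n g := by
  have := AddSubmonoid.mul_mem_mul ha hb
  rw [AddSubmonoid.closure_mul_closure] at this
  refine AddSubmonoid.closure_mono ?_ this
  rintro _ ⟨a, ha, b, hb, rfl⟩
  exact mul_mem ha hb

theorem OmegaSet.trace_mul_transpose {h : MatP n g} (hh : h ∈ traceRing n g) :
    trace (h * hᵀ) • (1 : MatP n g) ∈ OmegaSet n g :=
  OmegaSet.of_mem_closure (Submonoid.subset_closure ⟨h, hh, rfl⟩)

theorem OmegaSet.sq (hn : 0 < n) {p : PolyRing n g} (hp : p ∈ wordTraces n g) :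
    p ^ 2 • (1 : MatP n g) ∈ OmegaSet n g := by
  have h1 : (Real.sqrt n)⁻¹ • p • (1 : MatP n g) ∈ traceRing n g :=
    Subalgebra.smul_mem _ (smul_one_mem_traceRing hp) _
  have h2 := OmegaSet.trace_mul_transpose h1
  have h3 : trace (((Real.sqrt n)⁻¹ • p • (1 : MatP n g)) *
      ((Real.sqrt n)⁻¹ • p • (1 : MatP n g))ᵀ) = p ^ 2 := by
    have hn' : (n : ℝ) ≠ 0 := by positivity
    rw [transpose_smul, transpose_smul, transpose_one, smul_mul_smul_comm, smul_mul_smul_comm,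
      ← mul_inv, Real.mul_self_sqrt (by positivity), trace_smul, trace_smul, mul_one, trace_one,
      Fintype.card_fin, smul_eq_mul, mul_comm (p * p), MvPolynomial.smul_eq_C_mul,
      ← map_natCast (MvPolynomial.C (R := ℝ)), ← mul_assoc, ← MvPolynomial.C_mul,
      inv_mul_cancel₀ hn', MvPolynomial.C_1, one_mul, pow_two]
  rwa [h3] at h2

theorem OmegaSet.exists_smul_one {ω : MatP n g} (hω : ω ∈ OmegaSet n g) :
    ∃ p ∈ wordTraces n g, ω = p • (1 : MatP n g) ∧
      ∀ X : Fin g → Matrix (Fin n) (Fin n) ℝ,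
        0 ≤ MvPolynomial.eval (fun v => X v.1 v.2.1 v.2.2) p := by
  refine AddSubmonoid.closure_induction ?_ ⟨0, zero_mem _, by simp, by simp⟩ ?_ hω
  · intro x hx
    induction hx using Submonoid.closure_induction with
    | mem x hx =>
      obtain ⟨h, hh, rfl⟩ := hx
      refine ⟨_, trace_mem_wordTraces (mul_mem hh (transpose_mem_traceRing hh)), rfl, fun X => ?_⟩
      simp only [trace, diag_apply, Matrix.mul_apply, transpose_apply, map_sum, map_mul]
      exact Finset.sum_nonneg fun i _ => Finset.sum_nonneg fun j _ => mul_self_nonneg _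
    | one => exact ⟨1, one_mem _, by simp, by simp⟩
    | mul x y _ _ hx hy =>
      obtain ⟨p, hp, rfl, hp'⟩ := hx
      obtain ⟨q, hq, rfl, hq'⟩ := hy
      exact ⟨p * q, mul_mem hp hq, by rw [smul_mul_smul_comm, one_mul], fun X => by
        rw [map_mul]; exact mul_nonneg (hp' X) (hq' X)⟩
  · rintro x y _ _ ⟨p, hp, rfl, hp'⟩ ⟨q, hq, rfl, hq'⟩
    exact ⟨p + q, add_mem hp hq, by rw [add_smul], fun X => by
      rw [map_add]; exact add_nonneg (hp' X) (hq' X)⟩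

end TraceRing

section Evaluation

variable {n g : ℕ}

theorem evalMat_eq_mapMatrix (X : Fin g → Matrix (Fin n) (Fin n) ℝ) (h : MatP n g) :
    evalMat n g X h = (MvPolynomial.eval fun v => X v.1 v.2.1 v.2.2).mapMatrix h := rfl

theorem ThetaSet.posSemidef_evalMat {t : MatP n g} (ht : t ∈ ThetaSet n g)
    (X : Fin g → Matrix (Fin n) (Fin n) ℝ) : (evalMat n g X t).PosSemidef := by
  refine AddSubmonoid.closure_induction ?_ ?_ ?_ ht
  · rintro _ ⟨ω, hω, h, -, rfl⟩
    obtain ⟨p, -, rfl, hp⟩ := OmegaSet.exists_smul_one hω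
    rw [smul_mul_assoc, one_mul]
    have : evalMat n g X (p • (h * hᵀ)) =
        MvPolynomial.eval (fun v => X v.1 v.2.1 v.2.2) p •
          (evalMat n g X h * (evalMat n g X h)ᴴ) := by
      ext i j
      simp [evalMat, Matrix.mul_apply]
    rw [this]
    exact (posSemidef_self_mul_conjTranspose _).smul (hp X)
  · rw [evalMat_eq_mapMatrix, map_zero]
    exact PosSemidef.zero
  · intro x y _ _ hx hy
    rw [evalMat_eq_mapMatrix, map_add]
    exact hx.add hy

theorem Matrix.eq_zero_of_neg_pow_posSemidef {m : Type*} [Fintype m] [DecidableEq m]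
    {A : Matrix m m ℝ} {k : ℕ} (h : (-(Aᵀ * A) ^ k).PosSemidef) : A = 0 := by
  have hA : (Aᴴ * A).PosSemidef := posSemidef_conjTranspose_mul_self A
  have hk : ((Aᴴ * A) ^ k).PosSemidef := hA.pow k
  have h0 : (Aᴴ * A) ^ k = 0 := by
    have h1 := h.trace_nonneg
    have h2 := hk.trace_nonneg
    rw [trace_neg] at h1
    exact hk.trace_eq_zero_iff.1 (le_antisymm (neg_nonneg.1 h1) h2)
  have key : ∀ j, (Aᴴ * A) ^ 2 ^ j = 0 → Aᴴ * A = 0 := by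
    intro j
    induction j with
    | zero => intro h; simpa using h
    | succ j ih =>
      intro h
      refine ih (conjTranspose_mul_self_eq_zero.1 ?_)
      rw [(hA.pow _).isHermitian.eq, ← pow_two, ← pow_mul, ← pow_succ, h]
  exact conjTranspose_mul_self_eq_zero.1 (key k (pow_eq_zero_of_le Nat.lt_two_pow_self.le h0))

theorem evalMat_eq_zero_of_neg_pow_eq {J : Set (MatP n g)} {h : MatP n g} {k : ℕ} {t u : MatP n g}
    (ht : t ∈ ThetaSet n g) (hu : u ∈ J) (e : -((hᵀ * h) ^ k) = t + u)
    {X : Fin g → Matrix (Fin n) (Fin n) ℝ} (hX : ∀ u ∈ J, evalMat n g X u = 0) :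
    evalMat n g X h = 0 := by
  apply Matrix.eq_zero_of_neg_pow_posSemidef (k := k)
  have h1 : evalMat n g X (-((hᵀ * h) ^ k)) = evalMat n g X t := by
    rw [e, evalMat_eq_mapMatrix, map_add, ← evalMat_eq_mapMatrix, ← evalMat_eq_mapMatrix,
      hX u hu, add_zero]
  have h2 : evalMat n g X hᵀ = (evalMat n g X h)ᵀ := rfl
  rw [← h2, evalMat_eq_mapMatrix, evalMat_eq_mapMatrix, ← map_mul, ← map_pow, ← map_neg,
    ← evalMat_eq_mapMatrix, h1]
  exact ThetaSet.posSemidef_evalMat ht X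

end Evaluation

section TraceHom

variable {n g : ℕ}

instance traceRingStarRing : StarRing (traceRing n g) where
  star a := ⟨(a : MatP n g)ᵀ, transpose_mem_traceRing a.2⟩
  star_involutive _ := Subtype.ext (transpose_transpose _)
  star_mul _ _ := Subtype.ext (transpose_mul _ _)
  star_add _ _ := Subtype.ext (transpose_add _ _)

/-- The trace as a map from the trace ring to the algebra generated by traces of words. -/
def traceHom (n g : ℕ) : traceRing n g →+ wordTraces n g where
  toFun a := ⟨trace (a : MatP n g), trace_mem_wordTraces a.2⟩
  map_zero' := Subtype.ext (trace_zero (Fin n) (PolyRing n g))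
  map_add' a b := Subtype.ext (trace_add a.1 b.1)

theorem coe_traceHom (a : traceRing n g) :
    ((traceHom n g a : wordTraces n g) : PolyRing n g) = trace (a : MatP n g) := rfl

theorem coe_newtonSeq_wordTraces (p : ℕ → wordTraces n g) (m : ℕ) :
    ((newtonSeq p m : wordTraces n g) : PolyRing n g) = newtonSeq (fun i => (p i : PolyRing n g)) m :=
  map_newtonSeq (wordTraces n g).val.toRingHom p m

/-- The trace ring as a module over the algebra generated by traces of words. -/
instance traceRingModule : Module (wordTraces n g) (traceRing n g) where
  smul c h := ⟨c.1 • h.1, smul_mem_traceRing c.2 h.2⟩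
  one_smul _ := Subtype.ext (one_smul (PolyRing n g) _)
  mul_smul _ _ _ := Subtype.ext (mul_smul (α := PolyRing n g) _ _ _)
  smul_zero _ := Subtype.ext (smul_zero (M := PolyRing n g) _)
  smul_add _ _ _ := Subtype.ext (smul_add (M := PolyRing n g) _ _ _)
  add_smul _ _ _ := Subtype.ext (add_smul (R := PolyRing n g) _ _ _)
  zero_smul _ := Subtype.ext (zero_smul (PolyRing n g) _)

/-- The bilinear form `(x, y) ↦ tr (x yᵀ)` on the trace ring. -/
def traceTransposeForm (n g : ℕ) :
    traceRing n g →ₗ[wordTraces n g] traceRing n g →ₗ[wordTraces n g] wordTraces n g :=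
  LinearMap.mk₂ _ (fun x y => traceHom n g (x * star y))
    (fun x y z => by rw [add_mul, map_add])
    (fun c x y => Subtype.ext <| by
      change trace ((c.1 • x.1) * (y.1)ᵀ) = c.1 * trace (x.1 * (y.1)ᵀ)
      rw [smul_mul_assoc, trace_smul, smul_eq_mul])
    (fun x y z => by rw [star_add, mul_add, map_add])
    (fun c x y => Subtype.ext <| by
      change trace (x.1 * (c.1 • y.1)ᵀ) = c.1 * trace (x.1 * (y.1)ᵀ)
      rw [transpose_smul, mul_smul_comm, trace_smul, smul_eq_mul])

theorem isMatrixTrace_comp_traceHom {L : Type*} [Field L] [LinearOrder L] [IsStrictOrderedRing L]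
    (φ : wordTraces n g →+* L) (hφ : ∀ a : traceRing n g, 0 ≤ φ (traceHom n g (a * star a))) :
    IsMatrixTrace n ((φ : wordTraces n g →+ L).comp (traceHom n g)) where
  comm a b := congrArg φ (Subtype.ext (trace_mul_comm a.1 b.1))
  apply_star a := congrArg φ (Subtype.ext (trace_transpose a.1))
  apply_one := by
    have : traceHom n g 1 = (n : wordTraces n g) := Subtype.ext (by
      rw [coe_traceHom]; simp)
    change φ (traceHom n g 1) = n
    rw [this, map_natCast]
  pos s r := sum_sum_mul_map_nonneg φ (traceTransposeForm n g)
    (fun x y => Subtype.ext (by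
      change trace (x.1 * (y.1)ᵀ) = trace (y.1 * (x.1)ᵀ)
      rw [← trace_transpose, transpose_mul, transpose_transpose]))
    hφ s r id
  newton a m hm := by
    change newtonSeq (fun i => φ (traceHom n g (a ^ (i + 1)))) m = 0
    rw [← map_newtonSeq φ, ← map_zero φ]
    refine congrArg φ (Subtype.ext ?_)
    rw [coe_newtonSeq_wordTraces]
    exact newtonSeq_trace_eq_zero (a : MatP n g) (by rwa [Fintype.card_fin])
  newton_skew a b ha hb m hm := by
    have h2 : (fun i => ((φ : wordTraces n g →+ L).comp (traceHom n g)) ((a * b) ^ (i + 1)) / 2) =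
        fun i => φ ((1 / 2 : ℚ) • traceHom n g ((a * b) ^ (i + 1))) := by
      funext i
      rw [map_rat_smul, Rat.smul_def]
      change φ (traceHom n g ((a * b) ^ (i + 1))) / 2 = _
      push_cast
      ring
    rw [h2, ← map_newtonSeq φ, ← map_zero φ]
    refine congrArg φ (Subtype.ext ?_)
    rw [coe_newtonSeq_wordTraces]
    exact newtonSeq_half_trace_eq_zero (a := (a : MatP n g)) (b := (b : MatP n g))
      (congrArg Subtype.val ha) (congrArg Subtype.val hb) hm
  cayley_hamilton a v := by
    have h := sum_newtonSeq_smul_pow_eq_zero (a : MatP n g)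
    rw [Fintype.card_fin] at h
    replace h := congrArg (fun x => trace (x * (v : MatP n g))) h
    simp only [Finset.sum_mul, trace_sum, smul_mul_assoc, trace_smul, zero_mul, trace_zero,
      smul_eq_mul] at h
    have h' : ∑ k ∈ Finset.range (n + 1), newtonSeq (fun i => traceHom n g (a ^ (i + 1))) k *
        traceHom n g (a ^ (n - k) * v) = 0 := Subtype.ext (by
      rw [AddSubmonoidClass.coe_finsetSum]
      simp only [MulMemClass.coe_mul, coe_newtonSeq_wordTraces]
      exact h)
    replace h' := congrArg φ h'
    simp only [map_sum, map_mul, map_newtonSeq, map_zero] at h'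
    exact h'

end TraceHom

section TraceIdeal

variable {n g : ℕ}

/-- Two-sided ideals of the trace ring that are closed under `u ↦ tr (u) • 1`. -/
structure IsTraceIdeal (J : Set (MatP n g)) : Prop where
  mem_traceRing : ∀ u ∈ J, u ∈ traceRing n g
  zero : (0 : MatP n g) ∈ J
  add : ∀ u ∈ J, ∀ v ∈ J, u + v ∈ J
  neg : ∀ u ∈ J, -u ∈ J
  mul : ∀ h ∈ traceRing n g, ∀ u ∈ J, h * u ∈ J ∧ u * h ∈ J
  trace : ∀ u ∈ J, Matrix.trace u • (1 : MatP n g) ∈ J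

theorem OmegaSet.mem_traceRing {ω : MatP n g} (hω : ω ∈ OmegaSet n g) : ω ∈ traceRing n g := by
  obtain ⟨p, hp, rfl, -⟩ := OmegaSet.exists_smul_one hω
  exact smul_one_mem_traceRing hp

theorem OmegaSet.zero : (0 : MatP n g) ∈ OmegaSet n g := AddSubmonoid.zero_mem _

/-- The elements of the center that are congruent to an element of `OmegaSet` modulo `J`. -/
def centralPreorder (J : Set (MatP n g)) : Set (wordTraces n g) :=
  {x | ∃ ω ∈ OmegaSet n g, ∃ u ∈ J, x.1 • (1 : MatP n g) = ω + u}

variable {J : Set (MatP n g)}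

theorem IsTraceIdeal.isRingPreorder (hn : 0 < n) (hJ : IsTraceIdeal J) :
    IsRingPreorder (centralPreorder J) where
  add := by
    rintro a ⟨ω, hω, u, hu, ha⟩ b ⟨ω', hω', u', hu', hb⟩
    refine ⟨ω + ω', OmegaSet.add hω hω', u + u', hJ.add u hu u' hu', ?_⟩
    change (a.1 + b.1) • (1 : MatP n g) = _
    rw [add_smul, ha, hb]
    abel
  mul := by
    rintro a ⟨ω, hω, u, hu, ha⟩ b ⟨ω', hω', u', hu', hb⟩
    refine ⟨ω * ω', OmegaSet.mul hω hω', ω * u' + u * (ω' + u'), hJ.add _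
      (hJ.mul _ (OmegaSet.mem_traceRing hω) _ hu').1 _ (hJ.mul _ (add_mem
        (OmegaSet.mem_traceRing hω') (hJ.mem_traceRing _ hu')) _ hu).2, ?_⟩
    change (a.1 * b.1) • (1 : MatP n g) = _
    rw [← one_mul (1 : MatP n g), ← smul_mul_smul_comm, ha, hb]
    noncomm_ring
  sq a := ⟨_, OmegaSet.sq hn a.2, 0, hJ.zero, by rw [add_zero]; rfl⟩

variable {L : Type*} [Field L]

/-- The images of the variables under a representation of the trace ring. -/
def genericEntries (ρ : traceRing n g →+* Matrix (Fin n) (Fin n) L)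
    (v : Fin g × Fin n × Fin n) : L :=
  ρ ⟨genMat n g v.1, genSet_subset_traceRing (Or.inl ⟨v.1, rfl⟩)⟩ v.2.1 v.2.2

theorem ringHom_matrix_apply_of_mem_closure {ρ : traceRing n g →+* Matrix (Fin n) (Fin n) L}
    (hρ : ∀ a, ρ (star a) = (ρ a).transpose) (κ : ℝ →+* L) {w : MatP n g}
    (hw : w ∈ Submonoid.closure (genSet n g)) :
    ρ ⟨w, closure_genSet_subset_traceRing hw⟩ =
      (MvPolynomial.eval₂Hom κ (genericEntries ρ)).mapMatrix w := by
  have hgen : ∀ j, ρ ⟨genMat n g j, genSet_subset_traceRing (Or.inl ⟨j, rfl⟩)⟩ =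
      (MvPolynomial.eval₂Hom κ (genericEntries ρ)).mapMatrix (genMat n g j) := by
    intro j
    ext a b
    simp [genMat, genericEntries]
  induction hw using Submonoid.closure_induction with
  | mem x hx =>
    rcases hx with ⟨j, rfl⟩ | ⟨j, rfl⟩
    · exact hgen j
    · refine (hρ ⟨genMat n g j, genSet_subset_traceRing (Or.inl ⟨j, rfl⟩)⟩).trans ?_
      rw [hgen]
      rfl
  | one => rw [map_one]; exact map_one ρ
  | mul x y hx hy ihx ihy =>
    rw [map_mul, ← ihx, ← ihy, ← map_mul]
    rfl

theorem eval₂_genericEntries {ρ : traceRing n g →+* Matrix (Fin n) (Fin n) L}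
    (hρ : ∀ a, ρ (star a) = (ρ a).transpose) (φ : wordTraces n g →+* L)
    (hφ : ∀ a, (ρ a).trace = φ (traceHom n g a)) (p : wordTraces n g) :
    MvPolynomial.eval₂ (φ.comp (algebraMap ℝ (wordTraces n g))) (genericEntries ρ) p.1 = φ p := by
  obtain ⟨p, hp⟩ := p
  rw [← MvPolynomial.coe_eval₂Hom]
  dsimp only
  induction hp using Algebra.adjoin_induction with
  | mem x hx =>
    obtain ⟨w, hw, rfl⟩ := hx
    refine Eq.trans ?_ (hφ ⟨w, closure_genSet_subset_traceRing hw⟩)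
    rw [ringHom_matrix_apply_of_mem_closure hρ (φ.comp (algebraMap ℝ (wordTraces n g))) hw]
    exact AddMonoidHom.map_trace _ w
  | algebraMap r => exact MvPolynomial.eval₂_C _ _ r
  | add x y hx hy ihx ihy =>
    rw [map_add, ihx, ihy, ← map_add]
    rfl
  | mul x y hx hy ihx ihy =>
    rw [map_mul, ihx, ihy, ← map_mul]
    rfl

/-- An element of the center that vanishes on the zero set of `J` is nilpotent modulo the
preordering of `J`, up to sign. -/
theorem IsTraceIdeal.exists_neg_pow_mem_centralPreorder (hn : 0 < n) (hJ : IsTraceIdeal J)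
    (c : wordTraces n g)
    (hc : ∀ X : Fin g → Matrix (Fin n) (Fin n) ℝ, (∀ u ∈ J, evalMat n g X u = 0) →
      MvPolynomial.eval (fun v => X v.1 v.2.1 v.2.2) c.1 = 0) :
    ∃ m : ℕ, -c ^ (2 * m) ∈ centralPreorder J := by
  by_contra! hcon
  obtain ⟨L, _, _, _, φ, hφ, hφc, hsq, hM, hL⟩ :=
    (IsTraceIdeal.isRingPreorder hn hJ).exists_point hcon
  obtain ⟨ρ, hρ, hφρ⟩ := (isMatrixTrace_comp_traceHom φ fun a => hφ _
    ⟨_, OmegaSet.trace_mul_transpose a.2, 0, hJ.zero, by rw [add_zero]; rfl⟩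
    ).exists_ringHom_matrix hM hsq
  have hev := eval₂_genericEntries hρ φ hφρ
  let S : Set (PolyRing n g) := {p | p ∈ wordTraces n g ∧ p • (1 : MatP n g) ∈ J}
  have hfg : (Ideal.span S).FG := (isNoetherianRing_iff_ideal_fg _).1 inferInstance _
  obtain ⟨G, hGS, hG⟩ := Submodule.fg_span_iff_fg_span_finset_subset S |>.1 hfg
  have hS : ∀ f ∈ S, MvPolynomial.eval₂ (φ.comp (algebraMap ℝ (wordTraces n g)))
      (genericEntries ρ) f = 0 := by
    rintro f ⟨hf, hfJ⟩
    rw [hev ⟨f, hf⟩]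
    refine le_antisymm ?_ (hφ _ ⟨0, OmegaSet.zero, _, hfJ, (zero_add _).symm⟩)
    rw [← neg_nonneg, ← map_neg]
    exact hφ _ ⟨0, OmegaSet.zero, _, hJ.neg _ hfJ, by
      rw [zero_add, ← neg_smul]; rfl⟩
  obtain ⟨r, hrG, hrc⟩ := exists_real_solution hL (φ.comp (algebraMap ℝ (wordTraces n g))) G c.1
    (genericEntries ρ) (fun f hf => hS f (hGS hf)) (by rwa [hev c])
  have hrS : ∀ f ∈ S, MvPolynomial.eval r f = 0 := by
    intro f hf
    have h1 : Ideal.span (G : Set (PolyRing n g)) ≤ RingHom.ker (MvPolynomial.eval r) :=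
      Ideal.span_le.2 hrG
    have h2 : f ∈ Ideal.span (G : Set (PolyRing n g)) := by
      have : f ∈ Ideal.span S := Ideal.subset_span hf
      rwa [Ideal.span, hG] at this
    exact h1 h2
  refine hrc (hc (fun j => Matrix.of fun a b => r (j, a, b)) fun u hu => ?_)
  have hut := transpose_mem_traceRing (hJ.mem_traceRing u hu)
  have h0 := hrS (Matrix.trace (u * uᵀ)) ⟨trace_mem_wordTraces (mul_mem (hJ.mem_traceRing u hu) hut),
    hJ.trace _ (hJ.mul _ hut u hu).2⟩
  have h1 : MvPolynomial.eval r (Matrix.trace (u * uᵀ)) =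
      Matrix.trace ((u.map (MvPolynomial.eval r)) * (u.map (MvPolynomial.eval r))ᴴ) := by
    simp [Matrix.trace, Matrix.mul_apply]
  rw [h1] at h0
  exact Matrix.trace_mul_conjTranspose_self_eq_zero_iff.1 h0

end TraceIdeal

section Certificate

variable {n g : ℕ} {J : Set (MatP n g)}

theorem coeff_charpoly_mem_wordTraces {s : MatP n g} (hs : s ∈ traceRing n g) {j : ℕ}
    (hj : j ≤ n) : s.charpoly.coeff j ∈ wordTraces n g := by
  have h := charpoly_coeff_eq_newtonSeq s (k := n - j) (by rw [Fintype.card_fin]; omega)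
  rw [Fintype.card_fin, Nat.sub_sub_self hj] at h
  rw [h]
  have h2 := coe_newtonSeq_wordTraces (fun i => traceHom n g (⟨s, hs⟩ ^ (i + 1))) (n - j)
  change _ = newtonSeq (fun i => (s ^ (i + 1)).trace) (n - j) at h2
  rw [← h2]
  exact SetLike.coe_mem _

theorem eval_coeff_charpoly_eq_zero {s : MatP n g} {X : Fin g → Matrix (Fin n) (Fin n) ℝ}
    (hs : evalMat n g X s = 0) {j : ℕ} (hj : j < n) :
    MvPolynomial.eval (fun v => X v.1 v.2.1 v.2.2) (s.charpoly.coeff j) = 0 := by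
  rw [← coeff_map, ← charpoly_map]
  change (charpoly (evalMat n g X s)).coeff j = 0
  rw [hs, charpoly_zero, Fintype.card_fin, coeff_X_pow, if_neg hj.ne]

theorem pow_add_sum_coeff_charpoly_smul (s : MatP n g) :
    s ^ n + ∑ j : Fin n, s.charpoly.coeff j • s ^ (j : ℕ) = 0 := by
  have h := aeval_self_charpoly s
  rw [aeval_eq_sum_range, charpoly_natDegree_eq_dim, Fintype.card_fin, Finset.sum_range_succ,
    Finset.sum_range] at h
  have h1 : s.charpoly.coeff n = 1 := by
    have := charpoly_monic s
    rwa [Monic, leadingCoeff, charpoly_natDegree_eq_dim, Fintype.card_fin] at this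
  rw [h1, one_smul, add_comm] at h
  exact h

theorem aeval_mem_traceRing {s : MatP n g} (hs : s ∈ traceRing n g) (r : (wordTraces n g)[X]) :
    aeval s r ∈ traceRing n g := by
  rw [aeval_eq_sum_range]
  exact sum_mem fun i _ => smul_mem_traceRing (r.coeff i).2 (pow_mem hs i)

theorem transpose_aeval {s : MatP n g} (hs : sᵀ = s) (r : (wordTraces n g)[X]) :
    (aeval s r)ᵀ = aeval s r := by
  rw [aeval_eq_sum_range, transpose_sum]
  refine Finset.sum_congr rfl fun i _ => ?_
  change ((r.coeff i).1 • s ^ i)ᵀ = (r.coeff i).1 • s ^ i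
  rw [transpose_smul, transpose_pow, hs]

/-- If `s` is a root of a monic polynomial, then a power of `s` is a combination of given powers of
the lower coefficients. -/
theorem exists_pow_eq_sum_of_add_sum_eq_zero {R A : Type*} [CommRing R] [Ring A] [Algebra R A]
    {s : A} {c : Fin n → R} (h : s ^ n + ∑ j, c j • s ^ (j : ℕ) = 0) (m : Fin n → ℕ) :
    ∃ (M : ℕ) (r : Fin n → R[X]), s ^ (n * M) = ∑ j, c j ^ m j • aeval s (r j) := by
  have h1 : -∑ j, C (c j) * X ^ (j : ℕ) ∈
      (Ideal.span (Set.range fun j => C (c j ^ m j))).radical := by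
    refine neg_mem (sum_mem fun j _ => Ideal.mul_mem_right _ _ ⟨m j, ?_⟩)
    rw [← C_pow]
    exact Ideal.subset_span ⟨j, rfl⟩
  obtain ⟨M, hM⟩ := h1
  obtain ⟨r, hr⟩ := Ideal.mem_span_range_iff_exists_fun.1 hM
  refine ⟨M, r, ?_⟩
  have h2 : aeval s (-∑ j, C (c j) * X ^ (j : ℕ)) = s ^ n := by
    rw [map_neg, map_sum, neg_eq_iff_add_eq_zero, add_comm]
    simpa only [map_mul, map_pow, aeval_X, aeval_C, ← Algebra.smul_def] using h
  have h3 := congrArg (aeval s) hr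
  rw [map_pow, h2, map_sum, ← pow_mul] at h3
  rw [← h3]
  refine Finset.sum_congr rfl fun j _ => ?_
  rw [map_mul, aeval_C, ← Algebra.commutes, Algebra.smul_def]

theorem IsTraceIdeal.neg_smul_eq (hn : 0 < n) (hJ : IsTraceIdeal J) {c : wordTraces n g}
    {m : ℕ} (hc : -c ^ (2 * m) ∈ centralPreorder J) {r : MatP n g} (hr : r ∈ traceRing n g)
    (hrt : rᵀ = r) :
    ∃ t ∈ ThetaSet n g, ∃ u ∈ J, -((c ^ (2 * m)) • r) = t + u := by
  obtain ⟨ω, hω, u, hu, e⟩ := hc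
  have hq : ∀ ε : ℝ, (1 / 2 : ℝ) • (r + ε • (1 : MatP n g)) ∈ traceRing n g := fun ε =>
    Subalgebra.smul_mem _ (add_mem hr (Subalgebra.smul_mem _ (one_mem _) _)) _
  have hqt : ∀ ε : ℝ, ((1 / 2 : ℝ) • (r + ε • (1 : MatP n g)))ᵀ =
      (1 / 2 : ℝ) • (r + ε • (1 : MatP n g)) := fun ε => by
    rw [transpose_smul, transpose_add, transpose_smul, transpose_one, hrt]
  set q₁ := (1 / 2 : ℝ) • (r + (-1 : ℝ) • (1 : MatP n g)) with hq₁
  set q₂ := (1 / 2 : ℝ) • (r + (1 : ℝ) • (1 : MatP n g)) with hq₂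
  have hdiff : q₂ * q₂ᵀ - q₁ * q₁ᵀ = r := by
    rw [hq₁, hq₂, hqt, hqt]
    simp only [mul_add, add_mul, mul_one, one_mul, smul_add, smul_smul,
      mul_smul_comm, smul_mul_assoc]
    module
  have h2 : q₂ * q₂ᵀ ∈ traceRing n g := mul_mem (hq 1) (transpose_mem_traceRing (hq 1))
  have hsq : (c ^ (2 * m)).1 • (1 : MatP n g) ∈ OmegaSet n g := by
    have := OmegaSet.sq hn (c ^ m).2
    have h3 : (c ^ m).1 ^ 2 = (c ^ (2 * m)).1 := by
      rw [mul_comm, pow_mul]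
      rfl
    rwa [h3] at this
  refine ⟨(c ^ (2 * m)).1 • (1 : MatP n g) * (q₁ * q₁ᵀ) + ω * (q₂ * q₂ᵀ), ?_,
    u * (q₂ * q₂ᵀ), (hJ.mul _ h2 _ hu).2, ?_⟩
  · exact AddSubmonoid.add_mem _
      (AddSubmonoid.subset_closure ⟨_, hsq, q₁, hq _, rfl⟩)
      (AddSubmonoid.subset_closure ⟨_, hω, q₂, hq _, rfl⟩)
  · rw [add_assoc, ← add_mul, ← e]
    change -((c ^ (2 * m)).1 • r) = _ + (-(c ^ (2 * m)).1) • (1 : MatP n g) * _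
    rw [smul_one_mul, smul_one_mul, neg_smul, ← sub_eq_add_neg, ← neg_sub, ← smul_sub, hdiff]

theorem IsTraceIdeal.exists_sum_eq (hJ : IsTraceIdeal J) {ι : Type*} (s : Finset ι)
    (f : ι → MatP n g) (hf : ∀ i ∈ s, ∃ t ∈ ThetaSet n g, ∃ u ∈ J, f i = t + u) :
    ∃ t ∈ ThetaSet n g, ∃ u ∈ J, ∑ i ∈ s, f i = t + u := by
  refine Finset.sum_induction f (fun x => ∃ t ∈ ThetaSet n g, ∃ u ∈ J, x = t + u) ?_
    ⟨0, AddSubmonoid.zero_mem _, 0, hJ.zero, (add_zero _).symm⟩ hf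
  rintro _ _ ⟨t, ht, u, hu, rfl⟩ ⟨t', ht', u', hu', rfl⟩
  exact ⟨t + t', AddSubmonoid.add_mem _ ht ht', u + u', hJ.add _ hu _ hu', by abel⟩

theorem IsTraceIdeal.exists_neg_pow_eq (hn : 0 < n) (hJ : IsTraceIdeal J) {s : MatP n g}
    (hs : s ∈ traceRing n g) (hst : sᵀ = s) (h0 : ∀ X : Fin g → Matrix (Fin n) (Fin n) ℝ,
      (∀ u ∈ J, evalMat n g X u = 0) → evalMat n g X s = 0) :
    ∃ k : ℕ, ∃ t ∈ ThetaSet n g, ∃ u ∈ J, -(s ^ k) = t + u := by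
  obtain ⟨c, hc⟩ : ∃ c : Fin n → wordTraces n g, ∀ j, (c j).1 = s.charpoly.coeff j :=
    ⟨fun j => ⟨_, coeff_charpoly_mem_wordTraces hs j.2.le⟩, fun _ => rfl⟩
  choose m hm using fun j => IsTraceIdeal.exists_neg_pow_mem_centralPreorder hn hJ (c j)
    fun X hX => by rw [hc]; exact eval_coeff_charpoly_eq_zero (h0 X hX) j.2
  have hsum : s ^ n + ∑ j, c j • s ^ (j : ℕ) = 0 := by
    rw [← pow_add_sum_coeff_charpoly_smul s]
    simp only [← hc]
    rfl
  have hpow := exists_pow_eq_sum_of_add_sum_eq_zero (R := wordTraces n g) (A := MatP n g) (s := s)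
    (c := c)
  obtain ⟨M, r, hr⟩ := hpow hsum fun j => 2 * m j
  refine ⟨n * M, ?_⟩
  rw [hr, ← Finset.sum_neg_distrib]
  refine hJ.exists_sum_eq _ _ fun j _ => ?_
  exact hJ.neg_smul_eq hn (hm j)
    (aeval_mem_traceRing hs _) (transpose_aeval hst _)

end Certificate

/-- Real Nullstellensatz for trace polynomials. -/
theorem stmt13 (n g : ℕ) (hn : 0 < n) (hg : 0 < g)
    (J : Set (MatP n g))
    (hJsub : ∀ u ∈ J, u ∈ traceRing n g)
    (hJ0 : (0 : MatP n g) ∈ J)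
    (hJadd : ∀ u ∈ J, ∀ v ∈ J, u + v ∈ J)
    (hJneg : ∀ u ∈ J, -u ∈ J)
    (hJmul : ∀ h ∈ traceRing n g, ∀ u ∈ J, h * u ∈ J ∧ u * h ∈ J)
    (hJtr : ∀ u ∈ J, (Matrix.trace u) • (1 : MatP n g) ∈ J)
    (h : MatP n g) (hh : h ∈ traceRing n g) :
    (∀ X : Fin g → Matrix (Fin n) (Fin n) ℝ,
        (∀ u ∈ J, evalMat n g X u = 0) → evalMat n g X h = 0) ↔
      ∃ k : ℕ, ∃ t ∈ ThetaSet n g, ∃ u ∈ J, -((hᵀ * h) ^ k) = t + u :=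
  ⟨fun h0 => IsTraceIdeal.exists_neg_pow_eq hn ⟨hJsub, hJ0, hJadd, hJneg, hJmul, hJtr⟩
      (mul_mem (transpose_mem_traceRing hh) hh) (by rw [transpose_mul, transpose_transpose])
      fun X hX => by rw [evalMat_eq_mapMatrix, map_mul, ← evalMat_eq_mapMatrix _ h, h0 X hX, mul_zero],
    fun ⟨_, _, ht, _, hu, e⟩ _ hX => evalMat_eq_zero_of_neg_pow_eq ht hu e hX⟩
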